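/- Suppose Assumption (V) and Assumption (φ) hold. Let a, b ∈ ℝ with a < b and a, b ∉ σ(H). Then a, b ∉ σ(H_h) for all sufficiently small h > 0, and ‖P_h* E_{H_h}((a,b)) P_h − E_H((a,b))‖_{B(L²(ℝ^d))} → 0 as h → 0, where E_A(Ω) denotes the spectral projection of a self-adjoint operator A associated to Ω ⊂ ℝ. -/

import Mathlib

open MeasureTheory Complex Real
open scoped FourierTransform InnerProductSpace ENNReal ComplexConjugate

noncomputable section

abbrev Euc (d : ℕ) : Type := EuclideanSpace ℝ (Fin d)
abbrev Zd (d : ℕ) : Type := Fin d → ℤ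

instance (d : ℕ) : MeasurableSingletonClass (Zd d) := by
  constructor
  intro f
  have : ({f} : Set (Zd d)) = Set.univ.pi fun j => {f j} := by
    ext g; simp [Set.eq_univ_iff_forall, funext_iff, Set.mem_pi, eq_comm]
  rw [this]
  exact MeasurableSet.univ_pi fun j => measurableSet_singleton _

/-- The measure on `ℤ^d` giving mass `h^d` to each point, so that `L²` of this measure is
`ℓ²(hℤ^d)` with norm `‖v‖_h² = h^d ∑_z |v(hz)|²`. -/
def latMeas (d : ℕ) (h : ℝ) : Measure (Zd d) := (ENNReal.ofReal (h ^ d)) • Measure.count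

/-- `L²(ℝ^d)`. -/
abbrev L2 (d : ℕ) := Lp ℂ 2 (volume : Measure (Euc d))

/-- `ℓ²(hℤ^d)`. -/
abbrev l2h (d : ℕ) (h : ℝ) := Lp ℂ 2 (latMeas d h)

/-- The lattice point `hz ∈ ℝ^d` associated to `z ∈ ℤ^d`. -/
def latPt (d : ℕ) (h : ℝ) (z : Zd d) : Euc d :=
  (EuclideanSpace.equiv (Fin d) ℝ).symm fun j => h * (z j : ℝ)

/-- The vector in `ℝ^d` associated to `n ∈ ℤ^d`. -/
def latVec (d : ℕ) (n : Zd d) : Euc d :=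
  (EuclideanSpace.equiv (Fin d) ℝ).symm fun j => (n j : ℝ)

/-- `P_h : L²(ℝ^d) → ℓ²(hℤ^d)`, `P_h u (z) = h^{−d} ∫ conj(φ(h⁻¹(x−z))) u(x) dx`. -/
def IsProjOp (d : ℕ) (h : ℝ) (φ : SchwartzMap (Euc d) ℂ)
    (Ph : L2 d →L[ℂ] l2h d h) : Prop :=
  ∀ u : L2 d, ∀ z : Zd d,
    (Ph u : Zd d → ℂ) z =
      (h ^ d : ℂ)⁻¹ * ∫ x, conj (φ (h⁻¹ • (x - latPt d h z))) * (u : Euc d → ℂ) x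

/-- The Laplacian `Δu(x) = ∑_j ∂²u/∂x_j²(x)` of a function on `ℝ^d`. -/
def lapl (d : ℕ) (u : Euc d → ℂ) (x : Euc d) : ℂ :=
  ∑ j : Fin d, fderiv ℝ (fun y => fderiv ℝ u y (EuclideanSpace.single j (1 : ℝ))) x
      (EuclideanSpace.single j (1 : ℝ))

/-- `H` is the continuum Schrödinger operator `−Δ + V`:  a self-adjoint operator on
`L²(ℝ^d)` whose action on every smooth compactly supported function is `−Δu + Vu`.
(Under Assumption (V), `−Δ + V` is essentially self-adjoint on `C_c^∞(ℝ^d)`, so these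
conditions uniquely determine `H` as its self-adjoint closure.) -/
def IsSchrodingerOp (d : ℕ) (V : Euc d → ℝ) (H : L2 d →ₗ.[ℂ] L2 d) : Prop :=
  IsSelfAdjoint H ∧
  ∀ (u : Euc d → ℂ) (_ : ContDiff ℝ (⊤ : ℕ∞) u) (_ : HasCompactSupport u)
    (hu2 : MemLp u 2 (volume : Measure (Euc d)))
    (hHu2 : MemLp (fun x => -(lapl d u x) + (V x : ℂ) * u x) 2 (volume : Measure (Euc d))),
    ∃ hdom : hu2.toLp u ∈ H.domain,
      H ⟨hu2.toLp u, hdom⟩ = hHu2.toLp (fun x => -(lapl d u x) + (V x : ℂ) * u x)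

/-- The pointwise action of the discrete Schrödinger operator `H_h = H_{0,h} + V`:
`(H_h v)(hz) = h⁻² ∑_j (2v(hz) − v(hz+he_j) − v(hz−he_j)) + V(hz) v(hz)`. -/
def discAct (d : ℕ) (h : ℝ) (V : Euc d → ℝ) (v : Zd d → ℂ) (z : Zd d) : ℂ :=
  (h ^ 2 : ℂ)⁻¹ * ∑ j : Fin d, (2 * v z - v (z + Pi.single j 1) - v (z - Pi.single j 1))
    + (V (latPt d h z) : ℂ) * v z

/-- `H_h` is the (self-adjoint) discrete Schrödinger operator `H_{0,h} + V` on `ℓ²(hℤ^d)`,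
with its natural (maximal) domain. -/
def IsDiscreteHam (d : ℕ) (h : ℝ) (V : Euc d → ℝ)
    (Hh : l2h d h →ₗ.[ℂ] l2h d h) : Prop :=
  (∀ v : l2h d h,
    MemLp (discAct d h V (v : Zd d → ℂ)) 2 (latMeas d h) → v ∈ Hh.domain) ∧
  (∀ v : Hh.domain, ∀ z : Zd d,
    (Hh v : Zd d → ℂ) z = discAct d h V ((v : l2h d h) : Zd d → ℂ) z)

/-- `R` is the resolvent `(H − μ)⁻¹` of the (possibly unbounded) operator `H`:  a bounded
operator which is a two-sided inverse of `H − μ`. -/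
def IsResolventAt {E : Type*} [NormedAddCommGroup E] [NormedSpace ℂ E]
    (H : E →ₗ.[ℂ] E) (μ : ℂ) (R : E →L[ℂ] E) : Prop :=
  (∀ w : E, ∃ hd : R w ∈ H.domain, H ⟨R w, hd⟩ - μ • R w = w) ∧
  (∀ u : H.domain, R (H u - μ • (u : E)) = u)

/-- `ν` is the family of diagonal spectral measures `u ↦ (Ω ↦ ⟨u, E_H(Ω)u⟩)` of the
self-adjoint operator `H`:  a family of finite Borel measures on `ℝ` satisfying the
resolvent formula `⟨u, (H−μ)⁻¹u⟩ = ∫ (λ−μ)⁻¹ dν_u(λ)` for every non-real `μ`.  (These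
conditions determine `ν` uniquely, and by polarization they determine the projection-valued
spectral measure of `H`.) -/
def IsSpectralMeasureFamily {E : Type*} [NormedAddCommGroup E] [InnerProductSpace ℂ E]
    (H : E →ₗ.[ℂ] E) (ν : E → MeasureTheory.Measure ℝ) : Prop :=
  (∀ u : E, IsFiniteMeasure (ν u)) ∧
  ∀ μ : ℂ, μ.im ≠ 0 → ∀ R : E →L[ℂ] E, IsResolventAt H μ R →
    ∀ u : E, (inner ℂ u (R u) : ℂ) = ∫ l : ℝ, ((l : ℂ) - μ)⁻¹ ∂(ν u)

section

section Resolvent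

variable {E : Type*} [NormedAddCommGroup E] [NormedSpace ℂ E]

/-- `X` is a two-sided inverse of `1 - z T`. -/
def IsInvOneSub (T : E →L[ℂ] E) (z : ℂ) (X : E →L[ℂ] E) : Prop :=
  (1 - z • T) * X = 1 ∧ X * (1 - z • T) = 1

lemma IsInvOneSub.right_apply {T X : E →L[ℂ] E} {z : ℂ} (hX : IsInvOneSub T z X) (w : E) :
    X w - z • T (X w) = w := by
  simpa using DFunLike.congr_fun hX.1 w

lemma IsInvOneSub.left_apply {T X : E →L[ℂ] E} {z : ℂ} (hX : IsInvOneSub T z X) (w : E) :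
    X (w - z • T w) = w := by
  simpa using DFunLike.congr_fun hX.2 w

lemma IsInvOneSub.comm {T X : E →L[ℂ] E} {z : ℂ} (hX : IsInvOneSub T z X) : T * X = X * T := by
  have h1 : T * (1 - z • T) = (1 - z • T) * T := by
    simp [mul_sub, sub_mul]
  calc T * X = (X * (1 - z • T)) * (T * X) := by rw [hX.2, one_mul]
    _ = X * (T * (1 - z • T)) * X := by rw [h1]; simp [mul_assoc]
    _ = X * T * ((1 - z • T) * X) := by simp [mul_assoc]
    _ = X * T := by rw [hX.1, mul_one]

/-- Moving the spectral parameter of a resolvent from `μ` to `μ + z`. -/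
lemma IsResolventAt.shift {H : E →ₗ.[ℂ] E} {μ z : ℂ} {R X : E →L[ℂ] E}
    (hR : IsResolventAt H μ R) (hX : IsInvOneSub R z X) :
    IsResolventAt H (μ + z) (R * X) := by
  refine ⟨fun w => ?_, fun u => ?_⟩
  · obtain ⟨hd, he⟩ := hR.1 (X w)
    refine ⟨hd, ?_⟩
    have h2 := hX.right_apply w
    simp only [mul_apply_eq_comp]
    rw [add_smul, ← sub_sub, he, h2]
  · have h1 := hR.2 u
    have h2 : H u - (μ + z) • (u : E)
        = (H u - μ • (u : E)) - z • R (H u - μ • (u : E)) := by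
      rw [h1, add_smul, sub_sub]
    rw [h2, mul_apply_eq_comp, hX.left_apply, h1]

/-- The resolvent identity. -/
lemma IsResolventAt.identity {H : E →ₗ.[ℂ] E} {μ μ' : ℂ} {R R' : E →L[ℂ] E}
    (hR : IsResolventAt H μ R) (hR' : IsResolventAt H μ' R') :
    R' = R + (μ' - μ) • (R * R') := by
  ext w
  obtain ⟨hd, he⟩ := hR'.1 w
  have h1 := hR.2 ⟨R' w, hd⟩
  have h2 : H ⟨R' w, hd⟩ - μ • R' w = w + (μ' - μ) • R' w := by
    rw [sub_eq_iff_eq_add] at he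
    rw [he, sub_smul]; abel
  simp only at h1
  rw [h2] at h1
  simpa using h1.symm

lemma IsResolventAt.unique {H : E →ₗ.[ℂ] E} {μ : ℂ} {R R' : E →L[ℂ] E}
    (hR : IsResolventAt H μ R) (hR' : IsResolventAt H μ R') : R' = R := by
  simpa using hR.identity hR'

lemma IsResolventAt.isInvOneSub {H : E →ₗ.[ℂ] E} {μ μ' : ℂ} {R R' : E →L[ℂ] E}
    (hR : IsResolventAt H μ R) (hR' : IsResolventAt H μ' R') :
    IsInvOneSub R (μ' - μ) (1 + (μ' - μ) • R') := by
  have h1 := hR.identity hR'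
  have h2 := hR'.identity hR
  have h3 : R' = R + (μ' - μ) • (R' * R) := by
    have h4 : (μ' - μ) • (R' * R) = -((μ - μ') • (R' * R)) := by
      rw [← neg_smul, neg_sub]
    rw [h4, eq_add_neg_iff_add_eq]
    exact h2.symm
  constructor
  · have : (1 - (μ' - μ) • R) * (1 + (μ' - μ) • R')
        = 1 + (μ' - μ) • (R' - (R + (μ' - μ) • (R * R'))) := by
      simp only [mul_add, sub_mul, mul_one, one_mul, smul_mul_smul_comm, smul_sub, smul_add,
        smul_smul]
      abel
    rw [this, ← h1]; simp
  · have : (1 + (μ' - μ) • R') * (1 - (μ' - μ) • R)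
        = 1 + (μ' - μ) • (R' - (R + (μ' - μ) • (R' * R))) := by
      simp only [add_mul, mul_sub, mul_one, one_mul, smul_mul_smul_comm, smul_sub, smul_add,
        smul_smul]
      abel
    rw [this, ← h3]; simp

end Resolvent

section SelfAdj

variable {E : Type*} [NormedAddCommGroup E] [InnerProductSpace ℂ E] [CompleteSpace E]

lemma IsInvOneSub.isSelfAdjoint {T X : E →L[ℂ] E} {r : ℝ} (hT : IsSelfAdjoint T)
    (hX : IsInvOneSub T (r : ℂ) X) : IsSelfAdjoint (T * X) := by
  have h0 : star (1 - (r : ℂ) • T) = 1 - (r : ℂ) • T := by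
    simp [hT.star_eq]
  have h1 : (1 - (r : ℂ) • T) * star X = 1 := by
    have := congrArg star hX.2
    rwa [star_mul, h0, star_one] at this
  have h2 : star X = X := by
    calc star X = X * (1 - (r : ℂ) • T) * star X := by rw [hX.2, one_mul]
      _ = X := by rw [mul_assoc, h1, mul_one]
  rw [IsSelfAdjoint, star_mul, hT.star_eq, h2, hX.comm]

lemma IsSelfAdjoint.inner_apply_im {S : E →L[ℂ] E} (hS : IsSelfAdjoint S) (w : E) :
    (inner ℂ w (S w) : ℂ).im = 0 := by
  have h : inner ℂ (S w) w = inner ℂ w (S w) := hS.isSymmetric w w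
  have h2 := inner_conj_symm (𝕜 := ℂ) w (S w)
  rw [h] at h2
  exact Complex.conj_eq_iff_im.mp h2

lemma norm_sq_sub_I_smul {S : E →L[ℂ] E} (hS : IsSelfAdjoint S) (y : ℝ) (w : E) :
    ‖w - ((y : ℂ) * I) • S w‖ ^ 2 = ‖w‖ ^ 2 + y ^ 2 * ‖S w‖ ^ 2 := by
  rw [@norm_sub_sq ℂ, inner_smul_right, norm_smul]
  have := hS.inner_apply_im w
  simp [mul_pow, this]

lemma exists_isInvOneSub_I {S : E →L[ℂ] E} (hS : IsSelfAdjoint S) (y : ℝ) :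
    ∃ X : E →L[ℂ] E, IsInvOneSub S ((y : ℂ) * I) X := by
  have hu : IsUnit (1 - ((y : ℂ) * I) • S) := by
    by_cases hy : y = 0
    · simp [hy]
    have hz : ((y : ℂ) * I) ≠ 0 := by simp [hy]
    have h1 : ((y : ℂ) * I)⁻¹ ∉ spectrum ℂ S := by
      intro hm
      have := hS.mem_spectrum_eq_re hm
      have h3 := congrArg Complex.im this
      simp at h3
      exact hy h3
    rw [spectrum.notMem_iff] at h1
    have h2 : (1 - ((y : ℂ) * I) • S)
        = (algebraMap ℂ (E →L[ℂ] E) ((y : ℂ) * I)) *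
          (algebraMap ℂ (E →L[ℂ] E) ((y : ℂ) * I)⁻¹ - S) := by
      rw [mul_sub, ← map_mul, mul_inv_cancel₀ hz, map_one, Algebra.smul_def]
    rw [h2]
    exact ((isUnit_iff_ne_zero.mpr hz).map _).mul h1
  obtain ⟨v, hv⟩ := hu
  exact ⟨↑v⁻¹, by rw [← hv]; simp, by rw [← hv]; simp⟩

lemma IsInvOneSub.norm_le_one {S X : E →L[ℂ] E} (hS : IsSelfAdjoint S) {y : ℝ}
    (hX : IsInvOneSub S ((y : ℂ) * I) X) : ‖X‖ ≤ 1 := by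
  refine X.opNorm_le_bound zero_le_one fun w => ?_
  have h1 := norm_sq_sub_I_smul hS y (X w)
  rw [hX.right_apply w] at h1
  rw [one_mul]
  refine le_of_sq_le_sq ?_ (norm_nonneg _)
  rw [h1]; nlinarith [sq_nonneg (y * ‖S (X w)‖)]

lemma IsInvOneSub.norm_mul_le {S X : E →L[ℂ] E} (hS : IsSelfAdjoint S) {y : ℝ} (hy : y ≠ 0)
    (hX : IsInvOneSub S ((y : ℂ) * I) X) : ‖S * X‖ ≤ |y|⁻¹ := by
  refine ContinuousLinearMap.opNorm_le_bound _ (by positivity) fun w => ?_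
  have h1 := norm_sq_sub_I_smul hS y (X w)
  rw [hX.right_apply w] at h1
  have h2 : |y| * ‖S (X w)‖ ≤ ‖w‖ := by
    refine le_of_sq_le_sq ?_ (norm_nonneg _)
    rw [h1, mul_pow, sq_abs]; nlinarith [sq_nonneg ‖X w‖]
  rw [mul_apply_eq_comp, inv_mul_eq_div, le_div_iff₀ (abs_pos.mpr hy)]
  linarith

omit [CompleteSpace E] in
lemma norm_le_of_quadratic_form_le {D : E →L[ℂ] E} {κ : ℝ} (hκ : 0 ≤ κ)
    (h : ∀ u, ‖(inner ℂ u (D u) : ℂ)‖ ≤ κ * ‖u‖ ^ 2) : ‖D‖ ≤ 2 * κ := by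
  have h1 : ∀ x y : E, ‖(inner ℂ (D y) x : ℂ)‖ ≤ κ * (‖x‖ ^ 2 + ‖y‖ ^ 2) := fun x y => by
    have h2 := inner_map_polarization (D : E →ₗ[ℂ] E) x y
    have h3 : ∀ w, ‖(inner ℂ (D w) w : ℂ)‖ ≤ κ * ‖w‖ ^ 2 := fun w => by
      rw [norm_inner_symm]; exact h w
    have p1 := parallelogram_law_with_norm ℂ x y
    have p2 := parallelogram_law_with_norm ℂ x (I • y)
    rw [norm_smul, norm_I, one_mul] at p2
    simp only [ContinuousLinearMap.coe_coe] at h2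
    rw [h2, norm_div]
    have h4 : ‖(4 : ℂ)‖ = 4 := by simp
    rw [h4, div_le_iff₀ (by norm_num)]
    refine (norm_sub_le _ _).trans ?_
    refine (add_le_add_left (norm_add_le _ _) _).trans ?_
    refine (add_le_add_left (add_le_add_left (norm_sub_le _ _) _) _).trans ?_
    simp only [norm_mul, norm_I, one_mul]
    have := h3 (x + y)
    have := h3 (x - y)
    have := h3 (x + I • y)
    have := h3 (x - I • y)
    nlinarith
  refine ContinuousLinearMap.opNorm_le_of_unit_norm (by positivity) fun x hx => ?_
  by_cases h0 : D x = 0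
  · rw [h0, norm_zero]; positivity
  have hn : ‖D x‖ ≠ 0 := norm_ne_zero_iff.mpr h0
  have h2 := h1 ((‖D x‖⁻¹ : ℂ) • D x) x
  rw [inner_smul_right, inner_self_eq_norm_sq_to_K, norm_smul, hx] at h2
  simp only [norm_mul, norm_inv, norm_pow, Complex.norm_real, norm_norm, coe_algebraMap] at h2
  rw [inv_mul_cancel₀ hn] at h2
  have h5 : ‖D x‖⁻¹ * ‖D x‖ ^ 2 = ‖D x‖ := by field_simp
  rw [h5] at h2
  linarith

end SelfAdj

end

section

section Stieltjes

variable {ν : Measure ℝ} [IsFiniteMeasure ν] {a b : ℝ}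

/-- The conjugate Poisson kernel. -/
def cpk (a l y : ℝ) : ℝ := (l - a) / ((l - a) ^ 2 + y ^ 2)

lemma abs_cpk_le (a l y : ℝ) : |cpk a l y| ≤ |l - a|⁻¹ := by
  unfold cpk
  by_cases h : l = a
  · simp [h]
  have h0 : 0 < |l - a| := abs_pos.mpr (sub_ne_zero.mpr h)
  rw [abs_div, abs_of_nonneg (show 0 ≤ (l - a) ^ 2 + y ^ 2 by positivity), ← sq_abs (l - a),
    inv_eq_one_div, div_le_div_iff₀ (by positivity) h0]
  nlinarith [sq_nonneg y]

lemma measurable_cpk (a : ℝ) : Measurable fun p : ℝ × ℝ => cpk a p.1 p.2 := by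
  unfold cpk; fun_prop

/-- A finite measure whose Poisson-type integrals at `a` stay bounded does not charge `a`. -/
lemma measure_singleton_eq_zero_of_bound {C : ℝ}
    (hC : ∀ y : ℝ, 0 < y → ∫ l, ((l - a) ^ 2 + y ^ 2)⁻¹ ∂ν ≤ C) : ν {a} = 0 := by
  have h1 : ∀ y : ℝ, 0 < y → ν.real {a} ≤ C * y ^ 2 := fun y hy => by
    have hIntg : Integrable (fun l : ℝ => ((l - a) ^ 2 + y ^ 2)⁻¹) ν := by
      refine (integrable_const ((y ^ 2)⁻¹)).mono' (by fun_prop) (ae_of_all _ fun l => ?_)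
      rw [Real.norm_of_nonneg (by positivity)]
      gcongr; nlinarith [sq_nonneg (l - a)]
    have h2 : ∫ l, Set.indicator {a} (fun _ => (y ^ 2)⁻¹) l ∂ν
        ≤ ∫ l, ((l - a) ^ 2 + y ^ 2)⁻¹ ∂ν := by
      refine integral_mono ((integrable_const _).indicator (measurableSet_singleton a)) hIntg
        fun l => ?_
      by_cases hl : l = a
      · simp [hl]
      · simp only [Set.indicator, Set.mem_singleton_iff, hl, if_false]; positivity
    rw [integral_indicator_const _ (measurableSet_singleton a), smul_eq_mul] at h2
    have h3 := h2.trans (hC y hy)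
    rwa [← div_eq_mul_inv, div_le_iff₀ (by positivity)] at h3
  have h2 : Filter.Tendsto (fun y : ℝ => C * y ^ 2) (nhdsWithin 0 (Set.Ioi 0)) (nhds 0) := by
    have : Continuous fun y : ℝ => C * y ^ 2 := by fun_prop
    simpa using (this.tendsto 0).mono_left nhdsWithin_le_nhds
  have h3 : ν.real {a} ≤ 0 :=
    ge_of_tendsto h2 (by filter_upwards [self_mem_nhdsWithin] with y hy using h1 y hy)
  exact (measureReal_eq_zero_iff).1 (le_antisymm h3 measureReal_nonneg)

lemma integrable_inv_abs_of_bound {C : ℝ}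
    (hC : ∀ y : ℝ, 0 < y → ∫ l, ((l - a) ^ 2 + y ^ 2)⁻¹ ∂ν ≤ C) :
    Integrable (fun l => |l - a|⁻¹) ν := by
  have hIntg : ∀ y : ℝ, 0 < y → Integrable (fun l : ℝ => ((l - a) ^ 2 + y ^ 2)⁻¹) ν := by
    intro y hy
    refine (integrable_const ((y ^ 2)⁻¹)).mono' (by fun_prop) (ae_of_all _ fun l => ?_)
    rw [Real.norm_of_nonneg (by positivity)]
    gcongr; nlinarith [sq_nonneg (l - a)]
  have hsq : Integrable (fun l => ((l - a) ^ 2)⁻¹) ν := by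
    refine ⟨by fun_prop, ?_⟩
    let f : ℕ → ℝ → ℝ≥0∞ := fun n l => ENNReal.ofReal (((l - a) ^ 2 + (1 / ((n : ℝ) + 1)) ^ 2)⁻¹)
    have h1 : ∀ l, ‖((l - a) ^ 2)⁻¹‖ₑ ≤ Filter.liminf (fun n => f n l) Filter.atTop := by
      intro l
      by_cases hl : l = a
      · simp [hl]
      have h2 : Filter.Tendsto (fun n => f n l) Filter.atTop
          (nhds (ENNReal.ofReal (((l - a) ^ 2 + 0 ^ 2)⁻¹))) := by
        refine ENNReal.tendsto_ofReal (Filter.Tendsto.inv₀ ?_ ?_)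
        · exact tendsto_const_nhds.add (tendsto_one_div_add_atTop_nhds_zero_nat.pow 2)
        · have := sub_ne_zero.mpr hl; positivity
      rw [h2.liminf_eq, Real.enorm_of_nonneg (by positivity)]
      simp
    have h3 : ∀ n, ∫⁻ l, f n l ∂ν ≤ ENNReal.ofReal C := fun n => by
      rw [← ofReal_integral_eq_lintegral_ofReal (hIntg _ (by positivity))
        (ae_of_all _ fun l => by positivity)]
      exact ENNReal.ofReal_le_ofReal (hC _ (by positivity))
    calc ∫⁻ l, ‖((l - a) ^ 2)⁻¹‖ₑ ∂ν ≤ ∫⁻ l, Filter.liminf (fun n => f n l) Filter.atTop ∂ν :=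
          lintegral_mono h1
      _ ≤ Filter.liminf (fun n => ∫⁻ l, f n l ∂ν) Filter.atTop :=
          lintegral_liminf_le fun n => by fun_prop
      _ ≤ ENNReal.ofReal C := by
          refine Filter.liminf_le_of_le (by isBoundedDefault) fun b hb => ?_
          obtain ⟨n, hn⟩ := hb.exists
          exact hn.trans (h3 n)
      _ < ⊤ := ENNReal.ofReal_lt_top
  refine ((integrable_const (1 : ℝ)).add hsq).mono' (by fun_prop) (ae_of_all _ fun l => ?_)
  rw [Real.norm_of_nonneg (by positivity)]
  show |l - a|⁻¹ ≤ 1 + ((l - a) ^ 2)⁻¹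
  rw [← sq_abs (l - a), ← inv_pow]
  nlinarith [sq_nonneg (|l - a|⁻¹ - 1)]

omit [IsFiniteMeasure ν] in
lemma integrable_cpk_prod (ha : Integrable (fun l => |l - a|⁻¹) ν) (Y : ℝ) :
    Integrable (fun p : ℝ × ℝ => cpk a p.1 p.2) (ν.prod (volume.restrict (Set.uIoc (-Y) Y))) := by
  have h1 : Integrable (fun _ : ℝ => (1 : ℝ)) (volume.restrict (Set.uIoc (-Y) Y)) :=
    integrable_const_iff.mpr (Or.inr ⟨by simp [Set.uIoc]⟩)
  refine (ha.mul_prod h1).mono' (measurable_cpk a).aestronglyMeasurable (ae_of_all _ fun p => ?_)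
  simpa using abs_cpk_le a p.1 p.2

lemma intervalIntegrable_cpk (ha : Integrable (fun l => |l - a|⁻¹) ν) (Y : ℝ) :
    IntervalIntegrable (fun y => ∫ l, cpk a l y ∂ν) volume (-Y) Y := by
  rw [intervalIntegrable_iff]
  exact (integrable_cpk_prod ha Y).integral_prod_right

lemma intervalIntegral_cpk (ha : Integrable (fun l => |l - a|⁻¹) ν) (h0 : ν {a} = 0)
    {Y : ℝ} (hY : 0 ≤ Y) :
    ∫ y in (-Y)..Y, ∫ l, cpk a l y ∂ν = ∫ l, 2 * Real.arctan (Y / (l - a)) ∂ν := by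
  have h1 : ∀ᵐ l ∂ν, ∫ y in (-Y)..Y, cpk a l y = 2 * Real.arctan (Y / (l - a)) := by
    have : ∀ᵐ l ∂ν, l ≠ a := by
      rw [ae_iff]; simpa using h0
    filter_upwards [this] with l hl
    have hs : l - a ≠ 0 := sub_ne_zero.mpr hl
    have hd : ∀ y ∈ Set.uIcc (-Y) Y, HasDerivAt (fun y => Real.arctan (y / (l - a))) (cpk a l y) y := by
      intro y _
      have := ((hasDerivAt_id y).div_const (l - a)).arctan
      refine this.congr_deriv ?_
      simp only [cpk]
      have : (l - a) ^ 2 + y ^ 2 ≠ 0 := by positivity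
      simp only [id]
      field_simp
    rw [intervalIntegral.integral_eq_sub_of_hasDerivAt hd]
    · rw [neg_div, Real.arctan_neg]; ring
    · refine Continuous.intervalIntegrable ?_ _ _
      unfold cpk
      exact Continuous.div (by fun_prop) (by fun_prop) fun y => by positivity
  rw [← integral_congr_ae h1]
  have hle : -Y ≤ Y := by linarith
  simp only [intervalIntegral.integral_of_le hle]
  have h2 := integrable_cpk_prod ha Y
  rw [Set.uIoc_of_le hle] at h2
  exact (integral_integral_swap h2).symm

lemma tendsto_integral_arctan (h0 : ν {a} = 0) :
    Filter.Tendsto (fun Y : ℝ => ∫ l, 2 * Real.arctan (Y / (l - a)) ∂ν) Filter.atTop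
      (nhds (∫ l, π * Real.sign (l - a) ∂ν)) := by
  refine tendsto_integral_filter_of_dominated_convergence (fun _ => π)
    (Filter.Eventually.of_forall fun Y => ?_) (Filter.Eventually.of_forall fun Y =>
      ae_of_all _ fun l => ?_) (integrable_const _) ?_
  · exact (measurable_const.mul (Real.measurable_arctan.comp (by fun_prop))).aestronglyMeasurable
  · rw [Real.norm_eq_abs, abs_mul, abs_two]
    have := (abs_lt.mpr ⟨Real.neg_pi_div_two_lt_arctan (Y / (l - a)), Real.arctan_lt_pi_div_two _⟩)
    linarith
  · have : ∀ᵐ l ∂ν, l ≠ a := by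
      rw [ae_iff]; simpa using h0
    filter_upwards [this] with l hl
    rcases lt_or_gt_of_ne hl with h | h
    · have hs : l - a < 0 := by linarith
      rw [Real.sign_of_neg hs, mul_neg_one]
      have h1 : Filter.Tendsto (fun Y : ℝ => Y / (l - a)) Filter.atTop Filter.atBot :=
        Filter.tendsto_id.atTop_div_const_of_neg hs
      have h2 := (Real.tendsto_arctan_atBot.mono_right nhdsWithin_le_nhds).comp h1
      have h3 := h2.const_mul 2
      rwa [show 2 * (-(π / 2)) = -π by ring] at h3
    · have hs : 0 < l - a := by linarith
      rw [Real.sign_of_pos hs, mul_one]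
      have h1 : Filter.Tendsto (fun Y : ℝ => Y / (l - a)) Filter.atTop Filter.atTop :=
        Filter.tendsto_id.atTop_div_const hs
      have h2 := (Real.tendsto_arctan_atTop.mono_right nhdsWithin_le_nhds).comp h1
      have h3 := h2.const_mul 2
      rwa [show 2 * (π / 2) = π by ring] at h3

/-- Stieltjes inversion along vertical lines. -/
lemma tendsto_intervalIntegral_cpk_sub (hab : a < b) {C : ℝ}
    (hCa : ∀ y : ℝ, 0 < y → ∫ l, ((l - a) ^ 2 + y ^ 2)⁻¹ ∂ν ≤ C)
    (hCb : ∀ y : ℝ, 0 < y → ∫ l, ((l - b) ^ 2 + y ^ 2)⁻¹ ∂ν ≤ C) :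
    Filter.Tendsto
      (fun Y : ℝ => ∫ y in (-Y)..Y, ((∫ l, cpk a l y ∂ν) - ∫ l, cpk b l y ∂ν)) Filter.atTop
      (nhds (2 * π * ν.real (Set.Ioo a b))) := by
  have a0 := measure_singleton_eq_zero_of_bound hCa
  have b0 := measure_singleton_eq_zero_of_bound hCb
  have ai := integrable_inv_abs_of_bound hCa
  have bi := integrable_inv_abs_of_bound hCb
  have hs : ∀ c : ℝ, Integrable (fun l => π * Real.sign (l - c)) ν := fun c => by
    refine (integrable_const π).mono' ?_ (ae_of_all _ fun l => ?_)
    · refine (measurable_const.mul ?_).aestronglyMeasurable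
      simp only [Real.sign]
      exact Measurable.ite (measurableSet_lt (by fun_prop) measurable_const) measurable_const
        (Measurable.ite (measurableSet_lt measurable_const (by fun_prop)) measurable_const
          measurable_const)
    · rw [norm_mul, Real.norm_of_nonneg pi_pos.le]
      rcases lt_trichotomy (l - c) 0 with h | h | h
      · simp [Real.sign_of_neg h]
      · simp [h, pi_pos.le]
      · simp [Real.sign_of_pos h]
  have h1 := (tendsto_integral_arctan a0).sub (tendsto_integral_arctan b0)
  have h2 : (∫ l, π * Real.sign (l - a) ∂ν) - ∫ l, π * Real.sign (l - b) ∂ν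
      = 2 * π * ν.real (Set.Ioo a b) := by
    rw [← integral_sub (hs a) (hs b)]
    have : ∀ᵐ l ∂ν, π * Real.sign (l - a) - π * Real.sign (l - b)
        = (Set.Ioo a b).indicator (fun _ => 2 * π) l := by
      have e1 : ∀ᵐ l ∂ν, l ≠ a := by rw [ae_iff]; simpa using a0
      have e2 : ∀ᵐ l ∂ν, l ≠ b := by rw [ae_iff]; simpa using b0
      filter_upwards [e1, e2] with l h1 h2
      rcases lt_or_gt_of_ne h1 with h | h
      · have : l - b < 0 := by linarith
        rw [Real.sign_of_neg (sub_neg.mpr h), Real.sign_of_neg this, Set.indicator_of_notMem (by simp; grind)]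
        simp
      · rcases lt_or_gt_of_ne h2 with h' | h'
        · rw [Real.sign_of_pos (sub_pos.mpr h), Real.sign_of_neg (sub_neg.mpr h'),
            Set.indicator_of_mem (Set.mem_Ioo.mpr ⟨h, h'⟩)]
          ring
        · rw [Real.sign_of_pos (sub_pos.mpr h), Real.sign_of_pos (sub_pos.mpr h'),
            Set.indicator_of_notMem (by simp; grind)]
          simp
    rw [integral_congr_ae this, integral_indicator_const _ measurableSet_Ioo, smul_eq_mul]
    ring
  rw [h2] at h1
  refine h1.congr' ?_
  filter_upwards [Filter.eventually_ge_atTop 0] with Y hY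
  rw [intervalIntegral.integral_sub (intervalIntegrable_cpk ai Y) (intervalIntegrable_cpk bi Y),
    intervalIntegral_cpk ai a0 hY, intervalIntegral_cpk bi b0 hY]

end Stieltjes

end

section

section Spectral

variable {E : Type*} [NormedAddCommGroup E] [InnerProductSpace ℂ E] [CompleteSpace E]

lemma inv_sub_ofReal_add_mul_I (l a y : ℝ) (hy : y ≠ 0) :
    ((l : ℂ) - (a + y * I))⁻¹ = (cpk a l y : ℝ) + (y * ((l - a) ^ 2 + y ^ 2)⁻¹ : ℝ) * I := by
  have h1 : ((l : ℂ) - (a + y * I)) ≠ 0 := by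
    intro h
    have := congrArg Complex.im h
    simp at this
    exact hy this
  have h2 : ((l - a) ^ 2 + y ^ 2 : ℝ) ≠ 0 := by positivity
  have h3 : ((l : ℂ) - a) ^ 2 + (y : ℂ) ^ 2 ≠ 0 := by exact_mod_cast h2
  refine inv_eq_of_mul_eq_one_right ?_
  unfold cpk
  push_cast
  field_simp
  ring_nf
  simp only [I_sq]
  ring

lemma integrable_inv_sub {ν : Measure ℝ} [IsFiniteMeasure ν] (a y : ℝ) (hy : y ≠ 0) :
    Integrable (fun l : ℝ => ((l : ℂ) - (a + y * I))⁻¹) ν := by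
  refine (integrable_const (|y|⁻¹)).mono' ?_ (ae_of_all _ fun l => ?_)
  · exact (Measurable.inv (by fun_prop)).aestronglyMeasurable
  · rw [norm_inv]
    refine inv_anti₀ (abs_pos.mpr hy) ?_
    refine le_trans (le_of_eq ?_) (Complex.abs_im_le_norm _)
    simp

omit [CompleteSpace E] in
/-- Real and imaginary parts of the resolvent on the vertical line through `a`. -/
lemma IsSpectralMeasureFamily.re_im {H : E →ₗ.[ℂ] E} {ν : E → Measure ℝ}
    (hν : IsSpectralMeasureFamily H ν) {a : ℝ} {S : E →L[ℂ] E} (hS : IsResolventAt H (a : ℂ) S)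
    {y : ℝ} (hy : y ≠ 0) {X : E →L[ℂ] E} (hX : IsInvOneSub S (y * I) X) (u : E) :
    (inner ℂ u (S (X u)) : ℂ).re = ∫ l, cpk a l y ∂(ν u) ∧
    (inner ℂ u (S (X u)) : ℂ).im = y * ∫ l, ((l - a) ^ 2 + y ^ 2)⁻¹ ∂(ν u) := by
  have := hν.1 u
  have h1 := hν.2 (a + y * I) (by simpa using hy) _ (hS.shift hX) u
  have h2 : (S * X) u = S (X u) := rfl
  rw [h2] at h1
  have hi := integrable_inv_sub (ν := ν u) a y hy
  constructor
  · rw [h1]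
    have := integral_re (𝕜 := ℂ) hi
    simp only [RCLike.re_eq_complex_re] at this
    rw [← this]
    congr 1; ext l
    rw [inv_sub_ofReal_add_mul_I l a y hy]
    generalize y * ((l - a) ^ 2 + y ^ 2)⁻¹ = q
    simp
  · rw [h1]
    have := integral_im (𝕜 := ℂ) hi
    simp only [RCLike.im_eq_complex_im] at this
    rw [← this, ← integral_const_mul]
    congr 1; ext l
    rw [inv_sub_ofReal_add_mul_I l a y hy]
    generalize y * ((l - a) ^ 2 + y ^ 2)⁻¹ = q
    simp

lemma IsSpectralMeasureFamily.integral_le {H : E →ₗ.[ℂ] E} {ν : E → Measure ℝ}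
    (hν : IsSpectralMeasureFamily H ν) {a : ℝ} {S : E →L[ℂ] E} (hS : IsResolventAt H (a : ℂ) S)
    (hSa : IsSelfAdjoint S) (u : E) (y : ℝ) (hy : 0 < y) :
    ∫ l, ((l - a) ^ 2 + y ^ 2)⁻¹ ∂(ν u) ≤ (‖S‖ * ‖u‖) ^ 2 := by
  obtain ⟨X, hX⟩ := exists_isInvOneSub_I hSa y
  have h1 := (hν.re_im hS hy.ne' hX u).2
  have h2 : (inner ℂ u (S (X u)) : ℂ).im = y * ‖S (X u)‖ ^ 2 := by
    have h5 := hX.right_apply u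
    generalize X u = w at h5 ⊢
    rw [← h5, inner_sub_left, inner_smul_left]
    have h3 := hSa.inner_apply_im w
    have h4 : (inner ℂ (S w) (S w) : ℂ) = ((‖S w‖ ^ 2 : ℝ) : ℂ) := by
      rw [inner_self_eq_norm_sq_to_K]; simp
    rw [h4, Complex.sub_im, h3]
    generalize ‖S w‖ ^ 2 = q
    simp
  have h3 : ‖S (X u)‖ ≤ ‖S‖ * ‖u‖ := by
    refine (S.le_opNorm _).trans ?_
    gcongr
    exact (X.le_of_opNorm_le (hX.norm_le_one hSa) u).trans (by simp)
  rw [h2] at h1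
  rw [← mul_left_cancel₀ hy.ne' h1]
  gcongr

end Spectral

end

section

section Compare

variable {E F : Type*} [NormedAddCommGroup E] [InnerProductSpace ℂ E] [CompleteSpace E]
  [NormedAddCommGroup F] [InnerProductSpace ℂ F] [CompleteSpace F]

open ContinuousLinearMap

lemma norm_adjoint_le_one_of_comp_eq {P : E →L[ℂ] F} (hP : ∀ w, P (adjoint P w) = w) :
    ‖adjoint P‖ ≤ 1 := by
  refine opNorm_le_bound _ zero_le_one fun w => ?_
  have h1 : ‖adjoint P w‖ ^ 2 = ‖w‖ ^ 2 := by
    have h := adjoint_inner_left P (adjoint P w) w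
    rw [hP, inner_self_eq_norm_sq_to_K, inner_self_eq_norm_sq_to_K] at h
    exact_mod_cast h
  rw [one_mul]
  exact (sq_le_sq₀ (norm_nonneg _) (norm_nonneg _)).1 h1.le

lemma norm_le_one_of_comp_adjoint_eq {P : E →L[ℂ] F} (hP : ∀ w, P (adjoint P w) = w) :
    ‖P‖ ≤ 1 := by
  rw [← LinearIsometryEquiv.norm_map (adjoint (𝕜 := ℂ) (E := E) (F := F)) P]
  exact norm_adjoint_le_one_of_comp_eq hP

/-- Invertibility of `1 - z T` persists under small perturbations of `T`. -/
lemma IsInvOneSub.perturb {B T X : E →L[ℂ] E} {z : ℂ} (hX : IsInvOneSub B z X)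
    (hT : ‖X‖ * (‖z‖ * ‖T - B‖) ≤ 1 / 2) :
    ∃ Z, IsInvOneSub T z Z ∧ ‖Z‖ ≤ 2 * ‖X‖ := by
  have h1 : ‖X * (z • (T - B))‖ ≤ 1 / 2 := by
    refine (_root_.norm_mul_le _ _).trans ?_
    rwa [norm_smul]
  have h2 : 1 - z • T = (1 - z • B) * (1 - X * (z • (T - B))) := by
    rw [mul_sub, ← mul_assoc, hX.1, one_mul, mul_one, smul_sub]; abel
  obtain ⟨U, hU⟩ : IsUnit (1 - z • T) := by
    rw [h2]
    refine IsUnit.mul ⟨⟨1 - z • B, X, hX.1, hX.2⟩, rfl⟩ ?_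
    exact isUnit_one_sub_of_norm_lt_one (h1.trans_lt (by norm_num))
  refine ⟨↑U⁻¹, ⟨by rw [← hU]; exact U.mul_inv, by rw [← hU]; exact U.inv_mul⟩, ?_⟩
  have h3 : (↑U⁻¹ : E →L[ℂ] E) = X + (X * (z • (T - B))) * ↑U⁻¹ := by
    have : (1 - X * (z • (T - B))) * (↑U⁻¹ : E →L[ℂ] E) = X := by
      calc _ = X * (1 - z • B) * (1 - X * (z • (T - B))) * (↑U⁻¹ : E →L[ℂ] E) := by
            rw [hX.2, one_mul]
        _ = X * (1 - z • T) * (↑U⁻¹ : E →L[ℂ] E) := by rw [h2]; simp only [mul_assoc]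
        _ = X := by rw [← hU, mul_assoc, U.mul_inv, mul_one]
    rw [sub_mul, one_mul] at this
    exact sub_eq_iff_eq_add.1 this
  have h4 : ‖(↑U⁻¹ : E →L[ℂ] E)‖ ≤ ‖X‖ + 1 / 2 * ‖(↑U⁻¹ : E →L[ℂ] E)‖ := by
    nth_rewrite 1 [h3]
    refine (norm_add_le _ _).trans ?_
    gcongr
    refine (_root_.norm_mul_le _ _).trans ?_
    gcongr
  linarith

/-- Transfer of a real resolvent point from `H` to a nearby operator `H'` on `F`. -/
lemma exists_resolvent_of_close {H : E →ₗ.[ℂ] E} {μ : ℂ} {B : E →L[ℂ] E}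
    (hB : IsResolventAt H μ B) {z : ℝ} {S : E →L[ℂ] E} (hS : IsResolventAt H (μ + z) S) :
    ∃ C > 0, ∃ δ₀ > 0, ∀ δ, 0 ≤ δ → δ ≤ δ₀ → ∀ (F : Type) [NormedAddCommGroup F]
      [InnerProductSpace ℂ F] [CompleteSpace F] (P : E →L[ℂ] F) (H' : F →ₗ.[ℂ] F)
      (B' : F →L[ℂ] F), IsSelfAdjoint B' → IsResolventAt H' μ B' →
      (∀ w, P (adjoint P w) = w) → (∀ u, ‖B' (P u) - P (B u)‖ ≤ δ * ‖u‖) →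
      (∀ u, ‖B u - adjoint P (P (B u))‖ ≤ δ * ‖u‖) →
      ∃ S' : F →L[ℂ] F, IsSelfAdjoint S' ∧ IsResolventAt H' (μ + z) S' ∧
        (∀ u, ‖S' (P u) - P (S u)‖ ≤ C * δ * ‖u‖) ∧
        (∀ u, ‖S u - adjoint P (P (S u))‖ ≤ C * δ * ‖u‖) := by
  have hX : IsInvOneSub B z (1 + (z : ℂ) • S) := by simpa using hB.isInvOneSub hS
  set X := 1 + (z : ℂ) • S with hXdef
  have hSX : S = B * X := (hB.shift hX).unique hS
  refine ⟨2 * ‖X‖ ^ 2 + ‖X‖ + 1, by positivity, (4 * (‖X‖ * |z| + 1))⁻¹, by positivity, ?_⟩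
  intro δ hδ0 hδ F _ _ _ P H' B' hB' hr hP h1 h2
  have hPa := norm_adjoint_le_one_of_comp_eq hP
  have hPn := norm_le_one_of_comp_adjoint_eq hP
  let T : E →L[ℂ] E := (adjoint P).comp (B'.comp P)
  have hT : ‖T - B‖ ≤ 2 * δ := by
    refine opNorm_le_bound _ (mul_nonneg zero_le_two hδ0) fun u => ?_
    have e : (T - B) u = adjoint P (B' (P u) - P (B u)) - (B u - adjoint P (P (B u))) := by
      simp [T]
    rw [e]
    refine (norm_sub_le _ _).trans ?_
    have h3 := ((adjoint P).le_of_opNorm_le hPa (B' (P u) - P (B u))).trans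
      ((one_mul _).le.trans (h1 u))
    linarith [h2 u]
  obtain ⟨Z, hZ, hZn⟩ := hX.perturb (T := T) (by
    have h3 : ‖X‖ * (‖(z : ℂ)‖ * ‖T - B‖) ≤ ‖X‖ * (|z| * (2 * (4 * (‖X‖ * |z| + 1))⁻¹)) := by
      rw [Complex.norm_real, Real.norm_eq_abs]
      gcongr; linarith
    refine h3.trans ?_
    rw [show ‖X‖ * (|z| * (2 * (4 * (‖X‖ * |z| + 1))⁻¹)) = (‖X‖ * |z|) / (2 * (‖X‖ * |z| + 1)) by
      field_simp; ring, div_le_div_iff₀ (by positivity) (by norm_num)]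
    nlinarith [norm_nonneg X, abs_nonneg z])
  let X' : F →L[ℂ] F := P.comp (Z.comp (adjoint P))
  have hX' : IsInvOneSub B' z X' := by
    constructor
    · ext w
      have h3 := congrArg P (hZ.right_apply (adjoint P w))
      simp only [map_sub, map_smul, T, comp_apply, hP] at h3
      simpa [X'] using h3
    · ext w
      have h3 := congrArg P (hZ.left_apply (adjoint P w))
      simp only [map_sub, map_smul, T, comp_apply, hP] at h3
      simpa [X'] using h3
  have hX'n : ∀ w, ‖X' w‖ ≤ 2 * ‖X‖ * ‖w‖ := fun w => by
    have e1 : ‖X' w‖ ≤ ‖Z (adjoint P w)‖ := by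
      simpa [X'] using P.le_of_opNorm_le hPn (Z (adjoint P w))
    have e2 : ‖adjoint P w‖ ≤ ‖w‖ := by simpa using (adjoint P).le_of_opNorm_le hPa w
    refine e1.trans ((Z.le_of_opNorm_le hZn _).trans ?_)
    gcongr
  refine ⟨B' * X', hX'.isSelfAdjoint hB', hr.shift hX', fun u => ?_, fun u => ?_⟩
  · have e : (B' * X') (P u) - P (S u) = X' (B' (P (X u)) - P (B (X u))) := by
      have h3 := hX.right_apply u
      have h4 := hX'.left_apply (P (B (X u)))
      have h5 : X' (B' (P (X u)) - (z : ℂ) • B' (P (B (X u)))) = X' (B' (P u)) := by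
        conv_rhs => rw [← h3]
        simp
      rw [hX'.comm, hSX]
      simp only [map_sub, map_smul, mul_apply_eq_comp] at h4 h5 ⊢
      simpa only [sub_sub_sub_cancel_right] using (congrArg₂ (· - ·) h5 h4).symm
    rw [e]
    refine (hX'n _).trans ?_
    have h3 := (h1 (X u)).trans (mul_le_mul_of_nonneg_left (X.le_opNorm u) hδ0)
    calc 2 * ‖X‖ * ‖B' (P (X u)) - P (B (X u))‖ ≤ 2 * ‖X‖ * (δ * (‖X‖ * ‖u‖)) := by gcongr
      _ = 2 * ‖X‖ ^ 2 * δ * ‖u‖ := by ring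
      _ ≤ _ := by gcongr; linarith [norm_nonneg X]
  · rw [hSX]
    refine (h2 (X u)).trans ((mul_le_mul_of_nonneg_left (X.le_opNorm u) hδ0).trans ?_)
    rw [show δ * (‖X‖ * ‖u‖) = ‖X‖ * δ * ‖u‖ by ring]
    gcongr
    nlinarith [norm_nonneg X]

/-- Comparison of compressed resolvents on a vertical line, with a constant independent of the
height. -/
lemma norm_inner_sub_le {S X : E →L[ℂ] E} {S' X' : F →L[ℂ] F} {P : E →L[ℂ] F} {η y : ℝ}
    (hη : 0 ≤ η) (hS : IsSelfAdjoint S) (hS' : IsSelfAdjoint S') (hPn : ‖P‖ ≤ 1)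
    (h1 : ∀ u, ‖S' (P u) - P (S u)‖ ≤ η * ‖u‖)
    (h2 : ∀ u, ‖S u - adjoint P (P (S u))‖ ≤ η * ‖u‖)
    (hX : IsInvOneSub S (y * I) X) (hX' : IsInvOneSub S' (y * I) X') (u : E) :
    ‖(inner ℂ u (S (X u)) : ℂ) - inner ℂ (P u) (S' (X' (P u)))‖ ≤ 2 * η * ‖u‖ ^ 2 := by
  have e : S' (X' (P u)) - P (S (X u)) = X' (S' (P (X u)) - P (S (X u))) := by
    have h3 := hX.right_apply u
    have h4 := hX'.left_apply (P (S (X u)))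
    have h5 : X' (S' (P (X u)) - (y * I : ℂ) • S' (P (S (X u)))) = X' (S' (P u)) := by
      conv_rhs => rw [← h3]
      simp
    have h6 : S' (X' (P u)) = X' (S' (P u)) := DFunLike.congr_fun hX'.comm (P u)
    rw [h6]
    simp only [map_sub, map_smul] at h4 h5 ⊢
    simpa only [sub_sub_sub_cancel_right] using (congrArg₂ (· - ·) h5 h4).symm
  have hXu : ‖X u‖ ≤ ‖u‖ := by simpa using X.le_of_opNorm_le (hX.norm_le_one hS) u
  have hPu : ‖P u‖ ≤ ‖u‖ := by simpa using P.le_of_opNorm_le hPn u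
  have e2 : (inner ℂ u (S (X u)) : ℂ) - inner ℂ (P u) (S' (X' (P u)))
      = inner ℂ u (S (X u) - adjoint P (P (S (X u))))
        - inner ℂ (P u) (S' (X' (P u)) - P (S (X u))) := by
    rw [inner_sub_right, inner_sub_right, adjoint_inner_right]; ring
  have h3 : ‖(inner ℂ u (S (X u) - adjoint P (P (S (X u)))) : ℂ)‖ ≤ η * ‖u‖ ^ 2 := by
    refine (norm_inner_le_norm _ _).trans ?_
    calc ‖u‖ * ‖S (X u) - adjoint P (P (S (X u)))‖ ≤ ‖u‖ * (η * ‖u‖) := by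
          gcongr; exact (h2 _).trans (by gcongr)
      _ = _ := by ring
  have h4 : ‖(inner ℂ (P u) (S' (X' (P u)) - P (S (X u))) : ℂ)‖ ≤ η * ‖u‖ ^ 2 := by
    refine (norm_inner_le_norm _ _).trans ?_
    rw [e]
    have h5 : ‖X' (S' (P (X u)) - P (S (X u)))‖ ≤ η * ‖u‖ := by
      refine (X'.le_of_opNorm_le (hX'.norm_le_one hS') _).trans ?_
      rw [one_mul]; exact (h1 _).trans (by gcongr)
    calc ‖P u‖ * ‖X' (S' (P (X u)) - P (S (X u)))‖ ≤ ‖u‖ * (η * ‖u‖) := by gcongr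
      _ = _ := by ring
  rw [e2]
  exact (norm_sub_le _ _).trans (by linarith)

omit [CompleteSpace E] in
/-- The difference of resolvents on two vertical lines decays quadratically. -/
lemma norm_inner_sub_vertical_le [CompleteSpace E] {H : E →ₗ.[ℂ] E} {a b y : ℝ}
    {S T X Y : E →L[ℂ] E}
    (hSr : IsResolventAt H (a : ℂ) S) (hTr : IsResolventAt H (b : ℂ) T)
    (hS : IsSelfAdjoint S) (hT : IsSelfAdjoint T) (hy : y ≠ 0)
    (hX : IsInvOneSub S (y * I) X) (hY : IsInvOneSub T (y * I) Y) (u : E) :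
    ‖(inner ℂ u (S (X u)) : ℂ) - inner ℂ u (T (Y u))‖ ≤ |a - b| / y ^ 2 * ‖u‖ ^ 2 := by
  have h1 := (hSr.shift hX).identity (hTr.shift hY)
  have h2 := DFunLike.congr_fun h1 u
  have h3 : S (X u) - T (Y u) = ((a - b : ℝ) : ℂ) • (S * X) ((T * Y) u) := by
    simp only [add_apply, smul_apply, mul_apply_eq_comp] at h2 ⊢
    rw [sub_eq_iff_eq_add]
    nth_rewrite 2 [h2]
    push_cast
    module
  rw [← inner_sub_right, h3]
  refine (norm_inner_le_norm _ _).trans ?_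
  rw [norm_smul, Complex.norm_real, Real.norm_eq_abs]
  have h4 := (S * X).le_of_opNorm_le (hX.norm_mul_le hS hy) ((T * Y) u)
  have h5 := (T * Y).le_of_opNorm_le (hY.norm_mul_le hT hy) u
  calc ‖u‖ * (|a - b| * ‖(S * X) ((T * Y) u)‖) ≤ ‖u‖ * (|a - b| * (|y|⁻¹ * (|y|⁻¹ * ‖u‖))) := by
        gcongr; exact h4.trans (by gcongr)
    _ = |a - b| / y ^ 2 * ‖u‖ ^ 2 := by rw [← sq_abs y]; field_simp

end Compare

end

section

section Abstract

open ContinuousLinearMap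

lemma abs_intervalIntegral_le_of_abs_le_min {f : ℝ → ℝ} {q s Y : ℝ} (hq : 0 ≤ q) (hs : 0 < s)
    (hY : 0 ≤ Y) (hf : ∀ y, y ≠ 0 → |f y| ≤ s ^ 2 * q) (hf' : ∀ y, y ≠ 0 → |f y| ≤ q / y ^ 2) :
    |∫ y in (-Y)..Y, f y| ≤ 2 * π * s * q := by
  have h1 : ∀ y, y ≠ 0 → |f y| ≤ 2 * s * q * (s / (1 + (s * y) ^ 2)) := by
    intro y hy
    have e1 := hf y hy
    have e2 := hf' y hy
    rw [le_div_iff₀ (by positivity)] at e2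
    rw [← mul_div_assoc, le_div_iff₀ (by positivity)]
    nlinarith [sq_nonneg s]
  have hc : Continuous fun y : ℝ => 2 * s * q * (s / (1 + (s * y) ^ 2)) := by
    refine continuous_const.mul (Continuous.div (by fun_prop) (by fun_prop) fun y => by positivity)
  have h2 : |∫ y in (-Y)..Y, f y| ≤ ∫ y in (-Y)..Y, 2 * s * q * (s / (1 + (s * y) ^ 2)) := by
    rw [← Real.norm_eq_abs]
    refine intervalIntegral.norm_integral_le_of_norm_le (by linarith) ?_
      (hc.intervalIntegrable _ _)
    have : ∀ᵐ y : ℝ, y ≠ 0 := by simp [ae_iff]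
    filter_upwards [this] with y hy _ using h1 y hy
  refine h2.trans ?_
  have h3 : ∫ y in (-Y)..Y, 2 * s * q * (s / (1 + (s * y) ^ 2))
      = 2 * s * q * Real.arctan (s * Y) - 2 * s * q * Real.arctan (s * (-Y)) := by
    refine intervalIntegral.integral_eq_sub_of_hasDerivAt (f := fun y => 2 * s * q * Real.arctan (s * y))
      (fun y _ => ?_) (hc.intervalIntegrable _ _)
    have := (((hasDerivAt_id y).const_mul s).arctan).const_mul (2 * s * q)
    refine this.congr_deriv ?_
    simp only [id]; ring
  rw [h3, mul_neg, Real.arctan_neg]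
  have h4 := Real.arctan_lt_pi_div_two (s * Y)
  have h5 : 0 ≤ s * q := by positivity
  nlinarith

variable {E : Type*} [NormedAddCommGroup E] [InnerProductSpace ℂ E] [CompleteSpace E]

/-- Norm-resolvent closeness of an operator `H'` on another space to `H` forces closeness of the
spectral projections associated with an interval whose endpoints lie in the resolvent set. -/
theorem exists_spectral_close {H : E →ₗ.[ℂ] E} {K a b : ℝ} (hab : a < b) {B Ra Rb EH : E →L[ℂ] E}
    (hBs : IsSelfAdjoint B)
    (hB : IsResolventAt H (-K : ℂ) B) (hRa : IsResolventAt H (a : ℂ) Ra)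
    (hRb : IsResolventAt H (b : ℂ) Rb) {ν : E → Measure ℝ} (hν : IsSpectralMeasureFamily H ν)
    (hEH : ∀ u : E, (inner ℂ u (EH u) : ℂ) = ((ν u (Set.Ioo a b)).toReal : ℝ))
    {ε : ℝ} (hε : 0 < ε) :
    ∃ δ > 0, ∀ (F : Type) [NormedAddCommGroup F]
      [InnerProductSpace ℂ F] [CompleteSpace F] (P : E →L[ℂ] F) (H' : F →ₗ.[ℂ] F)
      (B' : F →L[ℂ] F), IsSelfAdjoint B' → IsResolventAt H' (-K : ℂ) B' →
      (∀ w, P (adjoint P w) = w) → (∀ u, ‖B' (P u) - P (B u)‖ ≤ δ * ‖u‖) →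
      (∀ u, ‖B u - adjoint P (P (B u))‖ ≤ δ * ‖u‖) →
      ((∃ Sa : F →L[ℂ] F, IsResolventAt H' (a : ℂ) Sa) ∧
         (∃ Sb : F →L[ℂ] F, IsResolventAt H' (b : ℂ) Sb)) ∧
      (∀ ν' : F → Measure ℝ, IsSpectralMeasureFamily H' ν' → ∀ E' : F →L[ℂ] F,
        (∀ v : F, (inner ℂ v (E' v) : ℂ) = ((ν' v (Set.Ioo a b)).toReal : ℝ)) →
        ‖(adjoint P).comp (E'.comp P) - EH‖ ≤ ε) := by
  have ea : (a : ℂ) = (-K : ℂ) + ((a + K : ℝ) : ℂ) := by push_cast; ring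
  have eb : (b : ℂ) = (-K : ℂ) + ((b + K : ℝ) : ℂ) := by push_cast; ring
  have hRas : IsSelfAdjoint Ra := by
    have hX : IsInvOneSub B ((a + K : ℝ) : ℂ) (1 + ((a + K : ℝ) : ℂ) • Ra) := by
      have := hB.isInvOneSub hRa
      rwa [ea, add_sub_cancel_left] at this
    rw [ea] at hRa
    rw [(hB.shift hX).unique hRa]
    exact hX.isSelfAdjoint hBs
  have hRbs : IsSelfAdjoint Rb := by
    have hX : IsInvOneSub B ((b + K : ℝ) : ℂ) (1 + ((b + K : ℝ) : ℂ) • Rb) := by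
      have := hB.isInvOneSub hRb
      rwa [eb, add_sub_cancel_left] at this
    rw [eb] at hRb
    rw [(hB.shift hX).unique hRb]
    exact hX.isSelfAdjoint hBs
  obtain ⟨Ca, hCa, δa, hδa, hA⟩ := exists_resolvent_of_close hB (ea ▸ hRa)
  obtain ⟨Cb, hCb, δb, hδb, hBb⟩ := exists_resolvent_of_close hB (eb ▸ hRb)
  set q : ℝ := 2 * (b - a) with hqdef
  have hq : 0 < q := by rw [hqdef]; linarith
  set s : ℝ := ε / (2 * q) with hsdef
  have hs : 0 < s := by positivity
  refine ⟨min (min δa δb) (s ^ 2 * q / (4 * (Ca + Cb))), by positivity, ?_⟩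
  set δ := min (min δa δb) (s ^ 2 * q / (4 * (Ca + Cb))) with hδdef
  have hδ0 : 0 ≤ δ := by positivity
  have hδC : 4 * (Ca + Cb) * δ ≤ s ^ 2 * q := by
    have : δ ≤ s ^ 2 * q / (4 * (Ca + Cb)) := min_le_right _ _
    rw [le_div_iff₀ (by positivity)] at this
    linarith
  intro F _ _ _ P H' B' hB' hr hP h1 h2
  have hPn := norm_le_one_of_comp_adjoint_eq hP
  obtain ⟨Sa, hSa, hSar, ha1, ha2⟩ :=
    hA δ hδ0 ((min_le_left _ _).trans (min_le_left _ _)) F P H' B' hB' hr hP h1 h2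
  obtain ⟨Sb, hSb, hSbr, hb1, hb2⟩ :=
    hBb δ hδ0 ((min_le_left _ _).trans (min_le_right _ _)) F P H' B' hB' hr hP h1 h2
  rw [← ea] at hSar
  rw [← eb] at hSbr
  refine ⟨⟨⟨Sa, hSar⟩, ⟨Sb, hSbr⟩⟩, fun ν' hν' E' hE' => ?_⟩
  have key : ∀ u : E, |(ν u).real (Set.Ioo a b) - (ν' (P u)).real (Set.Ioo a b)|
      ≤ s * q * ‖u‖ ^ 2 := by
    intro u
    have := hν.1 u
    have := hν'.1 (P u)
    let Ct : ℝ := max ((‖Ra‖ * ‖u‖) ^ 2) ((‖Rb‖ * ‖u‖) ^ 2)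
    let Ct' : ℝ := max ((‖Sa‖ * ‖P u‖) ^ 2) ((‖Sb‖ * ‖P u‖) ^ 2)
    have ta := fun y hy => (hν.integral_le hRa hRas u y hy).trans (le_max_left _ _ : _ ≤ Ct)
    have tb := fun y hy => (hν.integral_le hRb hRbs u y hy).trans (le_max_right _ _ : _ ≤ Ct)
    have ta' := fun y hy => (hν'.integral_le hSar hSa (P u) y hy).trans (le_max_left _ _ : _ ≤ Ct')
    have tb' := fun y hy => (hν'.integral_le hSbr hSb (P u) y hy).trans (le_max_right _ _ : _ ≤ Ct')
    have l1 := tendsto_intervalIntegral_cpk_sub hab ta tb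
    have l2 := tendsto_intervalIntegral_cpk_sub hab ta' tb'
    have i1 := fun Y => (intervalIntegrable_cpk (integrable_inv_abs_of_bound ta) Y).sub
      (intervalIntegrable_cpk (integrable_inv_abs_of_bound tb) Y)
    have i2 := fun Y => (intervalIntegrable_cpk (integrable_inv_abs_of_bound ta') Y).sub
      (intervalIntegrable_cpk (integrable_inv_abs_of_bound tb') Y)
    let f : ℝ → ℝ := fun y => ((∫ l, cpk a l y ∂(ν u)) - ∫ l, cpk b l y ∂(ν u))
      - ((∫ l, cpk a l y ∂(ν' (P u))) - ∫ l, cpk b l y ∂(ν' (P u)))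
    have hf : ∀ y, y ≠ 0 → |f y| ≤ s ^ 2 * (q * ‖u‖ ^ 2) ∧ |f y| ≤ q * ‖u‖ ^ 2 / y ^ 2 := by
      intro y hy
      obtain ⟨Xa, hXa⟩ := exists_isInvOneSub_I hRas y
      obtain ⟨Xb, hXb⟩ := exists_isInvOneSub_I hRbs y
      obtain ⟨Ya, hYa⟩ := exists_isInvOneSub_I hSa y
      obtain ⟨Yb, hYb⟩ := exists_isInvOneSub_I hSb y
      have r1 := (hν.re_im hRa hy hXa u).1
      have r2 := (hν.re_im hRb hy hXb u).1
      have r3 := (hν'.re_im hSar hy hYa (P u)).1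
      have r4 := (hν'.re_im hSbr hy hYb (P u)).1
      have n1 := norm_inner_sub_le (mul_nonneg hCa.le hδ0) hRas hSa hPn ha1 ha2 hXa hYa u
      have n2 := norm_inner_sub_le (mul_nonneg hCb.le hδ0) hRbs hSb hPn hb1 hb2 hXb hYb u
      have n3 := norm_inner_sub_vertical_le hRa hRb hRas hRbs hy hXa hXb u
      have n4 := norm_inner_sub_vertical_le hSar hSbr hSa hSb hy hYa hYb (P u)
      have hPu : ‖P u‖ ≤ ‖u‖ := by simpa using P.le_of_opNorm_le hPn u
      have n5 : |a - b| / y ^ 2 * ‖P u‖ ^ 2 ≤ |a - b| / y ^ 2 * ‖u‖ ^ 2 := by gcongr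
      have n1 := (Complex.abs_re_le_norm _).trans n1
      have n2 := (Complex.abs_re_le_norm _).trans n2
      have n3 := (Complex.abs_re_le_norm _).trans n3
      have n4 := ((Complex.abs_re_le_norm _).trans n4).trans n5
      rw [Complex.sub_re, r1, r3] at n1
      rw [Complex.sub_re, r2, r4] at n2
      rw [Complex.sub_re, r1, r2] at n3
      rw [Complex.sub_re, r3, r4] at n4
      have hab' : |a - b| = b - a := by rw [abs_sub_comm, abs_of_pos (by linarith)]
      rw [hab'] at n3 n4
      constructor
      · have e : |f y| ≤ 2 * (Ca * δ) * ‖u‖ ^ 2 + 2 * (Cb * δ) * ‖u‖ ^ 2 := by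
          rw [abs_le] at n1 n2 ⊢
          simp only [f]
          constructor <;> linarith [n1.1, n1.2, n2.1, n2.2]
        refine e.trans ?_
        nlinarith [sq_nonneg ‖u‖, mul_nonneg (add_pos hCa hCb).le hδ0]
      · have e : |f y| ≤ (b - a) / y ^ 2 * ‖u‖ ^ 2 + (b - a) / y ^ 2 * ‖u‖ ^ 2 := by
          rw [abs_le] at n3 n4 ⊢
          simp only [f]
          constructor <;> linarith [n3.1, n3.2, n4.1, n4.2]
        refine e.trans (le_of_eq ?_)
        rw [hqdef]; ring
    have l3 := (l1.sub l2).abs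
    have h3 : |2 * π * (ν u).real (Set.Ioo a b) - 2 * π * (ν' (P u)).real (Set.Ioo a b)|
        ≤ 2 * π * s * (q * ‖u‖ ^ 2) := by
      refine le_of_tendsto l3 ?_
      filter_upwards [Filter.eventually_ge_atTop 0] with Y hY
      rw [← intervalIntegral.integral_sub (i1 Y) (i2 Y)]
      exact abs_intervalIntegral_le_of_abs_le_min (by positivity) hs hY
        (fun y hy => (hf y hy).1) (fun y hy => (hf y hy).2)
    rw [← mul_sub, abs_mul, abs_of_pos (by positivity), mul_assoc (2 * π) s] at h3
    have := le_of_mul_le_mul_left h3 (by positivity)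
    linarith
  have h3 : ‖(adjoint P).comp (E'.comp P) - EH‖ ≤ 2 * (s * q) := by
    refine norm_le_of_quadratic_form_le (by positivity) fun u => ?_
    have e : (inner ℂ u (((adjoint P).comp (E'.comp P) - EH) u) : ℂ)
        = (((ν' (P u)).real (Set.Ioo a b) - (ν u).real (Set.Ioo a b) : ℝ) : ℂ) := by
      rw [sub_apply, inner_sub_right, hEH, comp_apply, comp_apply, adjoint_inner_right, hE']
      simp [Measure.real]
    rw [e, Complex.norm_real, Real.norm_eq_abs, abs_sub_comm]
    exact key u
  refine h3.trans (le_of_eq ?_)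
  rw [hsdef]; field_simp

end Abstract

end

section

section MulOp

variable {X : Type*} [MeasurableSpace X] {μ : Measure X}

lemma memLp_ofReal_mul {m : X → ℝ} (hm : Measurable m) {C : ℝ} (hC : ∀ x, |m x| ≤ C)
    {u : X → ℂ} (hu : MemLp u 2 μ) : MemLp (fun x => (m x : ℂ) * u x) 2 μ := by
  refine hu.of_le_mul (c := C) ?_ (ae_of_all _ fun x => ?_)
  · exact (measurable_ofReal.comp hm).aestronglyMeasurable.mul hu.1
  · rw [norm_mul, Complex.norm_real, Real.norm_eq_abs]
    gcongr; exact hC x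

/-- Multiplication by a bounded real function as an operator on `L²`. -/
def mulOp (μ : Measure X) (m : X → ℝ) (hm : Measurable m) (C : ℝ) (hC : ∀ x, |m x| ≤ C) :
    Lp ℂ 2 μ →L[ℂ] Lp ℂ 2 μ :=
  LinearMap.mkContinuous
    { toFun := fun u => (memLp_ofReal_mul hm hC (Lp.memLp u)).toLp _
      map_add' := fun u v => by
        apply Lp.ext
        filter_upwards [(memLp_ofReal_mul hm hC (Lp.memLp (u + v))).coeFn_toLp,
          (memLp_ofReal_mul hm hC (Lp.memLp u)).coeFn_toLp,
          (memLp_ofReal_mul hm hC (Lp.memLp v)).coeFn_toLp, Lp.coeFn_add u v,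
          Lp.coeFn_add ((memLp_ofReal_mul hm hC (Lp.memLp u)).toLp _)
            ((memLp_ofReal_mul hm hC (Lp.memLp v)).toLp _)] with x h1 h2 h3 h4 h5
        rw [h1, h5, Pi.add_apply, h2, h3, h4, Pi.add_apply, mul_add]
      map_smul' := fun c u => by
        apply Lp.ext
        filter_upwards [(memLp_ofReal_mul hm hC (Lp.memLp (c • u))).coeFn_toLp,
          (memLp_ofReal_mul hm hC (Lp.memLp u)).coeFn_toLp, Lp.coeFn_smul c u,
          Lp.coeFn_smul c ((memLp_ofReal_mul hm hC (Lp.memLp u)).toLp _)] with x h1 h2 h3 h4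
        rw [h1, RingHom.id_apply, h4, Pi.smul_apply, h2, h3, Pi.smul_apply, smul_eq_mul,
          smul_eq_mul]
        ring }
    C fun u => by
      refine Lp.norm_le_mul_norm_of_ae_le_mul ?_
      filter_upwards [(memLp_ofReal_mul hm hC (Lp.memLp u)).coeFn_toLp] with x h1
      simp only [LinearMap.coe_mk, AddHom.coe_mk]
      rw [h1, norm_mul, Complex.norm_real, Real.norm_eq_abs]
      gcongr; exact hC x

variable {m : X → ℝ} {hm : Measurable m} {C : ℝ} {hC : ∀ x, |m x| ≤ C}

lemma coeFn_mulOp (u : Lp ℂ 2 μ) : mulOp μ m hm C hC u =ᵐ[μ] fun x => (m x : ℂ) * u x :=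
  (memLp_ofReal_mul hm hC (Lp.memLp u)).coeFn_toLp

lemma inner_mulOp_left (u v : Lp ℂ 2 μ) :
    (inner ℂ (mulOp μ m hm C hC u) v : ℂ) = inner ℂ u (mulOp μ m hm C hC v) := by
  rw [L2.inner_def, L2.inner_def]
  refine integral_congr_ae ?_
  filter_upwards [coeFn_mulOp (hm := hm) (hC := hC) u, coeFn_mulOp (hm := hm) (hC := hC) v]
    with x h1 h2
  rw [h1, h2]
  simp
  ring

lemma isSelfAdjoint_mulOp : IsSelfAdjoint (mulOp μ m hm C hC) := by
  rw [ContinuousLinearMap.isSelfAdjoint_iff_isSymmetric]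
  exact fun u v => inner_mulOp_left u v

end MulOp

section Translation

variable {G : Type*} [AddCommGroup G] [MeasurableSpace G] [MeasurableAdd G]
  {μ : Measure G} [μ.IsAddRightInvariant]

/-- Translation `f ↦ f (· + y)` on `L²`. -/
def trOp (μ : Measure G) [μ.IsAddRightInvariant] (y : G) : Lp ℂ 2 μ →L[ℂ] Lp ℂ 2 μ :=
  (Lp.compMeasurePreservingₗᵢ ℂ (· + y) (measurePreserving_add_right μ y)).toContinuousLinearMap

lemma coeFn_trOp (y : G) (u : Lp ℂ 2 μ) : trOp μ y u =ᵐ[μ] fun x => u (x + y) :=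
  Lp.coeFn_compMeasurePreserving u (measurePreserving_add_right μ y)

lemma norm_trOp (y : G) (u : Lp ℂ 2 μ) : ‖trOp μ y u‖ = ‖u‖ :=
  Lp.norm_compMeasurePreserving u (measurePreserving_add_right μ y)

lemma trOp_comp (y z : G) (u : Lp ℂ 2 μ) : trOp μ y (trOp μ z u) = trOp μ (y + z) u := by
  apply Lp.ext
  have h1 := (measurePreserving_add_right μ y).quasiMeasurePreserving.ae (coeFn_trOp z u)
  filter_upwards [coeFn_trOp y (trOp μ z u), coeFn_trOp (y + z) u, h1] with x h1 h2 h3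
  rw [h1, h2, h3, add_assoc]

lemma trOp_zero (u : Lp ℂ 2 μ) : trOp μ 0 u = u := by
  apply Lp.ext
  filter_upwards [coeFn_trOp 0 u] with x h1
  rw [h1, add_zero]

lemma inner_trOp_trOp (y : G) (u v : Lp ℂ 2 μ) :
    (inner ℂ (trOp μ y u) (trOp μ y v) : ℂ) = inner ℂ u v :=
  (Lp.compMeasurePreservingₗᵢ ℂ (· + y) (measurePreserving_add_right μ y)).inner_map_map u v

lemma inner_trOp_left (y : G) (u v : Lp ℂ 2 μ) :
    (inner ℂ (trOp μ y u) v : ℂ) = inner ℂ u (trOp μ (-y) v) := by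
  rw [← inner_trOp_trOp y u, trOp_comp, add_neg_cancel, trOp_zero]

/-- The second difference `2 u - u (· + y) - u (· - y)` on `L²`. -/
def diffOp (μ : Measure G) [μ.IsAddRightInvariant] (y : G) : Lp ℂ 2 μ →L[ℂ] Lp ℂ 2 μ :=
  (2 : ℂ) • ContinuousLinearMap.id ℂ _ - trOp μ y - trOp μ (-y)

lemma diffOp_apply (y : G) (u : Lp ℂ 2 μ) :
    diffOp μ y u = (2 : ℂ) • u - trOp μ y u - trOp μ (-y) u := by
  simp [diffOp]

lemma coeFn_diffOp (y : G) (u : Lp ℂ 2 μ) :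
    diffOp μ y u =ᵐ[μ] fun x => 2 * u x - u (x + y) - u (x - y) := by
  rw [diffOp_apply]
  filter_upwards [Lp.coeFn_sub ((2 : ℂ) • u - trOp μ y u) (trOp μ (-y) u),
    Lp.coeFn_sub ((2 : ℂ) • u) (trOp μ y u), Lp.coeFn_smul (2 : ℂ) u, coeFn_trOp y u,
    coeFn_trOp (-y) u] with x h1 h2 h3 h4 h5
  rw [h1, Pi.sub_apply, h2, Pi.sub_apply, h3, Pi.smul_apply, h4, h5, smul_eq_mul, sub_eq_add_neg x]

lemma inner_diffOp_left (y : G) (u v : Lp ℂ 2 μ) :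
    (inner ℂ (diffOp μ y u) v : ℂ) = inner ℂ u (diffOp μ y v) := by
  simp only [diffOp_apply, inner_sub_left, inner_sub_right, inner_trOp_left, neg_neg,
    inner_smul_left, inner_smul_right, map_ofNat]
  ring

lemma re_inner_diffOp_nonneg (y : G) (u : Lp ℂ 2 μ) : 0 ≤ (inner ℂ u (diffOp μ y u) : ℂ).re := by
  simp only [diffOp_apply, inner_sub_right, inner_smul_right, Complex.sub_re]
  have h : ∀ z, (inner ℂ u (trOp μ z u) : ℂ).re ≤ ‖u‖ ^ 2 := fun z => by
    refine (Complex.re_le_norm _).trans ((norm_inner_le_norm _ _).trans ?_)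
    rw [norm_trOp, sq]
  have h2 : (2 * (inner ℂ u u : ℂ)).re = 2 * ‖u‖ ^ 2 := by
    have h3 : (inner ℂ u u : ℂ) = ((‖u‖ ^ 2 : ℝ) : ℂ) := by
      rw [inner_self_eq_norm_sq_to_K]; simp
    rw [h3, ← Complex.ofReal_ofNat, ← Complex.ofReal_mul, Complex.ofReal_re]
  simp only [h2]
  linarith [h y, h (-y)]

lemma weighted_diff_ge {c s t k l a b e f : ℝ} (hc : 0 ≤ c)
    (h : (t - s) ^ 2 ≤ c * (k * l)) :
    -(c / 2) * (l ^ 2 * (e * e + f * f) + k ^ 2 * (a * a + b * b)) ≤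
      (e - a) * (t ^ 2 * e - s ^ 2 * a) + (f - b) * (t ^ 2 * f - s ^ 2 * b) := by
  have e1 : (e - a) * (t ^ 2 * e - s ^ 2 * a) + (f - b) * (t ^ 2 * f - s ^ 2 * b)
      = (t * e - s * a) ^ 2 + (t * f - s * b) ^ 2 - (t - s) ^ 2 * (a * e + b * f) := by ring
  have e2 : (t - s) ^ 2 * (a * e + b * f) ≤
      c / 2 * (l ^ 2 * (e * e + f * f) + k ^ 2 * (a * a + b * b)) := by
    rcases le_total (a * e + b * f) 0 with hX | hX
    · have := mul_nonpos_of_nonneg_of_nonpos (sq_nonneg (t - s)) hX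
      have : 0 ≤ c / 2 * (l ^ 2 * (e * e + f * f) + k ^ 2 * (a * a + b * b)) := by
        have := mul_self_nonneg e; have := mul_self_nonneg f
        have := mul_self_nonneg a; have := mul_self_nonneg b
        positivity
      linarith
    · have h1 := mul_le_mul_of_nonneg_right h hX
      have h2 : (k * l) * (a * e + b * f) ≤
          (l ^ 2 * (e * e + f * f) + k ^ 2 * (a * a + b * b)) / 2 := by
        nlinarith [sq_nonneg (k * a - l * e), sq_nonneg (k * b - l * f)]
      have h3 := mul_le_mul_of_nonneg_left h2 hc
      linarith
  rw [e1]
  linarith [sq_nonneg (t * e - s * a), sq_nonneg (t * f - s * b)]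

/-- Weighted lower bound for the quadratic form of the second difference operator. -/
lemma re_inner_diffOp_ge (y : G) {u p r : Lp ℂ 2 μ} {θ ρ : G → ℝ} {c : ℝ}
    (hp : p =ᵐ[μ] fun x => ((θ x ^ 2 : ℝ) : ℂ) * u x)
    (hr : r =ᵐ[μ] fun x => (ρ x : ℂ) * u x) (hc : 0 ≤ c) 
    (hθ : ∀ x, (θ (x + y) - θ x) ^ 2 ≤ c * (ρ x * ρ (x + y))) :
    -c * ‖r‖ ^ 2 ≤ (inner ℂ p (diffOp μ y u) : ℂ).re := by
  have hmp := (measurePreserving_add_right μ y).quasiMeasurePreserving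
  have e1 : (inner ℂ p (diffOp μ y u) : ℂ)
      = inner ℂ (trOp μ y p - p) (trOp μ y u - u) := by
    simp only [diffOp_apply, inner_sub_left, inner_sub_right, inner_smul_right, inner_trOp_left,
      trOp_comp, neg_add_cancel, trOp_zero]
    ring
  have e2 : -c * ‖r‖ ^ 2 = ∫ x, -(c / 2) * (‖trOp μ y r x‖ ^ 2 + ‖r x‖ ^ 2) ∂μ := by
    have n : ∀ v : Lp ℂ 2 μ, ∫ x, ‖v x‖ ^ 2 ∂μ = ‖v‖ ^ 2 := fun v => by
      have h := inner_self_eq_norm_sq_to_K (𝕜 := ℂ) v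
      rw [L2.inner_def] at h
      simp only [inner_self_eq_norm_sq_to_K] at h
      have h' : ((∫ x, ‖v x‖ ^ 2 ∂μ : ℝ) : ℂ) = ((‖v‖ ^ 2 : ℝ) : ℂ) := by
        rw [← integral_complex_ofReal]; simpa using h
      exact_mod_cast h'
    rw [integral_const_mul, integral_add, n, n, norm_trOp]
    · ring
    · exact (Lp.memLp _).integrable_norm_pow two_ne_zero
    · exact (Lp.memLp _).integrable_norm_pow two_ne_zero
  have hi := L2.integrable_inner (𝕜 := ℂ) (trOp μ y p - p) (trOp μ y u - u)
  have e3 := integral_re (𝕜 := ℂ) hi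
  simp only [RCLike.re_eq_complex_re] at e3
  rw [e1, L2.inner_def, ← e3, e2]
  refine integral_mono_ae ?_ hi.re ?_
  · exact (((Lp.memLp _).integrable_norm_pow two_ne_zero).add
      ((Lp.memLp _).integrable_norm_pow two_ne_zero)).const_mul _
  filter_upwards [hp, hr, hmp.ae hp, hmp.ae hr, coeFn_trOp y p, coeFn_trOp y r, coeFn_trOp y u,
    Lp.coeFn_sub (trOp μ y p) p, Lp.coeFn_sub (trOp μ y u) u] with x h1 h2 h3 h4 h5 h6 h7 h8 h9
  rw [h8, h9, Pi.sub_apply, Pi.sub_apply, h5, h6, h7, h3, h4, h1, h2]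
  have ht := hθ x
  generalize u x = z at *
  generalize u (x + y) = w at *
  generalize θ x = s at *
  generalize θ (x + y) = t at *
  generalize ρ x = k at *
  generalize ρ (x + y) = l at *
  simp only [norm_mul, mul_pow, Complex.norm_real, Real.norm_eq_abs,
    sq_abs, ← Complex.normSq_eq_norm_sq, Complex.normSq_apply, RCLike.inner_apply, Complex.mul_re,
    Complex.mul_im, Complex.sub_re, Complex.sub_im, Complex.conj_re, Complex.conj_im,
    Complex.ofReal_re, Complex.ofReal_im, map_sub, map_mul]
  refine (weighted_diff_ge (a := z.re) (b := z.im) (e := w.re) (f := w.im) hc ht).trans_eq ?_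
  ring

end Translation

end

section

section Abstract

variable {E : Type*} [NormedAddCommGroup E] [InnerProductSpace ℂ E]

/-- Coercivity estimate separating the two terms of `l + q`. -/
lemma norm_le_of_form_bounds {u l q p : E} {c₁ c : ℝ} (hc₁ : 0 ≤ c₁) (hc : 0 ≤ c)
    (hqp : ‖q‖ ^ 2 ≤ (inner ℂ p q : ℂ).re) (hpq : ‖p‖ ≤ c₁ * ‖q‖)
    (hpu : (inner ℂ p u : ℂ).re ≤ c₁ * (inner ℂ u q : ℂ).re)
    (huq : ‖u‖ ^ 2 ≤ (inner ℂ u q : ℂ).re) (hul : 0 ≤ (inner ℂ u l : ℂ).re)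
    (hpl : -c * (inner ℂ p u : ℂ).re ≤ (inner ℂ p l : ℂ).re) :
    ‖u‖ ≤ ‖l + q‖ ∧ ‖q‖ ≤ (c₁ + c * c₁ + 1) * ‖l + q‖ ∧
      ‖l‖ ≤ (c₁ + c * c₁ + 2) * ‖l + q‖ := by
  set f := l + q with hf
  have h1 : (inner ℂ u f : ℂ).re = (inner ℂ u l : ℂ).re + (inner ℂ u q : ℂ).re := by
    rw [hf, inner_add_right, Complex.add_re]
  have h2 : (inner ℂ p f : ℂ).re = (inner ℂ p l : ℂ).re + (inner ℂ p q : ℂ).re := by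
    rw [hf, inner_add_right, Complex.add_re]
  have h3 : (inner ℂ u f : ℂ).re ≤ ‖u‖ * ‖f‖ :=
    (Complex.re_le_norm _).trans (norm_inner_le_norm _ _)
  have h4 : (inner ℂ p f : ℂ).re ≤ ‖p‖ * ‖f‖ :=
    (Complex.re_le_norm _).trans (norm_inner_le_norm _ _)
  have hu : ‖u‖ ≤ ‖f‖ := by
    by_contra! hlt
    have : 0 < ‖u‖ := (norm_nonneg _).trans_lt hlt
    nlinarith
  have h5 : (inner ℂ u q : ℂ).re ≤ ‖f‖ ^ 2 := by
    nlinarith [norm_nonneg f]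
  have h6 : ‖q‖ ^ 2 ≤ c₁ * ‖q‖ * ‖f‖ + c * c₁ * ‖f‖ ^ 2 := by
    have a1 : c * (inner ℂ p u : ℂ).re ≤ c * (c₁ * ‖f‖ ^ 2) :=
      mul_le_mul_of_nonneg_left (hpu.trans (mul_le_mul_of_nonneg_left h5 hc₁)) hc
    have a2 := mul_le_mul_of_nonneg_right hpq (norm_nonneg f)
    linarith
  have hq : ‖q‖ ≤ (c₁ + c * c₁ + 1) * ‖f‖ := by
    have hcc := mul_nonneg hc hc₁
    by_contra! hlt
    have hfq : ‖f‖ ≤ ‖q‖ := by nlinarith [norm_nonneg f]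
    have hq0 : 0 < ‖q‖ := lt_of_le_of_lt (by positivity) hlt
    nlinarith [mul_le_mul_of_nonneg_left hfq (mul_nonneg hcc (norm_nonneg f)),
      mul_lt_mul_of_pos_left hlt hq0, mul_nonneg (norm_nonneg f) hq0.le]
  refine ⟨hu, hq, ?_⟩
  have : ‖l‖ ≤ ‖f‖ + ‖q‖ := by
    have : l = f - q := by rw [hf]; abel
    rw [this]; exact norm_sub_le _ _
  linarith

variable [CompleteSpace E]

open scoped ComplexOrder in
lemma exists_selfAdjoint_inverse_one_add {T : E →L[ℂ] E} (hT : IsSelfAdjoint T)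
    (hpos : ∀ u, 0 ≤ (inner ℂ u (T u) : ℂ).re) :
    ∃ R : E →L[ℂ] E, IsSelfAdjoint R ∧ ∀ u, R u + T (R u) = u := by
  have hTp : T.IsPositive := by
    refine ⟨ContinuousLinearMap.isSelfAdjoint_iff_isSymmetric.mp hT, fun u => ?_⟩
    rw [ContinuousLinearMap.reApplyInnerSelf_apply, ← inner_conj_symm, RCLike.conj_re]
    exact hpos u
  have hu : IsUnit (1 + T) := by
    have h0 : (0 : E →L[ℂ] E) ≤ T := (ContinuousLinearMap.nonneg_iff_isPositive T).mpr hTp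
    have h1 : (-1 : ℂ) ∉ spectrum ℂ T := fun h => by
      have h2 := spectrum_nonneg_of_nonneg h0 h
      have := (Complex.le_def.mp h2).1
      norm_num at this
    rw [spectrum.notMem_iff] at h1
    have h2 : (algebraMap ℂ (E →L[ℂ] E)) (-1) - T = -(1 + T) := by
      rw [map_neg, map_one]; abel
    rw [h2] at h1
    simpa using h1.neg
  obtain ⟨w, hw⟩ := hu
  refine ⟨(↑w⁻¹ : E →L[ℂ] E), ?_, fun u => ?_⟩
  · have hsa : IsSelfAdjoint (w : E →L[ℂ] E) := by
      rw [hw]; exact (IsSelfAdjoint.one _).add hT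
    have h1 : star (↑w⁻¹ : E →L[ℂ] E) * (w : E →L[ℂ] E) = 1 := by
      conv_lhs => rw [← hsa.star_eq, ← star_mul, Units.mul_inv, star_one]
    have h2 : star (↑w⁻¹ : E →L[ℂ] E) = ↑w⁻¹ := by
      calc star (↑w⁻¹ : E →L[ℂ] E) = star (↑w⁻¹ : E →L[ℂ] E) * ((w : E →L[ℂ] E) * ↑w⁻¹) := by simp
        _ = ↑w⁻¹ := by rw [← mul_assoc, h1, one_mul]
    exact h2
  · have : ((w : E →L[ℂ] E) * ↑w⁻¹) u = u := by rw [Units.mul_inv]; rfl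
    rw [hw] at this
    simpa using this

/-- For bounded `L ≥ 0` and `S` selfadjoint, the solution operator `B` of `L v + a = w`,
`v = S² a`. -/
lemma exists_solution_operator {L S : E →L[ℂ] E} (hL : IsSelfAdjoint L) (hS : IsSelfAdjoint S)
    (hpos : ∀ u, 0 ≤ (inner ℂ u (L u) : ℂ).re) :
    ∃ B : E →L[ℂ] E, IsSelfAdjoint B ∧ ∀ w, B w = S (S (w - L (B w))) := by
  have hSs := ContinuousLinearMap.isSelfAdjoint_iff_isSymmetric.mp hS
  have hT : IsSelfAdjoint (S * L * S) := by
    have := hL.conjugate S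
    rwa [hS.star_eq] at this
  obtain ⟨R, hR, hRe⟩ := exists_selfAdjoint_inverse_one_add hT (fun u => by
    have h := hSs u (L (S u))
    simp only [ContinuousLinearMap.coe_coe] at h
    simp only [mul_apply_eq_comp]
    rw [← h]
    exact hpos _)
  refine ⟨S * R * S, ?_, fun w => ?_⟩
  · have := hR.conjugate S
    rwa [hS.star_eq] at this
  · have := hRe (S w)
    simp only [mul_apply_eq_comp] at this ⊢
    rw [map_sub S w, ← eq_sub_iff_add_eq.mpr this]

lemma eq_zero_of_solution {L S : E →L[ℂ] E} (hS : IsSelfAdjoint S)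
    (hpos : ∀ u, 0 ≤ (inner ℂ u (L u) : ℂ).re) {v : E} (hv : v = S (S (- L v))) : v = 0 := by
  have hSs := ContinuousLinearMap.isSelfAdjoint_iff_isSymmetric.mp hS
  have h1 := hSs (S (- L v)) (L v)
  simp only [ContinuousLinearMap.coe_coe] at h1
  rw [← hv] at h1
  have h2 := hpos v
  rw [h1, map_neg, inner_neg_left, inner_self_eq_norm_sq_to_K] at h2
  have h3 : S (L v) = 0 := by
    have : (-(((‖S (L v)‖ : ℝ) : ℂ) ^ 2)).re = -‖S (L v)‖ ^ 2 := by
      rw [← Complex.ofReal_pow, ← Complex.ofReal_neg, Complex.ofReal_re]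
    have h2' : 0 ≤ -‖S (L v)‖ ^ 2 := this ▸ h2
    have : ‖S (L v)‖ = 0 := by nlinarith [sq_nonneg ‖S (L v)‖]
    exact norm_eq_zero.mp this
  rw [hv, map_neg, h3, neg_zero, map_zero]

end Abstract

section Lattice

variable {d : ℕ} {h : ℝ}

instance : (latMeas d h).IsAddRightInvariant := by
  unfold latMeas; infer_instance

lemma ae_latMeas_iff (hh : 0 < h) {p : Zd d → Prop} :
    (∀ᵐ z ∂latMeas d h, p z) ↔ ∀ z, p z := by
  have h0 : ENNReal.ofReal (h ^ d) ≠ 0 := by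
    simp only [ne_eq, ENNReal.ofReal_eq_zero, not_le]; positivity
  rw [latMeas, Measure.ae_ennreal_smul_measure_iff h0, Measure.ae_count_iff]

lemma l2h_ext (hh : 0 < h) {v w : l2h d h} (H : ∀ z, (v : Zd d → ℂ) z = w z) : v = w :=
  Lp.ext ((ae_latMeas_iff hh).mpr H)

/-- The discrete Laplacian `H_{0,h}`. -/
def latLap (d : ℕ) (h : ℝ) : l2h d h →L[ℂ] l2h d h :=
  ((h ^ 2 : ℂ)⁻¹) • ∑ j : Fin d, diffOp (latMeas d h) (Pi.single j 1)

lemma latLap_apply (v : l2h d h) :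
    latLap d h v = ((h ^ 2 : ℂ)⁻¹) • ∑ j : Fin d, diffOp (latMeas d h) (Pi.single j 1) v := by
  simp [latLap]

lemma coeFn_latLap (hh : 0 < h) (v : l2h d h) (z : Zd d) :
    (latLap d h v : Zd d → ℂ) z = (h ^ 2 : ℂ)⁻¹ *
      ∑ j : Fin d, (2 * (v : Zd d → ℂ) z - v (z + Pi.single j 1) - v (z - Pi.single j 1)) := by
  rw [latLap_apply, (ae_latMeas_iff hh).mp (Lp.coeFn_smul _ _) z, Pi.smul_apply, smul_eq_mul]
  congr 1
  rw [(ae_latMeas_iff hh).mp (Lp.coeFn_finsetSum _ _) z, Finset.sum_apply]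
  exact Finset.sum_congr rfl fun j _ => (ae_latMeas_iff hh).mp (coeFn_diffOp _ v) z

lemma inner_latLap_left (u v : l2h d h) :
    (inner ℂ (latLap d h u) v : ℂ) = inner ℂ u (latLap d h v) := by
  rw [latLap_apply, latLap_apply, inner_smul_left, inner_smul_right, sum_inner, inner_sum]
  simp only [inner_diffOp_left, map_inv₀, map_pow, Complex.conj_ofReal]

lemma isSelfAdjoint_latLap : IsSelfAdjoint (latLap d h) := by
  rw [ContinuousLinearMap.isSelfAdjoint_iff_isSymmetric]
  exact fun u v => inner_latLap_left u v

lemma re_inner_latLap (p u : l2h d h) : (inner ℂ p (latLap d h u) : ℂ).re =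
    (h ^ 2)⁻¹ * ∑ j : Fin d, (inner ℂ p (diffOp (latMeas d h) (Pi.single j 1) u) : ℂ).re := by
  rw [latLap_apply, inner_smul_right, inner_sum, ← Complex.re_sum]
  rw [← Complex.ofReal_pow, ← Complex.ofReal_inv, Complex.re_ofReal_mul]

lemma re_inner_latLap_nonneg (u : l2h d h) : 0 ≤ (inner ℂ u (latLap d h u) : ℂ).re := by
  rw [re_inner_latLap]
  exact mul_nonneg (by positivity) (Finset.sum_nonneg fun j _ => re_inner_diffOp_nonneg _ _)

end Lattice

end

section

/-- A potential `W ≥ 1` which is slowly varying at unit scale. -/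
structure IsSlowPotential {d : ℕ} (W : Euc d → ℝ) (c : ℝ) : Prop where
  continuous : Continuous W
  one_le : ∀ x, 1 ≤ W x
  one_le_const : 1 ≤ c
  le_mul : ∀ x y, dist x y ≤ 1 → W y ≤ c * W x

namespace IsSlowPotential

variable {d : ℕ} {W : Euc d → ℝ} {c : ℝ}

lemma pos (hW : IsSlowPotential W c) (x : Euc d) : 0 < W x := one_pos.trans_le (hW.one_le x)

lemma le_pow_mul (hW : IsSlowPotential W c) (n : ℕ) :
    ∀ x y, dist x y ≤ n → W y ≤ c ^ n * W x := by
  have hc := hW.one_le_const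
  induction n with
  | zero =>
    intro x y h
    have : x = y := by simpa using h
    simp [this]
  | succ n ih =>
    intro x y h
    have hn : (0 : ℝ) < n + 1 := by positivity
    set z := AffineMap.lineMap x y ((n : ℝ) / (n + 1)) with hz
    have h1 : dist x z ≤ n := by
      rw [hz, dist_left_lineMap, Real.norm_of_nonneg (by positivity)]
      push_cast at h
      calc (n : ℝ) / (n + 1) * dist x y ≤ (n : ℝ) / (n + 1) * (n + 1) := by gcongr
        _ = n := by field_simp
    have h2 : dist z y ≤ 1 := by
      rw [hz, dist_lineMap_right]
      have : (1 : ℝ) - n / (n + 1) = 1 / (n + 1) := by field_simp; ring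
      rw [this, Real.norm_of_nonneg (by positivity)]
      push_cast at h
      calc 1 / ((n : ℝ) + 1) * dist x y ≤ 1 / ((n : ℝ) + 1) * (n + 1) := by gcongr
        _ = 1 := by field_simp
    calc W y ≤ c * W z := hW.le_mul z y h2
      _ ≤ c * (c ^ n * W x) := by gcongr; exact ih x z h1
      _ = c ^ (n + 1) * W x := by ring

lemma le_rpow_mul (hW : IsSlowPotential W c) (x y : Euc d) :
    W y ≤ c * Real.exp (Real.log c * dist x y) * W x := by
  have hc := hW.one_le_const
  have hlog : 0 ≤ Real.log c := Real.log_nonneg hc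
  refine (hW.le_pow_mul _ x y (Nat.le_ceil _)).trans ?_
  refine mul_le_mul_of_nonneg_right ?_ (hW.pos x).le
  have h1 : c = Real.exp (Real.log c) := (Real.exp_log (by linarith)).symm
  have h2 := (Nat.ceil_lt_add_one (dist_nonneg (x := x) (y := y))).le
  calc c ^ ⌈dist x y⌉₊ = Real.exp (Real.log c * ⌈dist x y⌉₊) := by
        rw [mul_comm, Real.exp_nat_mul, ← h1]
    _ ≤ Real.exp (Real.log c * (dist x y + 1)) := by
        apply Real.exp_le_exp.mpr; gcongr
    _ = c * Real.exp (Real.log c * dist x y) := by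
        rw [mul_add, mul_one, Real.exp_add, ← h1, mul_comm]

/-- A potential slowly varying at unit scale is comparable to the square of a weight which is
slowly varying at every scale. -/
lemma exists_weight (hW : IsSlowPotential W c) :
    ∃ θ : Euc d → ℝ, ∃ C : ℝ, 0 ≤ C ∧ Measurable θ ∧ (∀ x, 1 ≤ θ x) ∧ (∀ x, W x ≤ θ x ^ 2) ∧
      (∀ x, θ x ^ 2 ≤ c * W x) ∧
      ∀ x y, ‖y‖ ≤ 1 → (θ (x + y) - θ x) ^ 2 ≤ C * ‖y‖ ^ 2 * (θ x * θ (x + y)) := by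
  have hc := hW.one_le_const
  set L := Real.log c / 2 with hL
  have hL0 : 0 ≤ L := div_nonneg (Real.log_nonneg hc) two_pos.le
  set F : Euc d → Euc d → ℝ := fun y x => √(W y) * Real.exp (-(L * dist x y)) with hF
  have hFle : ∀ x y, F y x ≤ √(c * W x) := fun x y => by
    have h1 : √(W y) ≤ √(c * W x) * Real.exp (L * dist x y) := by
      rw [Real.sqrt_le_iff]
      refine ⟨by positivity, (hW.le_rpow_mul x y).trans_eq ?_⟩
      have : 0 ≤ c * W x := mul_nonneg (by linarith) (hW.pos x).le
      rw [mul_pow, Real.sq_sqrt this, sq (Real.exp _), ← Real.exp_add, hL]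
      rw [show Real.log c / 2 * dist x y + Real.log c / 2 * dist x y = Real.log c * dist x y by ring]
      ring
    calc F y x ≤ √(c * W x) * Real.exp (L * dist x y) * Real.exp (-(L * dist x y)) := by
          simp only [hF]; gcongr
      _ = √(c * W x) := by rw [mul_assoc, ← Real.exp_add]; simp
  have hbdd : ∀ x, BddAbove (Set.range fun y => F y x) := fun x =>
    ⟨√(c * W x), by rintro _ ⟨y, rfl⟩; exact hFle x y⟩
  set θ : Euc d → ℝ := fun x => ⨆ y, F y x with hθ
  have hθge : ∀ x, √(W x) ≤ θ x := fun x => by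
    refine le_trans ?_ (le_ciSup (hbdd x) x)
    simp [hF]
  have hθle : ∀ x, θ x ≤ √(c * W x) := fun x => ciSup_le (hFle x)
  have h1θ : ∀ x, 1 ≤ θ x := fun x => le_trans (by
    rw [Real.one_le_sqrt]; exact hW.one_le x) (hθge x)
  have hslow : ∀ x x', θ x' ≤ Real.exp (L * dist x x') * θ x := fun x x' => by
    refine ciSup_le fun y => ?_
    refine le_trans ?_ (mul_le_mul_of_nonneg_left (le_ciSup (hbdd x) y) (Real.exp_pos _).le)
    simp only [hF]
    rw [mul_left_comm, ← Real.exp_add]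
    gcongr
    have := dist_triangle x x' y
    nlinarith
  have hmeas : Measurable θ := by
    refine LowerSemicontinuous.measurable ?_
    refine lowerSemicontinuous_ciSup hbdd fun y => Continuous.lowerSemicontinuous ?_
    simp only [hF]
    fun_prop
  refine ⟨θ, (L * Real.exp L) ^ 2, by positivity, hmeas, h1θ, fun x => ?_, fun x => ?_,
    fun x y hy => ?_⟩
  · rw [← Real.sq_sqrt (hW.pos x).le]
    exact pow_le_pow_left₀ (Real.sqrt_nonneg _) (hθge x) 2
  · rw [← Real.sq_sqrt (mul_nonneg (by linarith) (hW.pos x).le : 0 ≤ c * W x)]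
    exact pow_le_pow_left₀ (by linarith [h1θ x]) (hθle x) 2
  · have ha := h1θ x
    have hb := h1θ (x + y)
    have e1 := hslow x (x + y)
    have e2 := hslow (x + y) x
    rw [dist_comm] at e2
    have hd : dist x (x + y) = ‖y‖ := by simp [dist_eq_norm]
    rw [hd] at e1 e2
    have hE : Real.exp (L * ‖y‖) ≤ 1 + L * Real.exp L * ‖y‖ := by
      have h1 : Real.exp (L * ‖y‖) ≤ Real.exp L :=
        Real.exp_le_exp.mpr (by nlinarith)
      have h2 : 1 - L * ‖y‖ ≤ Real.exp (-(L * ‖y‖)) := by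
        linarith [Real.add_one_le_exp (-(L * ‖y‖))]
      have h3 := mul_le_mul_of_nonneg_left h2 (Real.exp_pos (L * ‖y‖)).le
      rw [← Real.exp_add, add_neg_cancel, Real.exp_zero] at h3
      have h4 := mul_le_mul_of_nonneg_left h1 (mul_nonneg hL0 (norm_nonneg y))
      nlinarith
    set k := L * Real.exp L * ‖y‖ with hk
    have hk0 : 0 ≤ k := by positivity
    have e3 := e1.trans (mul_le_mul_of_nonneg_right hE (by linarith))
    have e4 := e2.trans (mul_le_mul_of_nonneg_right hE (by linarith))
    have : (L * Real.exp L) ^ 2 * ‖y‖ ^ 2 = k ^ 2 := by rw [hk]; ring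
    rw [this]
    generalize θ x = s at *
    generalize θ (x + y) = t at *
    have g : ∀ s t : ℝ, 1 ≤ s → s ≤ t → t ≤ (1 + k) * s → (t - s) ^ 2 ≤ k ^ 2 * (s * t) := by
      intro s t hs hst h
      have h1 : t - s ≤ k * s := by linarith
      calc (t - s) ^ 2 ≤ (k * s) ^ 2 := pow_le_pow_left₀ (by linarith) h1 2
        _ = k ^ 2 * (s * s) := by ring
        _ ≤ k ^ 2 * (s * t) := by gcongr
    rcases le_total s t with hst | hst
    · exact g s t ha hst e3
    · have := g t s hb hst e4
      rw [mul_comm s t]; linarith [sub_sq_comm s t]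

end IsSlowPotential

section FormBounds

variable {X : Type*} [MeasurableSpace X] {μ : Measure X}

lemma re_inner_eq_integral (p q : Lp ℂ 2 μ) :
    (inner ℂ p q : ℂ).re = ∫ x, (inner ℂ (p x) (q x) : ℂ).re ∂μ := by
  have := integral_re (𝕜 := ℂ) (L2.integrable_inner (𝕜 := ℂ) p q)
  simp only [RCLike.re_eq_complex_re] at this
  rw [L2.inner_def, this]

lemma re_inner_mono {p q u r : Lp ℂ 2 μ}
    (h : ∀ᵐ x ∂μ, (inner ℂ (p x) (q x) : ℂ).re ≤ (inner ℂ (u x) (r x) : ℂ).re) :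
    (inner ℂ p q : ℂ).re ≤ (inner ℂ u r : ℂ).re := by
  rw [re_inner_eq_integral, re_inner_eq_integral]
  exact integral_mono_ae (L2.integrable_inner (𝕜 := ℂ) p q).re
    (L2.integrable_inner (𝕜 := ℂ) u r).re h

lemma norm_sq_eq_re_inner' {E : Type*} [NormedAddCommGroup E] [InnerProductSpace ℂ E] (u : E) :
    ‖u‖ ^ 2 = (inner ℂ u u : ℂ).re := by
  have := inner_self_eq_norm_sq (𝕜 := ℂ) u
  simpa using this.symm

lemma re_inner_ofReal_mul (s t : ℝ) (z : ℂ) :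
    (inner ℂ ((s : ℂ) * z) ((t : ℂ) * z) : ℂ).re = s * t * ‖z‖ ^ 2 := by
  rw [← Complex.normSq_eq_norm_sq, Complex.normSq_apply]
  simp
  ring

/-- The estimate `norm_le_of_form_bounds` for multiplication operators. -/
lemma norm_le_of_mul_form_bounds {u q r p l : Lp ℂ 2 μ} {W θ : X → ℝ} {c C : ℝ} (hc : 0 ≤ c)
    (hC : 0 ≤ C) (hq : q =ᵐ[μ] fun x => (W x : ℂ) * u x)
    (hp : p =ᵐ[μ] fun x => ((θ x ^ 2 : ℝ) : ℂ) * u x) (hr : r =ᵐ[μ] fun x => (θ x : ℂ) * u x)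
    (h1 : ∀ x, 1 ≤ W x) (h2 : ∀ x, W x ≤ θ x ^ 2) (h3 : ∀ x, θ x ^ 2 ≤ c * W x)
    (hul : 0 ≤ (inner ℂ u l : ℂ).re) (hpl : -C * ‖r‖ ^ 2 ≤ (inner ℂ p l : ℂ).re) :
    ‖u‖ ≤ ‖l + q‖ ∧ ‖q‖ ≤ (c + C * c + 1) * ‖l + q‖ ∧ ‖l‖ ≤ (c + C * c + 2) * ‖l + q‖ := by
  have hu : u =ᵐ[μ] fun x => ((1 : ℝ) : ℂ) * u x := by simp
  refine norm_le_of_form_bounds (p := p) hc hC ?_ ?_ ?_ ?_ hul ?_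
  · rw [norm_sq_eq_re_inner']
    refine re_inner_mono ?_
    filter_upwards [hq, hp] with x e1 e2
    rw [e1, e2, re_inner_ofReal_mul, re_inner_ofReal_mul]
    have := h1 x
    gcongr
    exact h2 x
  · refine Lp.norm_le_mul_norm_of_ae_le_mul ?_
    filter_upwards [hq, hp] with x e1 e2
    have := h1 x
    rw [e1, e2, norm_mul, norm_mul, Complex.norm_real, Complex.norm_real,
      Real.norm_of_nonneg (sq_nonneg _), Real.norm_of_nonneg (by linarith), ← mul_assoc]
    gcongr
    exact h3 x
  · have : c * (inner ℂ u q : ℂ).re = (inner ℂ u ((c : ℂ) • q) : ℂ).re := by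
      rw [inner_smul_right, Complex.re_ofReal_mul]
    rw [this]
    refine re_inner_mono ?_
    filter_upwards [hq, hp, hu, Lp.coeFn_smul (c : ℂ) q] with x e1 e2 e3 e4
    rw [e4, Pi.smul_apply, e1, e2, smul_eq_mul, ← mul_assoc, ← Complex.ofReal_mul]
    have a1 := re_inner_ofReal_mul (θ x ^ 2) 1 (u x)
    have a2 := re_inner_ofReal_mul 1 (c * W x) (u x)
    rw [Complex.ofReal_one, one_mul] at a1 a2
    rw [a1, a2, mul_one, one_mul]
    gcongr
    exact h3 x
  · rw [norm_sq_eq_re_inner']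
    refine re_inner_mono ?_
    filter_upwards [hq] with x e1
    rw [e1]
    have a1 := re_inner_ofReal_mul 1 1 (u x)
    have a2 := re_inner_ofReal_mul 1 (W x) (u x)
    rw [Complex.ofReal_one, one_mul] at a1 a2
    rw [a1, a2, one_mul]
    gcongr
    linarith [h1 x]
  · have h4 : ‖r‖ ^ 2 ≤ (inner ℂ p u : ℂ).re := by
      rw [norm_sq_eq_re_inner']
      refine re_inner_mono ?_
      filter_upwards [hp, hr] with x e1 e2
      rw [e1, e2]
      have a1 := re_inner_ofReal_mul (θ x ^ 2) 1 (u x)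
      rw [Complex.ofReal_one, one_mul] at a1
      rw [a1, re_inner_ofReal_mul]
      nlinarith
    nlinarith

end FormBounds

end

section

variable {d : ℕ} {W : Euc d → ℝ} {c : ℝ}

lemma latPt_add_single (h : ℝ) (z : Zd d) (j : Fin d) :
    latPt d h (z + Pi.single j 1) = latPt d h z + h • EuclideanSpace.single j (1 : ℝ) := by
  ext i
  rcases eq_or_ne i j with rfl | hij
  · simp [latPt, mul_add]
  · simp [latPt, hij]

lemma norm_le_of_lattice_equation (hW : IsSlowPotential W c) : ∃ C : ℝ, 0 ≤ C ∧
    ∀ h : ℝ, 0 < h → h ≤ 1 → ∀ v q : l2h d h,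
      (∀ z, (q : Zd d → ℂ) z = (W (latPt d h z) : ℂ) * (v : Zd d → ℂ) z) →
      ‖q‖ ≤ C * ‖latLap d h v + q‖ ∧ ‖latLap d h v‖ ≤ C * ‖latLap d h v + q‖ := by
  obtain ⟨θ, C, hC, hθm, h1θ, hWθ, hθW, hθ⟩ := hW.exists_weight
  have hc0 : 0 ≤ c := zero_le_one.trans hW.one_le_const
  have hdC : 0 ≤ d * C := by positivity
  refine ⟨c + d * C * c + 2, by positivity, fun h hh hh1 v q hq => ?_⟩
  have hcong : ∀ {f g : Zd d → ℂ}, (∀ z, f z = g z) → f =ᵐ[latMeas d h] g :=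
    fun H => ae_of_all _ H
  have hWpos := fun z => hW.pos (latPt d h z)
  let p : l2h d h := mulOp (latMeas d h) (fun z => θ (latPt d h z) ^ 2 / W (latPt d h z))
    (measurable_of_countable _) c (fun z => by
      rw [abs_of_nonneg (div_nonneg (sq_nonneg _) (hWpos z).le), div_le_iff₀ (hWpos z)]
      exact hθW _) q
  let r : l2h d h := mulOp (latMeas d h) (fun z => θ (latPt d h z) / W (latPt d h z))
    (measurable_of_countable _) c (fun z => by
      have := h1θ (latPt d h z)
      rw [abs_of_nonneg (div_nonneg (by linarith) (hWpos z).le), div_le_iff₀ (hWpos z)]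
      nlinarith [hθW (latPt d h z)]) q
  have hp : p =ᵐ[latMeas d h] fun z => ((θ (latPt d h z) ^ 2 : ℝ) : ℂ) * (v : Zd d → ℂ) z := by
    filter_upwards [coeFn_mulOp (μ := latMeas d h) q] with z hz
    rw [hz, hq, ← mul_assoc, ← Complex.ofReal_mul, div_mul_cancel₀ _ (hWpos z).ne']
  have hr : r =ᵐ[latMeas d h] fun z => (θ (latPt d h z) : ℂ) * (v : Zd d → ℂ) z := by
    filter_upwards [coeFn_mulOp (μ := latMeas d h) q] with z hz
    rw [hz, hq, ← mul_assoc, ← Complex.ofReal_mul, div_mul_cancel₀ _ (hWpos z).ne']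
  have key := norm_le_of_mul_form_bounds (l := latLap d h v) hc0 hdC (hcong hq) hp hr
    (fun z => hW.one_le _) (fun z => hWθ _) (fun z => hθW _) (re_inner_latLap_nonneg v) (by
      rw [re_inner_latLap]
      have h1 : ∀ j ∈ (Finset.univ : Finset (Fin d)), -(C * h ^ 2) * ‖r‖ ^ 2 ≤
          (inner ℂ p (diffOp (latMeas d h) (Pi.single j 1) v) : ℂ).re := fun j _ => by
        refine re_inner_diffOp_ge _ hp hr (by positivity) fun z => ?_
        have hn : ‖h • EuclideanSpace.single j (1 : ℝ)‖ = h := by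
          rw [norm_smul, Real.norm_of_nonneg hh.le]; simp
        have := hθ (latPt d h z) (h • EuclideanSpace.single j (1 : ℝ)) (hn.trans_le hh1)
        rwa [hn, ← latPt_add_single] at this
      have h2 := Finset.sum_le_sum h1
      rw [Finset.sum_const, Finset.card_univ, Fintype.card_fin, nsmul_eq_mul] at h2
      calc -(d * C) * ‖r‖ ^ 2 = (h ^ 2)⁻¹ * (d * (-(C * h ^ 2) * ‖r‖ ^ 2)) := by
            field_simp
        _ ≤ _ := by gcongr)
  refine ⟨key.2.1.trans ?_, key.2.2⟩
  gcongr
  norm_num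

/-- The resolvent of the lattice Schrödinger operator, with separation estimates uniform in the
mesh size. -/
lemma exists_lattice_resolvent (hW : IsSlowPotential W c) : ∃ C : ℝ, 0 ≤ C ∧
    ∀ h : ℝ, 0 < h → h ≤ 1 → ∃ B : l2h d h →L[ℂ] l2h d h, IsSelfAdjoint B ∧
      (∀ w z, (w - latLap d h (B w) : l2h d h) z
        = (W (latPt d h z) : ℂ) * (B w : Zd d → ℂ) z) ∧
      (∀ w, ‖w - latLap d h (B w)‖ ≤ C * ‖w‖ ∧ ‖latLap d h (B w)‖ ≤ C * ‖w‖) ∧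
      ∀ (V : Euc d → ℝ) (K : ℝ), (∀ x, W x = V x + K) → ∀ Hh : l2h d h →ₗ.[ℂ] l2h d h,
        IsDiscreteHam d h V Hh → IsResolventAt Hh (-(K : ℂ)) B := by
  obtain ⟨C, hC, hest⟩ := norm_le_of_lattice_equation hW
  refine ⟨C, hC, fun h hh hh1 => ?_⟩
  have hWpos := fun z => hW.pos (latPt d h z)
  have hae : ∀ {f g : Zd d → ℂ}, f =ᵐ[latMeas d h] g → ∀ z, f z = g z :=
    fun H => (ae_latMeas_iff hh).mp H
  set S : l2h d h →L[ℂ] l2h d h := mulOp (latMeas d h) (fun z => √(W (latPt d h z))⁻¹)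
    (measurable_of_countable _) 1 (fun z => by
      rw [abs_of_nonneg (Real.sqrt_nonneg _), Real.sqrt_le_one]
      exact inv_le_one_of_one_le₀ (hW.one_le _)) with hSdef
  have hS : IsSelfAdjoint S := isSelfAdjoint_mulOp
  have hSS : ∀ u z, (S (S u) : Zd d → ℂ) z = ((W (latPt d h z) : ℂ))⁻¹ * (u : Zd d → ℂ) z :=
    fun u z => by
      rw [hae (coeFn_mulOp _) z, hae (coeFn_mulOp _) z, ← mul_assoc, ← Complex.ofReal_mul,
        Real.mul_self_sqrt (inv_nonneg.mpr (hWpos z).le), Complex.ofReal_inv]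
  have hWne : ∀ z, (W (latPt d h z) : ℂ) ≠ 0 := fun z =>
    Complex.ofReal_ne_zero.mpr (hWpos z).ne'
  obtain ⟨B, hB, hBe⟩ := exists_solution_operator (isSelfAdjoint_latLap (d := d) (h := h)) hS
    re_inner_latLap_nonneg
  have hBW : ∀ w z, (w - latLap d h (B w) : l2h d h) z
      = (W (latPt d h z) : ℂ) * (B w : Zd d → ℂ) z := fun w z => by
    have h1 := hSS (w - latLap d h (B w)) z
    rw [← hBe w] at h1
    rw [h1, mul_inv_cancel_left₀ (hWne z)]
  have hsub : ∀ w z, (w - latLap d h (B w) : l2h d h) z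
      = (w : Zd d → ℂ) z - (latLap d h (B w) : Zd d → ℂ) z := fun w z =>
    hae (Lp.coeFn_sub _ _) z
  refine ⟨B, hB, hBW, fun w => ?_,
    fun V K hVK Hh hHh => ?_⟩
  · have := hest h hh hh1 (B w) (w - latLap d h (B w)) (hBW w)
    rwa [add_sub_cancel] at this
  have hact : ∀ (v : l2h d h) z, discAct d h V v z
      = (latLap d h v : Zd d → ℂ) z + ((W (latPt d h z) : ℂ) - K) * (v : Zd d → ℂ) z :=
    fun v z => by
      rw [coeFn_latLap hh, discAct, hVK]
      push_cast
      ring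
  have hdom : ∀ w, B w ∈ Hh.domain := fun w => by
    refine hHh.1 _ ?_
    have : discAct d h V (B w) =ᵐ[latMeas d h] (w - (K : ℂ) • B w : l2h d h) := by
      refine (ae_latMeas_iff hh).mpr fun z => ?_
      rw [hact, hae (Lp.coeFn_sub _ _) z, Pi.sub_apply, hae (Lp.coeFn_smul _ _) z, Pi.smul_apply,
        sub_mul, ← hBW, hsub, smul_eq_mul]
      ring
    rw [memLp_congr_ae this]
    exact Lp.memLp _
  have hright : ∀ w, Hh ⟨B w, hdom w⟩ - (-(K : ℂ)) • B w = w := fun w => by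
    refine l2h_ext hh fun z => ?_
    rw [hae (Lp.coeFn_sub _ _) z, Pi.sub_apply, hae (Lp.coeFn_smul _ _) z, Pi.smul_apply,
      hHh.2 ⟨B w, hdom w⟩ z, hact, sub_mul, ← hBW, hsub, smul_eq_mul]
    ring
  refine ⟨fun w => ⟨hdom w, hright w⟩, fun u => ?_⟩
  set w := Hh u - (-(K : ℂ)) • (u : l2h d h) with hw
  set e : l2h d h := B w - u with he
  have heq : e = S (S (-latLap d h e)) := by
    refine l2h_ext hh fun z => ?_
    rw [hSS, hae (Lp.coeFn_neg _) z, Pi.neg_apply]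
    have h1 : (latLap d h e : Zd d → ℂ) z = (latLap d h (B w) : Zd d → ℂ) z
        - (latLap d h (u : l2h d h) : Zd d → ℂ) z := by
      rw [he, map_sub, hae (Lp.coeFn_sub _ _) z, Pi.sub_apply]
    have h2 : (e : Zd d → ℂ) z = (B w : Zd d → ℂ) z - ((u : l2h d h) : Zd d → ℂ) z := by
      rw [he, hae (Lp.coeFn_sub _ _) z, Pi.sub_apply]
    have h3 := hBW w z
    rw [hsub] at h3
    have h4 : (w : Zd d → ℂ) z = (latLap d h (u : l2h d h) : Zd d → ℂ) z
        + (W (latPt d h z) : ℂ) * ((u : l2h d h) : Zd d → ℂ) z := by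
      rw [hw, hae (Lp.coeFn_sub _ _) z, Pi.sub_apply, hae (Lp.coeFn_smul _ _) z, Pi.smul_apply,
        hHh.2 u z, hact, smul_eq_mul]
      ring
    rw [eq_inv_mul_iff_mul_eq₀ (hWne z), h1, h2]
    linear_combination -h3 + h4
  have := eq_zero_of_solution hS re_inner_latLap_nonneg heq
  exact sub_eq_zero.mp this

end

section

open scoped SchwartzMap LineDeriv

variable {d : ℕ}

/-- The `j`-th coordinate vector. -/
abbrev basisVec (j : Fin d) : Euc d := EuclideanSpace.single j 1

/-- `-Δ` on Schwartz functions. -/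
def negLapS (g : 𝓢(Euc d, ℂ)) : 𝓢(Euc d, ℂ) := -∑ j : Fin d, ∂_{basisVec j} (∂_{basisVec j} g)

lemma negLapS_apply (g : 𝓢(Euc d, ℂ)) (x : Euc d) : negLapS g x = -lapl d g x := by
  rw [negLapS, neg_apply, sum_apply, lapl]
  rfl

/-- The translate `x ↦ g (x + a)` of a Schwartz function. -/
def transS (a : Euc d) (g : 𝓢(Euc d, ℂ)) : 𝓢(Euc d, ℂ) := g.compSubConstCLM ℂ (-a)

lemma transS_apply (a : Euc d) (g : 𝓢(Euc d, ℂ)) (x : Euc d) : transS a g x = g (x + a) := by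
  simp [transS]

lemma fourier_transS (a : Euc d) (g : 𝓢(Euc d, ℂ)) (ξ : Euc d) :
    𝓕 (transS a g) ξ = Complex.exp (2 * π * (inner ℝ a ξ : ℝ) * I) * 𝓕 g ξ := by
  have h := congrFun (VectorFourier.fourierIntegral_comp_add_right Real.fourierChar volume
    (innerₗ (Euc d)) (g : Euc d → ℂ) a) ξ
  have h1 : ((transS a g : 𝓢(Euc d, ℂ)) : Euc d → ℂ) = (g : Euc d → ℂ) ∘ fun v => v + a :=
    funext fun x => transS_apply a g x
  rw [SchwartzMap.fourier_coe, SchwartzMap.fourier_coe, h1]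
  refine h.trans ?_
  simp only [Circle.smul_def, Real.fourierChar_apply, innerₗ_apply_apply, smul_eq_mul]
  congr 2
  push_cast
  ring

lemma fourier_negLapS (g : 𝓢(Euc d, ℂ)) (ξ : Euc d) :
    𝓕 (negLapS g) ξ = (((2 * π * ‖ξ‖) ^ 2 : ℝ) : ℂ) * 𝓕 g ξ := by
  have h1 : ∀ (f : 𝓢(Euc d, ℂ)) j, (𝓕 (∂_{basisVec j} f) : 𝓢(Euc d, ℂ)) ξ = 2 * π * I * ((ξ j : ℝ) : ℂ) * 𝓕 f ξ := by
    intro f j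
    have : (inner ℝ · (basisVec j : Euc d)).HasTemperateGrowth :=
      ((innerSL ℝ).flip (basisVec j : Euc d)).hasTemperateGrowth
    rw [SchwartzMap.fourier_lineDerivOp_eq]
    rw [smul_apply, SchwartzMap.smulLeftCLM_apply_apply this, EuclideanSpace.inner_single_right]
    simp
    ring
  have h2 : 𝓕 (negLapS g) = -∑ j : Fin d, 𝓕 (∂_{basisVec j} (∂_{basisVec j} g)) := by
    have := map_sum (FourierTransform.fourierCLM ℂ 𝓢(Euc d, ℂ))
      (fun j : Fin d => ∂_{basisVec j} (∂_{basisVec j} g)) Finset.univ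
    have h3 := map_neg (FourierTransform.fourierCLM ℂ 𝓢(Euc d, ℂ))
      (∑ j : Fin d, ∂_{basisVec j} (∂_{basisVec j} g))
    simp only [FourierTransform.fourierCLM_apply] at this h3
    rw [negLapS, h3, this]
  rw [h2, neg_apply, sum_apply]
  simp only [h1]
  rw [mul_pow, EuclideanSpace.real_norm_sq_eq]
  push_cast
  rw [Finset.mul_sum, Finset.sum_mul, ← Finset.sum_neg_distrib]
  refine Finset.sum_congr rfl fun j _ => ?_
  linear_combination (-(4 * π ^ 2 * (ξ j : ℂ) ^ 2 * 𝓕 g ξ)) * I_sq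

/-- The difference Laplacian of mesh `h` on Schwartz functions. -/
def diffLapS (h : ℝ) (g : 𝓢(Euc d, ℂ)) : 𝓢(Euc d, ℂ) :=
  (h ^ 2 : ℂ)⁻¹ • ∑ j : Fin d,
    ((2 : ℂ) • g - transS (h • basisVec j) g - transS (-(h • basisVec j)) g)

/-- The Fourier symbol of the difference Laplacian. -/
def diffSymbol (h : ℝ) (ξ : Euc d) : ℝ :=
  (h ^ 2)⁻¹ * ∑ j : Fin d, 4 * Real.sin (π * h * ξ j) ^ 2

lemma fourier_diffLapS (h : ℝ) (g : 𝓢(Euc d, ℂ)) (ξ : Euc d) :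
    𝓕 (diffLapS h g) ξ = (diffSymbol h ξ : ℂ) * 𝓕 g ξ := by
  have h2 : 𝓕 (diffLapS h g) = (h ^ 2 : ℂ)⁻¹ • ∑ j : Fin d,
      ((2 : ℂ) • 𝓕 g - 𝓕 (transS (h • basisVec j) g) - 𝓕 (transS (-(h • basisVec j)) g)) := by
    simp only [← FourierTransform.fourierCLM_apply (R := ℂ), diffLapS, map_smul, map_sum, map_sub]
  rw [h2, smul_apply, sum_apply, diffSymbol]
  push_cast
  rw [smul_eq_mul, mul_assoc, Finset.sum_mul]
  congr 1
  refine Finset.sum_congr rfl fun j _ => ?_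
  rw [Pi.sub_apply, Pi.sub_apply, Pi.smul_apply, fourier_transS, fourier_transS, inner_neg_left, real_inner_smul_left, EuclideanSpace.inner_single_left,
    smul_eq_mul]
  set t : ℂ := ((π * h * ξ j : ℝ) : ℂ) with ht
  have e1 : (2 * π * ((h * (starRingEnd ℝ 1 * ξ j) : ℝ) : ℂ) * I : ℂ) = (2 * t) * I := by
    rw [ht]; simp; ring
  have e2 : (2 * π * ((-(h * (starRingEnd ℝ 1 * ξ j)) : ℝ) : ℂ) * I : ℂ) = -(2 * t) * I := by
    rw [ht]; simp; ring
  rw [e1, e2]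
  have e3 : Complex.exp (2 * t * I) + Complex.exp (-(2 * t) * I) = 2 * Complex.cos (2 * t) := by
    rw [Complex.cos]; ring
  have e4 : Complex.cos (2 * t) = 1 - 2 * Complex.sin t ^ 2 := by
    rw [Complex.cos_two_mul]
    linear_combination 2 * Complex.sin_sq_add_cos_sq t
  have e5 : Complex.sin (π * h * (ξ j : ℂ)) = Complex.sin t := by rw [ht]; push_cast; rfl
  rw [e5]
  linear_combination (- 𝓕 g ξ) * e3 + (- 2 * 𝓕 g ξ) * e4

lemma abs_sq_sub_sin_sq_le (t : ℝ) : |t ^ 2 - Real.sin t ^ 2| ≤ t ^ 4 := by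
  have hs : Real.sin t ^ 2 ≤ t ^ 2 := sq_le_sq.mpr Real.abs_sin_le_abs
  rw [abs_of_nonneg (by linarith)]
  rcases le_or_gt 1 (t ^ 2) with h | h
  · nlinarith [sq_nonneg (Real.sin t), sq_nonneg t]
  · have h1 : |t| < 1 := (sq_lt_one_iff_abs_lt_one t).mp h
    rcases eq_or_ne t 0 with rfl | h0
    · simp
    have h0' := abs_pos.mpr h0
    have h2 := (Real.sin_gt_sub_cube h0').le
    have h3 : Real.sin |t| ^ 2 = Real.sin t ^ 2 := by
      rcases abs_choice t with h | h <;> rw [h]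
      simp
    have h4 : |t| ^ 2 = t ^ 2 := sq_abs t
    have h5 : (0 : ℝ) ≤ |t| - |t| ^ 3 / 6 := by nlinarith
    have h6 := pow_le_pow_left₀ h5 h2 2
    rw [h3] at h6
    have h7 : t ^ 4 = |t| ^ 4 := by rw [show (4:ℕ) = 2 * 2 from rfl, pow_mul, pow_mul, h4]
    rw [h7, ← h4]
    nlinarith [sq_nonneg (|t| ^ 3)]

lemma le_abs_sin {δ t : ℝ} (hδ : 0 ≤ δ) (hδ1 : δ ≤ 1) (ht : |t| ≤ π * (1 - δ)) :
    2 * δ / π * |t| ≤ |Real.sin t| := by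
  have hπ := Real.pi_pos
  have h1 : Real.sin |t| ≤ |Real.sin t| := by
    rcases abs_choice t with h | h <;> rw [h]
    · exact le_abs_self _
    · rw [Real.sin_neg]; exact neg_le_abs _
  refine le_trans ?_ h1
  rcases le_total |t| (π / 2) with h | h
  · refine le_trans ?_ (Real.mul_le_sin (abs_nonneg t) h)
    gcongr
    linarith
  · rw [← Real.sin_pi_sub]
    refine le_trans ?_ (Real.mul_le_sin (by nlinarith) (by linarith))
    have : δ * |t| ≤ π - |t| := by nlinarith [mul_nonneg hδ hδ]
    calc 2 * δ / π * |t| = 2 / π * (δ * |t|) := by ring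
      _ ≤ _ := by gcongr

lemma abs_diffSymbol_sub_le {h : ℝ} (hh : 0 < h) (ξ : Euc d) :
    |diffSymbol h ξ - (2 * π * ‖ξ‖) ^ 2| ≤ h ^ 2 / 4 * (2 * π * ‖ξ‖) ^ 4 := by
  have hπ := Real.pi_pos
  have e1 : (2 * π * ‖ξ‖) ^ 2 = (h ^ 2)⁻¹ * ∑ j : Fin d, 4 * (π * h * ξ j) ^ 2 := by
    rw [mul_pow, EuclideanSpace.real_norm_sq_eq, Finset.mul_sum, Finset.mul_sum]
    refine Finset.sum_congr rfl fun j _ => ?_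
    field_simp
    ring
  have e2 : ∑ j : Fin d, (ξ j) ^ 4 ≤ ‖ξ‖ ^ 4 := by
    have h1 : ∀ j ∈ (Finset.univ : Finset (Fin d)), (ξ j) ^ 4 ≤ (ξ j) ^ 2 * ‖ξ‖ ^ 2 := fun j _ => by
      rw [show (ξ j) ^ 4 = (ξ j) ^ 2 * (ξ j) ^ 2 by ring, EuclideanSpace.real_norm_sq_eq]
      gcongr
      exact Finset.single_le_sum (f := fun i => (ξ i) ^ 2) (fun i _ => sq_nonneg _)
        (Finset.mem_univ j)
    refine (Finset.sum_le_sum h1).trans_eq ?_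
    rw [← Finset.sum_mul, ← EuclideanSpace.real_norm_sq_eq]
    ring
  rw [diffSymbol, e1, ← mul_sub, ← Finset.sum_sub_distrib, abs_mul,
    abs_of_nonneg (by positivity : 0 ≤ (h ^ 2)⁻¹)]
  calc (h ^ 2)⁻¹ * |∑ j : Fin d, (4 * Real.sin (π * h * ξ j) ^ 2 - 4 * (π * h * ξ j) ^ 2)|
      ≤ (h ^ 2)⁻¹ * ∑ j : Fin d, 4 * (π * h * ξ j) ^ 4 := by
        gcongr
        refine (Finset.abs_sum_le_sum_abs _ _).trans (Finset.sum_le_sum fun j _ => ?_)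
        rw [← mul_sub, abs_mul, abs_of_nonneg (by norm_num : (0 : ℝ) ≤ 4), abs_sub_comm]
        gcongr
        exact abs_sq_sub_sin_sq_le _
    _ = h ^ 2 / 4 * ((2 * π) ^ 4 * ∑ j : Fin d, (ξ j) ^ 4) := by
        rw [Finset.mul_sum, Finset.mul_sum, Finset.mul_sum]
        refine Finset.sum_congr rfl fun j _ => ?_
        field_simp
        ring
    _ ≤ h ^ 2 / 4 * ((2 * π) ^ 4 * ‖ξ‖ ^ 4) := by gcongr
    _ = _ := by rw [mul_pow (2 * π)]

lemma le_diffSymbol {h δ : ℝ} (hh : 0 < h) (hδ : 0 ≤ δ) (hδ1 : δ ≤ 1) {ξ : Euc d}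
    (hξ : ∀ j, |h * ξ j| ≤ 1 - δ) : (2 * δ / π) ^ 2 * (2 * π * ‖ξ‖) ^ 2 ≤ diffSymbol h ξ := by
  have hπ := Real.pi_pos
  rw [mul_pow (2 * π), EuclideanSpace.real_norm_sq_eq, diffSymbol, Finset.mul_sum, Finset.mul_sum,
    Finset.mul_sum]
  refine Finset.sum_le_sum fun j _ => ?_
  have h1 := le_abs_sin (t := π * h * ξ j) hδ hδ1 (by
    rw [mul_assoc, abs_mul, abs_of_pos hπ]; gcongr; exact hξ j)
  have h2 := pow_le_pow_left₀ (by positivity) h1 2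
  rw [sq_abs, mul_pow, sq_abs] at h2
  calc (2 * δ / π) ^ 2 * ((2 * π) ^ 2 * ξ j ^ 2)
      = (h ^ 2)⁻¹ * (4 * ((2 * δ / π) ^ 2 * (π * h * ξ j) ^ 2)) := by field_simp; ring
    _ ≤ _ := by gcongr

end

section

open scoped SchwartzMap

variable {d : ℕ}

/-- The difference Laplacian of mesh `h` on `L²(ℝ^d)`. -/
def contLap (d : ℕ) (h : ℝ) : L2 d →L[ℂ] L2 d :=
  ((h ^ 2 : ℂ)⁻¹) • ∑ j : Fin d, diffOp volume (h • basisVec j)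

lemma contLap_apply (h : ℝ) (u : L2 d) : contLap d h u
    = ((h ^ 2 : ℂ)⁻¹) • ∑ j : Fin d, diffOp volume (h • basisVec j) u := by
  simp [contLap]

lemma re_inner_contLap (h : ℝ) (p u : L2 d) : (inner ℂ p (contLap d h u) : ℂ).re =
    (h ^ 2)⁻¹ * ∑ j : Fin d, (inner ℂ p (diffOp volume (h • basisVec j) u) : ℂ).re := by
  rw [contLap_apply, inner_smul_right, inner_sum, ← Complex.re_sum, ← Complex.ofReal_pow,
    ← Complex.ofReal_inv, Complex.re_ofReal_mul]

lemma re_inner_contLap_ge {h C : ℝ} (hh : 0 < h) {p u : L2 d} {r : ℝ}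
    (H : ∀ j, -(C * h ^ 2) * r ≤ (inner ℂ p (diffOp volume (h • basisVec j) u) : ℂ).re) :
    -(d * C) * r ≤ (inner ℂ p (contLap d h u) : ℂ).re := by
  have h2 := Finset.sum_le_sum fun j (_ : j ∈ (Finset.univ : Finset (Fin d))) => H j
  rw [Finset.sum_const, Finset.card_univ, Fintype.card_fin, nsmul_eq_mul] at h2
  rw [re_inner_contLap]
  calc -(d * C) * r = (h ^ 2)⁻¹ * (d * (-(C * h ^ 2) * r)) := by field_simp
    _ ≤ _ := by gcongr

lemma toLp_transS (a : Euc d) (g : 𝓢(Euc d, ℂ)) :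
    (transS a g).toLp 2 volume = trOp volume a (g.toLp 2 volume) := by
  apply Lp.ext
  filter_upwards [(transS a g).coeFn_toLp 2 volume, coeFn_trOp (μ := volume) a (g.toLp 2 volume),
    (measurePreserving_add_right volume a).quasiMeasurePreserving.ae (g.coeFn_toLp 2 volume)]
    with x h1 h2 h3
  rw [h1, h2, h3, transS_apply]

lemma toLp_diffLapS (h : ℝ) (g : 𝓢(Euc d, ℂ)) :
    (diffLapS h g).toLp 2 volume = contLap d h (g.toLp 2 volume) := by
  rw [contLap_apply]
  simp only [← SchwartzMap.toLpCLM_apply (𝕜 := ℂ), diffLapS, map_smul, map_sum, map_sub]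
  simp only [SchwartzMap.toLpCLM_apply, toLp_transS, diffOp_apply]

lemma norm_toLp_le_of_fourier_le {f g : 𝓢(Euc d, ℂ)} {C : ℝ}
    (H : ∀ ξ, ‖𝓕 f ξ‖ ≤ C * ‖𝓕 g ξ‖) : ‖f.toLp 2 volume‖ ≤ C * ‖g.toLp 2 volume‖ := by
  rw [← SchwartzMap.norm_fourier_toL2_eq f, ← SchwartzMap.norm_fourier_toL2_eq g]
  refine Lp.norm_le_mul_norm_of_ae_le_mul ?_
  filter_upwards [(𝓕 f).coeFn_toLp 2 volume, (𝓕 g).coeFn_toLp 2 volume] with ξ h1 h2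
  rw [h1, h2]
  exact H ξ

lemma inner_toLp_fourier (f g : 𝓢(Euc d, ℂ)) :
    (inner ℂ (f.toLp 2 volume) (g.toLp 2 volume) : ℂ) = ∫ ξ, conj (𝓕 f ξ) * 𝓕 g ξ := by
  rw [← SchwartzMap.inner_fourier_toL2_eq, L2.inner_def]
  refine integral_congr_ae ?_
  filter_upwards [(𝓕 f).coeFn_toLp 2 volume, (𝓕 g).coeFn_toLp 2 volume] with ξ h1 h2
  rw [h1, h2, RCLike.inner_apply, mul_comm]

lemma integrable_conj_mul (f g : 𝓢(Euc d, ℂ)) : Integrable (fun ξ => conj (f ξ) * g ξ) := by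
  refine (L2.integrable_inner (𝕜 := ℂ) (f.toLp 2 volume) (g.toLp 2 volume)).congr ?_
  filter_upwards [f.coeFn_toLp 2 volume, g.coeFn_toLp 2 volume] with ξ h1 h2
  rw [h1, h2, RCLike.inner_apply, mul_comm]

lemma integral_norm_mul_norm_le (f g : 𝓢(Euc d, ℂ)) :
    ∫ ξ, ‖f ξ‖ * ‖g ξ‖ ≤ ‖f.toLp 2 volume‖ * ‖g.toLp 2 volume‖ := by
  have hf := (f.memLp 2).norm
  have hg := (g.memLp 2).norm
  have h1 : ∫ ξ, ‖f ξ‖ * ‖g ξ‖ = (inner ℝ (hf.toLp _) (hg.toLp _) : ℝ) := by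
    rw [L2.inner_def]
    refine integral_congr_ae ?_
    filter_upwards [hf.coeFn_toLp, hg.coeFn_toLp] with ξ h1 h2
    rw [h1, h2]
    simp [mul_comm]
  rw [h1]
  refine (real_inner_le_norm _ _).trans_eq ?_
  rw [Lp.norm_toLp, Lp.norm_toLp, eLpNorm_norm, eLpNorm_norm, SchwartzMap.norm_toLp,
    SchwartzMap.norm_toLp]

lemma norm_inner_sub_inner_le {f g f' g' p q : 𝓢(Euc d, ℂ)} {C : ℝ}
    (H : ∀ ξ, ‖conj (𝓕 f ξ) * 𝓕 g ξ - conj (𝓕 f' ξ) * 𝓕 g' ξ‖ ≤ C * (‖𝓕 p ξ‖ * ‖𝓕 q ξ‖))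
    (hC : 0 ≤ C) :
    ‖(inner ℂ (f.toLp 2 volume) (g.toLp 2 volume) : ℂ) - inner ℂ (f'.toLp 2 volume) (g'.toLp 2 volume)‖
      ≤ C * (‖p.toLp 2 volume‖ * ‖q.toLp 2 volume‖) := by
  rw [inner_toLp_fourier, inner_toLp_fourier, ← integral_sub (integrable_conj_mul _ _)
    (integrable_conj_mul _ _)]
  have hi : Integrable (fun ξ => ‖𝓕 p ξ‖ * ‖𝓕 q ξ‖) := by
    refine (integrable_conj_mul (𝓕 p) (𝓕 q)).norm.congr (ae_of_all _ fun ξ => ?_)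
    simp
  refine (norm_integral_le_of_norm_le (hi.const_mul C) (ae_of_all _ H)).trans ?_
  rw [integral_const_mul, ← SchwartzMap.norm_fourier_toL2_eq p,
    ← SchwartzMap.norm_fourier_toL2_eq q]
  gcongr
  exact integral_norm_mul_norm_le _ _

lemma norm_contLap_sub_le {h : ℝ} (hh : 0 < h) (g : 𝓢(Euc d, ℂ)) :
    ‖contLap d h (g.toLp 2 volume) - (negLapS g).toLp 2 volume‖
      ≤ h ^ 2 / 4 * ‖(negLapS (negLapS g)).toLp 2 volume‖ := by
  have h1 : contLap d h (g.toLp 2 volume) - (negLapS g).toLp 2 volume = (diffLapS h g - negLapS g).toLp 2 volume := by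
    rw [← toLp_diffLapS]
    simp only [← SchwartzMap.toLpCLM_apply (𝕜 := ℂ), map_sub]
  rw [h1]
  refine norm_toLp_le_of_fourier_le fun ξ => ?_
  have h2 : 𝓕 (diffLapS h g - negLapS g) ξ
      = ((diffSymbol h ξ - (2 * π * ‖ξ‖) ^ 2 : ℝ) : ℂ) * 𝓕 g ξ := by
    have : 𝓕 (diffLapS h g - negLapS g) = 𝓕 (diffLapS h g) - 𝓕 (negLapS g) := by
      simp only [← FourierTransform.fourierCLM_apply (R := ℂ), map_sub]
    rw [this, sub_apply, fourier_diffLapS, fourier_negLapS]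
    push_cast
    ring
  rw [h2, fourier_negLapS, fourier_negLapS, norm_mul, norm_mul, norm_mul, Complex.norm_real,
    Complex.norm_real, Real.norm_eq_abs, Real.norm_of_nonneg (sq_nonneg _)]
  calc |diffSymbol h ξ - (2 * π * ‖ξ‖) ^ 2| * ‖𝓕 g ξ‖
      ≤ h ^ 2 / 4 * (2 * π * ‖ξ‖) ^ 4 * ‖𝓕 g ξ‖ := by
        gcongr; exact abs_diffSymbol_sub_le hh ξ
    _ = _ := by ring

lemma le_re_inner_negLapS {g : 𝓢(Euc d, ℂ)} {p : L2 d} {c : ℝ}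
    (H : ∀ h : ℝ, 0 < h → h ≤ 1 → c ≤ (inner ℂ p (contLap d h (g.toLp 2 volume)) : ℂ).re) :
    c ≤ (inner ℂ p ((negLapS g).toLp 2 volume) : ℂ).re := by
  set N := ‖(negLapS (negLapS g)).toLp 2 volume‖ with hN
  have h1 : ∀ h : ℝ, 0 < h → h ≤ 1 →
      c - h ^ 2 / 4 * N * ‖p‖ ≤ (inner ℂ p ((negLapS g).toLp 2 volume) : ℂ).re := fun h hh hh1 => by
    have h2 : (inner ℂ p (contLap d h (g.toLp 2 volume) - (negLapS g).toLp 2 volume) : ℂ).re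
        ≤ ‖p‖ * (h ^ 2 / 4 * N) :=
      (Complex.re_le_norm _).trans ((norm_inner_le_norm _ _).trans
        (mul_le_mul_of_nonneg_left (norm_contLap_sub_le hh g) (norm_nonneg _)))
    rw [inner_sub_right, Complex.sub_re] at h2
    linarith [H h hh hh1]
  have h3 : Filter.Tendsto (fun h : ℝ => c - h ^ 2 / 4 * N * ‖p‖) (nhdsWithin 0 (Set.Ioi 0))
      (nhds (c - 0 ^ 2 / 4 * N * ‖p‖)) :=
    (Continuous.tendsto (by fun_prop) 0).mono_left nhdsWithin_le_nhds
  have h4 : c - 0 ^ 2 / 4 * N * ‖p‖ = c := by simp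
  rw [h4] at h3
  refine le_of_tendsto h3 ?_
  filter_upwards [Ioc_mem_nhdsGT (zero_lt_one' ℝ)] with h hh
  exact h1 h hh.1 hh.2

lemma re_inner_negLapS_nonneg (g : 𝓢(Euc d, ℂ)) :
    0 ≤ (inner ℂ (g.toLp 2 volume) ((negLapS g).toLp 2 volume) : ℂ).re :=
  le_re_inner_negLapS fun h hh _ => by
    rw [re_inner_contLap]
    exact mul_nonneg (by positivity) (Finset.sum_nonneg fun j _ => re_inner_diffOp_nonneg _ _)

lemma norm_smul_basisVec {h : ℝ} (hh : 0 < h) (j : Fin d) : ‖h • basisVec j‖ = h := by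
  rw [norm_smul, Real.norm_of_nonneg hh.le]; simp

/-- Separation estimate for `-Δ + W` on Schwartz functions. -/
lemma norm_le_of_schrodinger_equation {W : Euc d → ℝ} {c : ℝ} (hW : IsSlowPotential W c) :
    ∃ C : ℝ, 0 ≤ C ∧ ∀ (g : 𝓢(Euc d, ℂ)) (q : L2 d),
      q =ᵐ[volume] (fun x => (W x : ℂ) * g x) →
      ‖g.toLp 2 volume‖ ≤ ‖(negLapS g).toLp 2 volume + q‖ ∧ ‖q‖ ≤ C * ‖(negLapS g).toLp 2 volume + q‖ ∧
      ‖(negLapS g).toLp 2 volume‖ ≤ C * ‖(negLapS g).toLp 2 volume + q‖ := by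
  obtain ⟨θ, C, hC, hθm, h1θ, hWθ, hθW, hθ⟩ := hW.exists_weight
  have hc0 : 0 ≤ c := zero_le_one.trans hW.one_le_const
  have hdC : 0 ≤ d * C := by positivity
  refine ⟨c + d * C * c + 2, by positivity, fun g q hq0 => ?_⟩
  have hWm := hW.continuous.measurable
  have hq : q =ᵐ[volume] fun x => (W x : ℂ) * (g.toLp 2 volume : Euc d → ℂ) x := by
    filter_upwards [hq0, g.coeFn_toLp 2 volume] with x h1 h2
    rw [h1, h2]
  let p : L2 d := mulOp volume (fun x => θ x ^ 2 / W x) ((hθm.pow_const 2).div hWm) c (fun x => by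
    rw [abs_of_nonneg (div_nonneg (sq_nonneg _) (hW.pos x).le), div_le_iff₀ (hW.pos x)]
    exact hθW _) q
  let r : L2 d := mulOp volume (fun x => θ x / W x) (hθm.div hWm) c (fun x => by
    have := h1θ x
    rw [abs_of_nonneg (div_nonneg (by linarith) (hW.pos x).le), div_le_iff₀ (hW.pos x)]
    nlinarith [hθW x]) q
  have hp : p =ᵐ[volume] fun x => ((θ x ^ 2 : ℝ) : ℂ) * (g.toLp 2 volume : Euc d → ℂ) x := by
    filter_upwards [coeFn_mulOp (μ := volume) q, hq] with x hx hqx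
    rw [hx, hqx, ← mul_assoc, ← Complex.ofReal_mul, div_mul_cancel₀ _ (hW.pos x).ne']
  have hr : r =ᵐ[volume] fun x => (θ x : ℂ) * (g.toLp 2 volume : Euc d → ℂ) x := by
    filter_upwards [coeFn_mulOp (μ := volume) q, hq] with x hx hqx
    rw [hx, hqx, ← mul_assoc, ← Complex.ofReal_mul, div_mul_cancel₀ _ (hW.pos x).ne']
  have key := norm_le_of_mul_form_bounds (l := (negLapS g).toLp 2 volume) hc0 hdC hq hp hr
    hW.one_le hWθ hθW (re_inner_negLapS_nonneg g) (le_re_inner_negLapS fun h hh hh1 => by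
      refine re_inner_contLap_ge hh fun j => re_inner_diffOp_ge _ hp hr (by positivity) fun x => ?_
      have := hθ x (h • basisVec j) ((norm_smul_basisVec hh j).trans_le hh1)
      rwa [norm_smul_basisVec hh] at this)
  refine ⟨key.1, key.2.1.trans ?_, key.2.2⟩
  gcongr
  norm_num

end

section

open scoped SchwartzMap Convolution

variable {d : ℕ}

lemma continuous_trOp (f : L2 d) : Continuous fun y : Euc d => trOp volume y f := by
  have hg : Continuous fun y : Euc d => (⟨(· + y), by fun_prop⟩ : C(Euc d, Euc d)) :=
    ContinuousMap.continuous_of_continuous_uncurry _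
      (continuous_snd.add continuous_fst)
  exact Continuous.compMeasurePreservingLp (f := fun _ => f) continuous_const hg
    (fun y => measurePreserving_add_right volume y) (by norm_num)

lemma integrable_normed_smul_trOp (η : ContDiffBump (0 : Euc d)) (f : L2 d) :
    Integrable fun y : Euc d => (η.normed volume y) • trOp volume (-y) f := by
  refine ((η.integrable_normed (μ := volume)).mul_const ‖f‖).mono'
    (η.continuous_normed.smul ((continuous_trOp f).comp continuous_neg)).aestronglyMeasurable
    (ae_of_all _ fun y => ?_)
  rw [norm_smul, norm_trOp, Real.norm_of_nonneg (η.nonneg_normed y)]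

/-- Mollification on `L²(ℝ^d)` by a bump function. -/
def mollOp (η : ContDiffBump (0 : Euc d)) : L2 d →L[ℂ] L2 d :=
  LinearMap.mkContinuous
    { toFun := fun f => ∫ y, (η.normed volume y) • trOp volume (-y) f
      map_add' := fun f g => by
        rw [← integral_add (integrable_normed_smul_trOp η f) (integrable_normed_smul_trOp η g)]
        simp only [map_add, smul_add]
      map_smul' := fun c f => by
        rw [RingHom.id_apply, ← integral_smul]
        simp only [map_smul, smul_comm c] } 1
    fun f => by
      have h1 : Integrable fun y => η.normed volume y * ‖f‖ := η.integrable_normed.mul_const _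
      refine (norm_integral_le_of_norm_le h1 (ae_of_all _ fun y => ?_)).trans_eq ?_
      · rw [norm_smul, norm_trOp, Real.norm_of_nonneg (η.nonneg_normed y)]
      · rw [integral_mul_const, η.integral_normed]

lemma mollOp_apply (η : ContDiffBump (0 : Euc d)) (f : L2 d) :
    mollOp η f = ∫ y, (η.normed volume y) • trOp volume (-y) f := rfl

lemma norm_mollOp_le (η : ContDiffBump (0 : Euc d)) (f : L2 d) : ‖mollOp η f‖ ≤ ‖f‖ := by
  simpa using (mollOp η).le_of_opNorm_le (LinearMap.mkContinuous_norm_le _ zero_le_one _) f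

lemma inner_mollOp_right (η : ContDiffBump (0 : Euc d)) (f g : L2 d) :
    (inner ℂ f (mollOp η g) : ℂ)
      = ∫ y, (η.normed volume y : ℂ) * inner ℂ f (trOp volume (-y) g) := by
  have h1 := (innerSL ℂ f).integral_comp_comm (integrable_normed_smul_trOp η g)
  simp only [innerSL_apply_apply] at h1
  rw [mollOp_apply, ← h1]
  refine integral_congr_ae (ae_of_all _ fun y => ?_)
  simp only
  rw [RCLike.real_smul_eq_coe_smul (K := ℂ), inner_smul_right]
  rfl

lemma inner_mollOp_left (η : ContDiffBump (0 : Euc d)) (f g : L2 d) :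
    (inner ℂ (mollOp η f) g : ℂ) = inner ℂ f (mollOp η g) := by
  rw [← inner_conj_symm, inner_mollOp_right, inner_mollOp_right, ← integral_conj,
    ← integral_neg_eq_self (fun y => (η.normed volume y : ℂ) * inner ℂ f (trOp volume (-y) g))]
  refine integral_congr_ae (ae_of_all _ fun y => ?_)
  simp only [map_mul, Complex.conj_ofReal, inner_conj_symm, η.normed_neg, inner_trOp_left]

lemma mollOp_trOp (η : ContDiffBump (0 : Euc d)) (a : Euc d) (f : L2 d) :
    mollOp η (trOp volume a f) = trOp volume a (mollOp η f) := by
  rw [mollOp_apply, mollOp_apply, ← (trOp volume a).integral_comp_comm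
    (integrable_normed_smul_trOp η f)]
  refine integral_congr_ae (ae_of_all _ fun y => ?_)
  simp only
  rw [ContinuousLinearMap.map_smul_of_tower, trOp_comp, trOp_comp, add_comm]

lemma mollOp_contLap (η : ContDiffBump (0 : Euc d)) (h : ℝ) (f : L2 d) :
    mollOp η (contLap d h f) = contLap d h (mollOp η f) := by
  simp only [contLap_apply, map_smul, map_sum, diffOp_apply, map_sub, mollOp_trOp]

lemma tendsto_mollOp (f : L2 d) {ε : ℝ} (hε : 0 < ε) : ∃ r > 0, ∀ η : ContDiffBump (0 : Euc d),
    η.rOut ≤ r → ‖mollOp η f - f‖ ≤ ε := by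
  have h1 : Continuous fun y : Euc d => trOp volume (-y) f := (continuous_trOp f).comp continuous_neg
  obtain ⟨r, hr, hr2⟩ := Metric.continuous_iff.1 h1 0 ε hε
  refine ⟨r, hr, fun η hη => ?_⟩
  have h2 : mollOp η f - f = ∫ y, (η.normed volume y) • (trOp volume (-y) f - f) := by
    simp only [smul_sub]
    rw [integral_sub (integrable_normed_smul_trOp η f) (η.integrable_normed.smul_const f),
      η.integral_normed_smul, mollOp_apply]
  have h3 : Integrable fun y => η.normed volume y * ε := η.integrable_normed.mul_const _
  rw [h2]
  refine (norm_integral_le_of_norm_le h3 (ae_of_all _ fun y => ?_)).trans_eq ?_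
  · rw [norm_smul, Real.norm_of_nonneg (η.nonneg_normed y)]
    by_cases hy : y ∈ Function.support (η.normed volume)
    · rw [η.support_normed_eq] at hy
      have := hr2 y (lt_of_lt_of_le hy hη)
      rw [neg_zero, trOp_zero, dist_eq_norm] at this
      exact mul_le_mul_of_nonneg_left this.le (η.nonneg_normed y)
    · rw [Function.notMem_support.1 hy]; simp
  · rw [integral_mul_const, η.integral_normed, one_mul]

lemma exists_schwartz_mollOp (η : ContDiffBump (0 : Euc d)) {f : L2 d} {R : ℝ}
    (hf : ∀ᵐ x, R < ‖x‖ → (f : Euc d → ℂ) x = 0) :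
    ∃ g : 𝓢(Euc d, ℂ), HasCompactSupport g ∧ (∀ x, R + η.rOut < ‖x‖ → g x = 0) ∧
      g.toLp 2 volume = mollOp η f := by
  set f₀ : Euc d → ℂ := (Metric.closedBall 0 R).indicator f with hf₀
  have hff₀ : (f : Euc d → ℂ) =ᵐ[volume] f₀ := by
    filter_upwards [hf] with x hx
    by_cases h : x ∈ Metric.closedBall (0 : Euc d) R
    · rw [hf₀, Set.indicator_of_mem h]
    · rw [hf₀, Set.indicator_of_notMem h]
      exact hx (by simpa using h)
  have hf₀i : Integrable f₀ := by
    have : IsFiniteMeasure (volume.restrict (Metric.closedBall (0 : Euc d) R)) :=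
      ⟨by simpa using measure_closedBall_lt_top⟩
    exact IntegrableOn.integrable_indicator
      (((Lp.memLp f).restrict _).integrable one_le_two) measurableSet_closedBall
  set ρ : Euc d → ℝ := η.normed volume with hρ
  set g₀ : Euc d → ℂ := ρ ⋆[ContinuousLinearMap.lsmul ℝ ℝ] f₀ with hg₀
  have hg₀a : ∀ x, g₀ x = ∫ t, ρ t • f₀ (x - t) := fun x => by
    rw [hg₀, convolution_def]; simp
  have hsm : ContDiff ℝ (⊤ : ℕ∞) g₀ := η.hasCompactSupport_normed.contDiff_convolution_left _
    η.contDiff_normed hf₀i.locallyIntegrable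
  have hz : ∀ x, R + η.rOut < ‖x‖ → g₀ x = 0 := fun x hx => by
    rw [hg₀a]
    refine integral_eq_zero_of_ae (ae_of_all _ fun t => ?_)
    by_cases ht : t ∈ Function.support ρ
    · rw [hρ, η.support_normed_eq, mem_ball_zero_iff] at ht
      have : x - t ∉ Metric.closedBall (0 : Euc d) R := by
        rw [mem_closedBall_zero_iff, not_le]
        linarith [norm_sub_norm_le x t]
      simp only [hf₀, Set.indicator_of_notMem this, smul_zero, Pi.zero_apply]
    · simp only [Function.notMem_support.1 ht, zero_smul, Pi.zero_apply]
  have hcs : HasCompactSupport g₀ :=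
    HasCompactSupport.intro (isCompact_closedBall (0 : Euc d) (R + η.rOut)) fun x hx =>
      hz x (by simpa using hx)
  refine ⟨hcs.toSchwartzMap hsm, hcs, hz, ?_⟩
  apply Lp.ext
  refine ((hcs.toSchwartzMap hsm).coeFn_toLp 2 volume).trans ?_
  have hloc : ∀ u : L2 d, ∀ s, MeasurableSet s → volume s < ∞ →
      IntegrableOn (u : Euc d → ℂ) s := fun u s _ hs =>
    have : IsFiniteMeasure (volume.restrict s) := ⟨by simpa using hs⟩
    ((Lp.memLp u).restrict _).integrable one_le_two
  refine ae_eq_of_forall_setIntegral_eq_of_sigmaFinite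
    (fun s _ _ => (hsm.continuous.integrable_of_hasCompactSupport hcs).integrableOn)
    (hloc _) fun s hs hs2 => ?_
  have hIntg : Integrable (Function.uncurry fun x t => ρ t • f₀ (x - t))
      ((volume.restrict s).prod volume) := by
    have := Integrable.convolution_integrand (μ := volume) (ν := volume)
      (ContinuousLinearMap.lsmul ℝ ℝ) (η.integrable_normed (μ := volume)) hf₀i
    have h2 := this.restrict (s := s ×ˢ Set.univ)
    rw [← Measure.prod_restrict, Measure.restrict_univ] at h2
    simpa [Function.uncurry_def] using h2
  have hsm' : ∀ x, (hcs.toSchwartzMap hsm) x = g₀ x := fun _ => rfl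
  simp only [hsm', hg₀a]
  rw [integral_integral_swap hIntg, ← L2.inner_indicatorConstLp_one (𝕜 := ℂ) hs hs2.ne,
    inner_mollOp_right]
  refine integral_congr_ae (ae_of_all _ fun y => ?_)
  simp only
  rw [L2.inner_indicatorConstLp_one, integral_smul, Complex.real_smul]
  congr 1
  refine integral_congr_ae (ae_restrict_of_ae ?_)
  filter_upwards [coeFn_trOp (μ := volume) (-y) f,
    (measurePreserving_add_right volume (-y)).quasiMeasurePreserving.ae hff₀] with x h1 h2
  rw [h1, h2, sub_eq_add_neg]

end

section

/-- A core on which a self-adjoint operator is bounded below, with dense range, gives a resolvent. -/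
lemma exists_resolvent_of_core {E D : Type*} [NormedAddCommGroup E] [InnerProductSpace ℂ E]
    [CompleteSpace E] [AddCommGroup D] [Module ℂ D] {H : E →ₗ.[ℂ] E} (hH : IsSelfAdjoint H)
    {K : ℝ} {ι A : D →ₗ[ℂ] E} (hA : ∀ g, ∃ hd : ι g ∈ H.domain, H ⟨ι g, hd⟩ + (K : ℂ) • ι g = A g)
    (hle : ∀ g, ‖ι g‖ ≤ ‖A g‖) (horth : ∀ u, (∀ g, (inner ℂ u (A g) : ℂ) = 0) → u = 0) :
    DenseRange A ∧ ∃ B : E →L[ℂ] E, IsSelfAdjoint B ∧ IsResolventAt H (-(K : ℂ)) B ∧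
      ∀ g, B (A g) = ι g := by
  have hdense : DenseRange A := by
    have h1 : (LinearMap.range A).topologicalClosure = ⊤ := by
      rw [Submodule.topologicalClosure_eq_top_iff, Submodule.eq_bot_iff]
      intro u hu
      refine horth u fun g => ?_
      rw [← inner_conj_symm, (Submodule.mem_orthogonal _ _).1 hu _ ⟨g, rfl⟩, map_zero]
    have h2 := Submodule.dense_iff_topologicalClosure_eq_top.2 h1
    rwa [LinearMap.coe_range] at h2
  have hsym : ∀ x y : H.domain, (inner ℂ (H x) (y : E) : ℂ) = inner ℂ (x : E) (H y) := by
    have := LinearPMap.adjoint_isFormalAdjoint hH.dense_domain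
    rwa [LinearPMap.isSelfAdjoint_def.1 hH] at this
  let B : E →L[ℂ] E := ι.extendOfNorm A
  have hBA : ∀ g, B (A g) = ι g := fun g =>
    LinearMap.extendOfNorm_eq hdense ⟨1, fun x => by simpa using hle x⟩ g
  have hB1 : ∀ w, (B w, w - (K : ℂ) • B w) ∈ H.graph := fun w => by
    have hcl : IsClosed {w : E | (B w, w - (K : ℂ) • B w) ∈ H.graph} :=
      hH.isClosed.preimage (f := fun w : E => (B w, w - (K : ℂ) • B w)) (by fun_prop)
    have := closure_minimal (s := Set.range A) (by
      rintro _ ⟨g, rfl⟩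
      obtain ⟨hd, hg⟩ := hA g
      rw [Set.mem_ofPred_eq, LinearPMap.mem_graph_iff]
      refine ⟨⟨ι g, hd⟩, (hBA g).symm, ?_⟩
      rw [hBA, ← hg, add_sub_cancel_right]) hcl
    exact this (hdense w)
  have hB2 : ∀ w, ∃ hd : B w ∈ H.domain, H ⟨B w, hd⟩ = w - (K : ℂ) • B w := fun w => by
    obtain ⟨⟨y, hy⟩, hy1, hy2⟩ := (LinearPMap.mem_graph_iff H).1 (hB1 w)
    obtain rfl : y = B w := hy1
    exact ⟨hy, hy2⟩
  refine ⟨hdense, B, ?_, ⟨fun w => ?_, fun u => ?_⟩, hBA⟩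
  · rw [ContinuousLinearMap.isSelfAdjoint_iff_isSymmetric]
    intro w w'
    obtain ⟨h1, h2⟩ := hB2 w
    obtain ⟨h3, h4⟩ := hB2 w'
    have := hsym ⟨B w, h1⟩ ⟨B w', h3⟩
    rw [h2, h4] at this
    simp only [inner_sub_left, inner_sub_right, inner_smul_left, inner_smul_right,
      Complex.conj_ofReal] at this
    simp only [ContinuousLinearMap.coe_coe]
    linear_combination -this
  · obtain ⟨h1, h2⟩ := hB2 w
    exact ⟨h1, by rw [h2]; module⟩
  · obtain ⟨h1, h2⟩ := hB2 (H u - -(K : ℂ) • (u : E))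
    set w := H u - -(K : ℂ) • (u : E) with hw
    rw [← sub_eq_zero]
    refine horth _ fun g => ?_
    obtain ⟨hd, hg⟩ := hA g
    have h3 := hsym (⟨B w, h1⟩ - u) ⟨ι g, hd⟩
    have h4 : H (⟨B w, h1⟩ - u) = -((K : ℂ) • (B w - u)) := by
      rw [LinearPMap.map_sub, h2, hw]; module
    rw [h4] at h3
    rw [← hg, inner_add_right, inner_smul_right]
    simp only [inner_neg_left, inner_smul_left, Complex.conj_ofReal] at h3
    rw [AddSubgroupClass.coe_sub] at h3
    linear_combination -h3

open scoped SchwartzMap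

variable {d : ℕ}

lemma tendsto_mollOp_seq (f : L2 d) : Filter.Tendsto (fun n : ℕ => mollOp
    (⟨1 / (2 * (n + 1)), 1 / (n + 1), by positivity, by
      rw [one_div_lt_one_div (by positivity) (by positivity)]
      have : (0 : ℝ) ≤ n := Nat.cast_nonneg n
      linarith⟩ : ContDiffBump (0 : Euc d)) f) Filter.atTop (nhds f) := by
  rw [Metric.tendsto_atTop]
  intro ε hε
  obtain ⟨r, hr, h⟩ := tendsto_mollOp f (half_pos hε)
  obtain ⟨N, hN⟩ := exists_nat_one_div_lt hr
  refine ⟨N, fun n hn => ?_⟩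
  rw [dist_eq_norm]
  refine (h _ ?_).trans_lt (half_lt_self hε)
  refine le_trans ?_ hN.le
  exact one_div_le_one_div_of_le (by positivity) (by simpa using hn)

lemma inner_contLap_left (h : ℝ) (u v : L2 d) :
    (inner ℂ (contLap d h u) v : ℂ) = inner ℂ u (contLap d h v) := by
  rw [contLap_apply, contLap_apply, inner_smul_left, inner_smul_right, sum_inner, inner_sum]
  simp only [inner_diffOp_left, ← Complex.ofReal_pow, ← Complex.ofReal_inv, Complex.conj_ofReal]

/-- The tent function of radius `R`. -/
def tent (R : ℝ) (x : Euc d) : ℝ := max 0 (1 - ‖x‖ / R)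

lemma measurable_tent (R : ℝ) : Measurable (tent (d := d) R) := by
  unfold tent; fun_prop

lemma tent_nonneg (R : ℝ) (x : Euc d) : 0 ≤ tent R x := le_max_left _ _

lemma tent_le_one {R : ℝ} (hR : 0 < R) (x : Euc d) : tent R x ≤ 1 := by
  have : 0 ≤ ‖x‖ / R := by positivity
  exact max_le zero_le_one (by linarith)

lemma tent_eq_zero {R : ℝ} (hR : 0 < R) {x : Euc d} (hx : R < ‖x‖) : tent R x = 0 := by
  have : 1 < ‖x‖ / R := (one_lt_div hR).2 hx
  exact max_eq_left (by linarith)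

lemma half_le_tent {R : ℝ} (hR : 0 < R) {x : Euc d} (hx : ‖x‖ ≤ R / 2) : 1 / 2 ≤ tent R x := by
  have : ‖x‖ / R ≤ 1 / 2 := by rw [div_le_iff₀ hR]; linarith
  exact le_max_of_le_right (by linarith)

lemma abs_tent_sub_le {R : ℝ} (hR : 0 < R) (x y : Euc d) :
    |tent R x - tent R y| ≤ ‖x - y‖ / R := by
  unfold tent
  have h1 := abs_max_sub_max_le_abs (1 - ‖x‖ / R) (1 - ‖y‖ / R) 0
  rw [max_comm 0, max_comm 0]
  refine h1.trans ?_
  have h2 : (1 - ‖x‖ / R) - (1 - ‖y‖ / R) = -((‖x‖ - ‖y‖) / R) := by ring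
  rw [h2, abs_neg, abs_div, abs_of_pos hR]
  gcongr
  exact abs_norm_sub_norm_le x y

lemma norm_tent_mul_sq_le {W : Euc d → ℝ} (hW : Continuous W) (h1W : ∀ x, 1 ≤ W x) {u : L2 d}
    (hu : ∀ g : 𝓢(Euc d, ℂ), HasCompactSupport g → ∀ q : L2 d,
      q =ᵐ[volume] (fun x => (W x : ℂ) * g x) →
      (inner ℂ u ((negLapS g).toLp 2 volume + q) : ℂ) = 0)
    {R : ℝ} (hR : 0 < R) {v : L2 d} (hv : v =ᵐ[volume] fun x => (tent R x : ℂ) * u x) :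
    ‖v‖ ^ 2 ≤ d * (R ^ 2)⁻¹ * ‖u‖ ^ 2 := by
  obtain ⟨C, hC⟩ := (isCompact_closedBall (0 : Euc d) (R + 1)).exists_bound_of_continuousOn
    hW.continuousOn
  have hC0 : 0 ≤ C := (norm_nonneg _).trans (hC 0 (by simp; linarith))
  set Wb : Euc d → ℝ := (Metric.closedBall 0 (R + 1)).indicator W with hWb
  have hWbm : Measurable Wb := hW.measurable.indicator measurableSet_closedBall
  have hWbC : ∀ x, |Wb x| ≤ C := fun x => by
    by_cases hx : x ∈ Metric.closedBall (0 : Euc d) (R + 1)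
    · rw [hWb, Set.indicator_of_mem hx]; exact hC x hx
    · rw [hWb, Set.indicator_of_notMem hx, abs_zero]; exact hC0
  set Q := mulOp (volume : Measure (Euc d)) Wb hWbm C hWbC with hQ
  set X := mulOp (volume : Measure (Euc d)) (fun x => tent R x ^ 2) ((measurable_tent R).pow_const 2) 1
    (fun x => by
      rw [abs_of_nonneg (sq_nonneg _)]
      exact pow_le_one₀ (tent_nonneg R x) (tent_le_one hR x)) with hX
  have key : ∀ η : ContDiffBump (0 : Euc d), η.rOut ≤ 1 →
      (inner ℂ (mollOp η (Q u)) (X (mollOp η u)) : ℂ).re ≤ d * (R ^ 2)⁻¹ * ‖u‖ ^ 2 := by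
    intro η hη
    have hXu : ∀ᵐ x, R < ‖x‖ → (X (mollOp η u) : Euc d → ℂ) x = 0 := by
      filter_upwards [coeFn_mulOp (μ := volume) (m := fun x => tent R x ^ 2) (mollOp η u)] with x hx hx2
      rw [hx, tent_eq_zero hR hx2]
      simp
    obtain ⟨g, hgc, hgz, hg⟩ := exists_schwartz_mollOp η hXu
    have hq : Q (mollOp η (X (mollOp η u))) =ᵐ[volume] fun x => (W x : ℂ) * g x := by
      rw [← hg]
      filter_upwards [coeFn_mulOp (μ := volume) (m := Wb) (g.toLp 2 volume), g.coeFn_toLp 2 volume]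
        with x h1 h2
      rw [h1, h2]
      by_cases hx : x ∈ Metric.closedBall (0 : Euc d) (R + 1)
      · rw [hWb, Set.indicator_of_mem hx]
      · rw [hgz x, mul_zero, mul_zero]
        rw [mem_closedBall_zero_iff, not_le] at hx
        linarith
    have h0 := hu g hgc _ hq
    have h1 : -(d * (R ^ 2)⁻¹) * ‖mollOp η u‖ ^ 2
        ≤ (inner ℂ u ((negLapS g).toLp 2 volume) : ℂ).re := by
      refine le_re_inner_negLapS fun h hh hh1 => ?_
      rw [hg, ← mollOp_contLap, ← inner_mollOp_left, ← inner_contLap_left, ← inner_conj_symm,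
        Complex.conj_re]
      refine re_inner_contLap_ge hh fun j => re_inner_diffOp_ge (θ := tent R) (ρ := 1) _
        (coeFn_mulOp (μ := volume) _) (by simp) (by positivity) fun x => ?_
      have h2 := abs_tent_sub_le hR (x + h • basisVec j) x
      rw [add_sub_cancel_left, norm_smul_basisVec hh] at h2
      rw [← sq_abs]
      calc |tent R (x + h • basisVec j) - tent R x| ^ 2 ≤ (h / R) ^ 2 := by gcongr
        _ = _ := by simp only [Pi.one_apply]; field_simp
    rw [inner_add_right, ← inner_mulOp_left, ← inner_mollOp_left] at h0
    have h2 := congrArg Complex.re h0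
    rw [Complex.add_re, Complex.zero_re] at h2
    have h3 : ‖mollOp η u‖ ^ 2 ≤ ‖u‖ ^ 2 := by gcongr; exact norm_mollOp_le η u
    have h4 : (d * (R ^ 2)⁻¹) * ‖mollOp η u‖ ^ 2 ≤ (d * (R ^ 2)⁻¹) * ‖u‖ ^ 2 := by gcongr
    linarith
  have hlim := ((tendsto_mollOp_seq (Q u)).inner (𝕜 := ℂ)
    ((X.continuous.tendsto u).comp (tendsto_mollOp_seq u)))
  have hlim2 := (Complex.continuous_re.tendsto _).comp hlim
  have h5 := le_of_tendsto' hlim2 fun n => key _ (by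
    refine (div_le_one (by positivity)).2 ?_
    have : (0 : ℝ) ≤ n := Nat.cast_nonneg n
    linarith)
  refine le_trans ?_ h5
  rw [norm_sq_eq_re_inner']
  refine re_inner_mono ?_
  filter_upwards [hv, coeFn_mulOp (μ := volume) (m := Wb) u,
    coeFn_mulOp (μ := volume) (m := fun x => tent R x ^ 2) u] with x h1 h2 h3
  rw [h1, h2, h3, re_inner_ofReal_mul, re_inner_ofReal_mul]
  by_cases hx : x ∈ Metric.closedBall (0 : Euc d) (R + 1)
  · rw [hWb, Set.indicator_of_mem hx]
    have := h1W x
    gcongr ?_ * _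
    nlinarith [sq_nonneg (tent R x)]
  · rw [tent_eq_zero hR]
    · simp
    · rw [mem_closedBall_zero_iff, not_le] at hx
      linarith

/-- `-Δ + W` on `C_c^∞(ℝ^d)` has range with trivial orthogonal complement. -/
lemma eq_zero_of_orthogonal_range {W : Euc d → ℝ} (hW : Continuous W) (h1W : ∀ x, 1 ≤ W x)
    {u : L2 d}
    (hu : ∀ g : 𝓢(Euc d, ℂ), HasCompactSupport g → ∀ q : L2 d,
      q =ᵐ[volume] (fun x => (W x : ℂ) * g x) →
      (inner ℂ u ((negLapS g).toLp 2 volume + q) : ℂ) = 0) : u = 0 := by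
  have key : ∀ r : ℕ, ∀ᵐ x, ‖x‖ ≤ r → (u : Euc d → ℂ) x = 0 := fun r => by
    set m : Euc d → ℝ := (Metric.closedBall 0 (r : ℝ)).indicator 1 with hm
    have hmm : Measurable m := measurable_one.indicator measurableSet_closedBall
    have hm1 : ∀ x, |m x| ≤ 1 := fun x => by
      by_cases hx : x ∈ Metric.closedBall (0 : Euc d) r
      · rw [hm, Set.indicator_of_mem hx]; simp
      · rw [hm, Set.indicator_of_notMem hx]; simp
    set v := mulOp (volume : Measure (Euc d)) m hmm 1 hm1 u with hv
    have hle : ∀ᶠ R : ℝ in Filter.atTop, ‖v‖ ^ 2 ≤ 4 * (d * (R ^ 2)⁻¹ * ‖u‖ ^ 2) := by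
      filter_upwards [Filter.eventually_ge_atTop (2 * (r : ℝ)), Filter.eventually_gt_atTop 0]
        with R hR2 hR
      set t := mulOp (volume : Measure (Euc d)) (tent R) (measurable_tent R) 1 (fun x => by
        rw [abs_of_nonneg (tent_nonneg R x)]; exact tent_le_one hR x) u with ht
      have h1 := norm_tent_mul_sq_le hW h1W hu hR (coeFn_mulOp (μ := volume) (hm := measurable_tent R)
        (C := 1) (hC := fun x => by
        rw [abs_of_nonneg (tent_nonneg R x)]; exact tent_le_one hR x) u)
      have h2 : ‖v‖ ≤ 2 * ‖t‖ := by
        refine Lp.norm_le_mul_norm_of_ae_le_mul ?_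
        filter_upwards [coeFn_mulOp (μ := volume) (m := m) u,
          coeFn_mulOp (μ := volume) (m := tent R) u] with x h1 h2
        rw [hv, ht, h1, h2, norm_mul, norm_mul, ← mul_assoc, Complex.norm_real, Complex.norm_real,
          Real.norm_eq_abs, Real.norm_eq_abs, abs_of_nonneg (tent_nonneg R x)]
        refine mul_le_mul_of_nonneg_right ?_ (norm_nonneg _)
        by_cases hx : x ∈ Metric.closedBall (0 : Euc d) r
        · have := half_le_tent hR (x := x) (by rw [mem_closedBall_zero_iff] at hx; linarith)
          linarith [hm1 x]
        · rw [hm, Set.indicator_of_notMem hx, abs_zero]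
          linarith [tent_nonneg R x]
      calc ‖v‖ ^ 2 ≤ (2 * ‖t‖) ^ 2 := by gcongr
        _ = 4 * ‖t‖ ^ 2 := by ring
        _ ≤ _ := by gcongr
    have hlim : Filter.Tendsto (fun R : ℝ => 4 * (d * (R ^ 2)⁻¹ * ‖u‖ ^ 2)) Filter.atTop
        (nhds (4 * (d * 0 * ‖u‖ ^ 2))) :=
      (((tendsto_inv_atTop_zero.comp (Filter.tendsto_pow_atTop two_ne_zero)).const_mul _).mul_const
        _).const_mul _
    have h0 := ge_of_tendsto hlim hle
    have hv0 : v = 0 := by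
      rw [← norm_eq_zero]
      nlinarith [norm_nonneg v]
    have h3 : (v : Euc d → ℂ) =ᵐ[volume] 0 := by rw [hv0]; exact Lp.coeFn_zero _ _ _
    filter_upwards [h3, coeFn_mulOp (μ := volume) (m := m) u] with x h1 h2 hx
    rw [hv, h2, hm, Set.indicator_of_mem (by simpa using hx)] at h1
    simpa using h1
  apply Lp.ext
  filter_upwards [ae_all_iff.2 key, Lp.coeFn_zero ℂ 2 (volume : Measure (Euc d))] with x hx h0
  obtain ⟨n, hn⟩ := exists_nat_ge ‖x‖
  rw [hx n hn, h0, Pi.zero_apply]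

end

section

open scoped SchwartzMap LineDeriv

variable {d : ℕ}

/-- The space of test functions, inside the Schwartz space. -/
def testS (d : ℕ) : Submodule ℂ 𝓢(Euc d, ℂ) where
  carrier := {g | HasCompactSupport g}
  add_mem' {f g} hf hg := by
    have : HasCompactSupport (⇑f + ⇑g) := HasCompactSupport.add hf hg
    exact this
  zero_mem' := by
    have : HasCompactSupport (0 : Euc d → ℂ) := HasCompactSupport.zero
    exact this
  smul_mem' c f hf := by
    have : HasCompactSupport (c • ⇑f) := HasCompactSupport.smul_left (f := fun _ => c) hf
    exact this

lemma memLp_mul_testS {W : Euc d → ℝ} (hW : Continuous W) (g : testS d) :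
    MemLp (fun x => (W x : ℂ) * g.1 x) 2 (volume : Measure (Euc d)) :=
  Continuous.memLp_of_hasCompactSupport
    ((Complex.continuous_ofReal.comp hW).mul g.1.continuous) (HasCompactSupport.mul_left g.2)

lemma negLapS_add (f g : 𝓢(Euc d, ℂ)) : negLapS (f + g) = negLapS f + negLapS g := by
  simp only [negLapS, LineDeriv.lineDerivOp_add, Finset.sum_add_distrib]
  abel

lemma negLapS_smul (c : ℂ) (g : 𝓢(Euc d, ℂ)) : negLapS (c • g) = c • negLapS g := by
  simp only [negLapS, LineDeriv.lineDerivOp_smul, Finset.smul_sum, smul_neg]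

/-- The operator `-Δ + W` on test functions. -/
def schrodingerOp {W : Euc d → ℝ} (hW : Continuous W) : testS d →ₗ[ℂ] L2 d where
  toFun g := (negLapS g.1).toLp 2 volume + (memLp_mul_testS hW g).toLp _
  map_add' f g := by
    have h1 : (memLp_mul_testS hW (f + g)).toLp _
        = (memLp_mul_testS hW f).toLp _ + (memLp_mul_testS hW g).toLp _ := by
      rw [← MemLp.toLp_add]
      congr 1
      funext x
      simp [mul_add]
    rw [h1, Submodule.coe_add, negLapS_add]
    simp only [← SchwartzMap.toLpCLM_apply (𝕜 := ℂ), map_add]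
    abel
  map_smul' c g := by
    have h1 : (memLp_mul_testS hW (c • g)).toLp _ = c • (memLp_mul_testS hW g).toLp _ := by
      rw [← MemLp.toLp_const_smul]
      congr 1
      funext x
      simp [mul_left_comm]
    rw [h1, Submodule.coe_smul, negLapS_smul]
    simp only [← SchwartzMap.toLpCLM_apply (𝕜 := ℂ), map_smul, RingHom.id_apply, smul_add]

lemma schrodingerOp_apply {W : Euc d → ℝ} (hW : Continuous W) (g : testS d) :
    schrodingerOp hW g = (negLapS g.1).toLp 2 volume + (memLp_mul_testS hW g).toLp _ := rfl

/-- The inclusion of the test functions in `L²(ℝ^d)`. -/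
def testIncl (d : ℕ) : testS d →ₗ[ℂ] L2 d :=
  (SchwartzMap.toLpCLM ℂ (E := Euc d) ℂ 2 volume).toLinearMap ∘ₗ (testS d).subtype

lemma testIncl_apply (g : testS d) : testIncl d g = g.1.toLp 2 volume := rfl

lemma schrodingerOp_core {V W : Euc d → ℝ} {K : ℝ} (hW : Continuous W)
    (hWV : ∀ x, W x = V x + K) {H : L2 d →ₗ.[ℂ] L2 d} (hH : IsSchrodingerOp d V H) (g : testS d) :
    ∃ hd : testIncl d g ∈ H.domain,
      H ⟨testIncl d g, hd⟩ + (K : ℂ) • testIncl d g = schrodingerOp hW g := by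
  have h2 : MemLp (g.1 : Euc d → ℂ) 2 (volume : Measure (Euc d)) := g.1.memLp 2
  have h4 : (fun x => -(lapl d g.1 x) + (V x : ℂ) * g.1 x) =ᵐ[volume]
      (schrodingerOp hW g - (K : ℂ) • testIncl d g : L2 d) := by
    filter_upwards [Lp.coeFn_sub (schrodingerOp hW g) ((K : ℂ) • testIncl d g),
      Lp.coeFn_add ((negLapS g.1).toLp 2 volume) ((memLp_mul_testS hW g).toLp _),
      (memLp_mul_testS hW g).coeFn_toLp,
      Lp.coeFn_smul (K : ℂ) (testIncl d g), g.1.coeFn_toLp 2 volume,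
      (negLapS g.1).coeFn_toLp 2 volume] with x h1 h2 h3 h4 h5 h6
    rw [h1, Pi.sub_apply, schrodingerOp_apply, h2, Pi.add_apply, h3, h4, Pi.smul_apply,
      testIncl_apply, h5, h6, negLapS_apply, hWV]
    push_cast
    rw [smul_eq_mul]
    ring
  have h3 : MemLp (fun x => -(lapl d g.1 x) + (V x : ℂ) * g.1 x) 2 (volume : Measure (Euc d)) :=
    (memLp_congr_ae h4).2 (Lp.memLp _)
  obtain ⟨hd, hg⟩ := hH.2 g.1 (g.1.smooth _) g.2 h2 h3
  have h5 : h3.toLp _ = schrodingerOp hW g - (K : ℂ) • testIncl d g :=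
    Lp.ext (h3.coeFn_toLp.trans h4)
  have h6 : H ⟨testIncl d g, hd⟩ = schrodingerOp hW g - (K : ℂ) • testIncl d g := hg.trans h5
  exact ⟨hd, by rw [h6, sub_add_cancel]⟩

/-- The resolvent of a Schrödinger operator below its potential. -/
lemma exists_schrodinger_resolvent {V W : Euc d → ℝ} {K c : ℝ} (hW : IsSlowPotential W c)
    (hWV : ∀ x, W x = V x + K) {H : L2 d →ₗ.[ℂ] L2 d} (hH : IsSchrodingerOp d V H) :
    ∃ B : L2 d →L[ℂ] L2 d, IsSelfAdjoint B ∧ IsResolventAt H (-(K : ℂ)) B ∧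
      ∀ p : L2 d → Prop, IsClosed {f | p f} → (∀ (g : 𝓢(Euc d, ℂ)) (q : L2 d),
        q =ᵐ[volume] (fun x => (W x : ℂ) * g x) →
        B ((negLapS g).toLp 2 volume + q) = g.toLp 2 volume →
        p ((negLapS g).toLp 2 volume + q)) → ∀ f, p f := by
  obtain ⟨C, hC, hCW⟩ := norm_le_of_schrodinger_equation hW
  obtain ⟨hdense, B, hB1, hB2, hB3⟩ := exists_resolvent_of_core (ι := testIncl d)
    (A := schrodingerOp hW.continuous) (K := K) hH.1 (schrodingerOp_core hW.continuous hWV hH)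
    (fun g => (hCW g.1 _ (memLp_mul_testS hW.continuous g).coeFn_toLp).1)
    (fun u hu => eq_zero_of_orthogonal_range hW.continuous hW.one_le fun g hg q hq => by
      have h1 : q = (memLp_mul_testS hW.continuous ⟨g, hg⟩).toLp _ :=
        Lp.ext (hq.trans (memLp_mul_testS hW.continuous ⟨g, hg⟩).coeFn_toLp.symm)
      rw [h1]
      exact hu ⟨g, hg⟩)
  refine ⟨B, hB1, hB2, fun p hp hall f => ?_⟩
  have h := closure_minimal (s := Set.range (schrodingerOp hW.continuous)) (t := {f | p f}) (by
    rintro _ ⟨g, rfl⟩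
    exact hall g.1 _ (memLp_mul_testS hW.continuous g).coeFn_toLp (hB3 g)) hp
  exact h (hdense f)

end

section

variable {ι : Type} [Fintype ι]

/-- The character `x ↦ e^{2πi n·x}`. -/
def expChar (n : ι → ℤ) (x : ι → ℝ) : ℂ := Complex.exp (2 * π * I * ∑ j, (n j : ℂ) * x j)

lemma norm_expChar (n : ι → ℤ) (x : ι → ℝ) : ‖expChar n x‖ = 1 := by
  have : 2 * π * I * ∑ j, (n j : ℂ) * x j = ((2 * π * ∑ j, (n j : ℝ) * x j : ℝ) : ℂ) * I := by
    push_cast; ring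
  rw [expChar, this, Complex.norm_exp_ofReal_mul_I]

lemma continuous_expChar (n : ι → ℤ) : Continuous (expChar n) := by
  unfold expChar; fun_prop

lemma expChar_add_int (n m : ι → ℤ) (x : ι → ℝ) :
    expChar n (x + fun i => (m i : ℝ)) = expChar n x := by
  rw [expChar, expChar, Complex.exp_eq_exp_iff_exists_int]
  refine ⟨∑ j, n j * m j, ?_⟩
  push_cast
  rw [show (∑ j, (n j : ℂ) * m j) * (2 * π * I) = 2 * π * I * ∑ j, (n j : ℂ) * m j by ring,
    ← mul_add, ← Finset.sum_add_distrib]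
  congr 1
  refine Finset.sum_congr rfl fun j _ => ?_
  simp only [Pi.add_apply, ofReal_add, ofReal_intCast]
  ring

lemma mFourier_coe (n : ι → ℤ) (x : ι → ℝ) :
    UnitAddTorus.mFourier n (fun i => (x i : UnitAddCircle)) = expChar n x := by
  simp only [UnitAddTorus.mFourier, ContinuousMap.coe_mk, fourier_coe_apply, expChar]
  rw [← Complex.exp_sum, Finset.mul_sum]
  congr 1
  refine Finset.sum_congr rfl fun j _ => ?_
  push_cast; ring

/-- The unit cube with lower corner `a`. -/
def unitCube (a : ι → ℝ) : Set (ι → ℝ) := {x | ∀ i, x i ∈ Set.Ioc (a i) (a i + 1)}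

lemma measurableSet_unitCube (a : ι → ℝ) : MeasurableSet (unitCube a) :=
  MeasurableSet.univ_pi' fun _ => measurableSet_Ioc

lemma integral_expChar_unitCube (k : ι → ℤ) (a : ι → ℝ) [Decidable (k = 0)] :
    ∫ x in unitCube a, expChar k x = if k = 0 then 1 else 0 := by
  classical
  simp only [← mFourier_coe]
  rw [unitCube, ← UnitAddTorus.integral_preimage (fun t => UnitAddTorus.mFourier k t) a]
  have h := orthonormal_iff_ite.mp (UnitAddTorus.orthonormal_mFourier (d := ι)) 0 k
  rw [ContinuousMap.inner_toLp] at h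
  simp only [UnitAddTorus.mFourier_zero, eq_comm (a := (0 : ι → ℤ))] at h
  simpa using h

/-- If the integer translates of `G ≥ 0` sum to `1`, the Fourier transform of `G` at integer
points is `δ₀`. -/
lemma integral_expChar_mul_of_tsum {G : (ι → ℝ) → ℝ} (hG : Integrable G) (h0 : ∀ x, 0 ≤ G x)
    (hs : ∀ x, ∑' n : ι → ℤ, G (x + fun i => (n i : ℝ)) = 1) (k : ι → ℤ) [Decidable (k = 0)] :
    ∫ x, expChar k x * (G x : ℂ) = if k = 0 then 1 else 0 := by
  set s : (ι → ℤ) → Set (ι → ℝ) := fun n => unitCube fun i => (n i : ℝ) with hsdef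
  have hm : ∀ n, MeasurableSet (s n) := fun n => measurableSet_unitCube _
  have hu : ⋃ n, s n = Set.univ := by
    refine Set.eq_univ_of_forall fun x => Set.mem_iUnion.mpr ⟨fun i => ⌈x i⌉ - 1, fun i => ?_⟩
    have h1 := Int.ceil_lt_add_one (x i)
    have h2 := Int.le_ceil (x i)
    push_cast
    constructor <;> linarith
  have hd : Pairwise (Function.onFun Disjoint s) := by
    intro n m hnm
    refine Set.disjoint_left.mpr fun x hn hm' => hnm (funext fun i => ?_)
    have h1 := hn i
    have h2 := hm' i
    have e1 : (n i : ℝ) < m i + 1 := h1.1.trans_le h2.2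
    have e2 : (m i : ℝ) < n i + 1 := h2.1.trans_le h1.2
    norm_cast at e1 e2
    omega
  have hF : Integrable fun x => expChar k x * (G x : ℂ) := by
    refine hG.ofReal.bdd_mul (c := 1) (continuous_expChar k).aestronglyMeasurable
      (ae_of_all _ fun x => (norm_expChar k x).le)
  have tr : ∀ {E : Type} [NormedAddCommGroup E] [NormedSpace ℝ E] (F : (ι → ℝ) → E) (n : ι → ℤ),
      ∫ x in s n, F x = ∫ x in s 0, F (x + fun i => (n i : ℝ)) := by
    intro E _ _ F n
    have := (measurePreserving_add_right (volume : Measure (ι → ℝ))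
      (fun i => (n i : ℝ))).setIntegral_preimage_emb
      (MeasurableEquiv.addRight (fun i => (n i : ℝ))).measurableEmbedding F (s n)
    rw [← this]
    congr 2
    ext x
    simp only [hsdef, unitCube, Set.mem_preimage, Set.mem_ofPred_eq, Pi.add_apply, Set.mem_Ioc,
      Pi.zero_apply, Int.cast_zero]
    refine forall_congr' fun i => ?_
    constructor <;> rintro ⟨h1, h2⟩ <;> constructor <;> linarith
  have S1 := hasSum_integral_iUnion hm hd hF.integrableOn
  have S2 := hasSum_integral_iUnion hm hd hG.integrableOn
  rw [hu, setIntegral_univ] at S1 S2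
  rw [funext fun n => tr (fun x => expChar k x * (G x : ℂ)) n] at S1
  rw [funext fun n => tr G n] at S2
  simp only [expChar_add_int] at S1
  have S3 := hasSum_integral_of_summable_integral_norm (μ := volume.restrict (s 0))
    (F := fun (n : ι → ℤ) x => expChar k x * (G (x + fun i => (n i : ℝ)) : ℂ)) (fun n => by
      have := (hF.comp_add_right (fun i => (n i : ℝ))).integrableOn (s := s 0)
      simpa only [expChar_add_int] using! this) (by
      refine S2.summable.congr fun n => ?_
      refine integral_congr_ae (ae_of_all _ fun x => ?_)
      simp only [norm_mul, norm_expChar, one_mul, norm_real, Real.norm_of_nonneg (h0 _)])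
  rw [S1.unique S3, ← integral_expChar_unitCube k (fun i => ((0 : ι → ℤ) i : ℝ))]
  refine integral_congr_ae (ae_of_all _ fun x => ?_)
  simp only
  rw [tsum_mul_left, ← Complex.ofReal_tsum, hs x, ofReal_one, mul_one]

/-- Parseval's identity for a function supported in the centered unit cube. -/
lemma hasSum_sq_integral_expChar {ψ : (ι → ℝ) → ℂ} (hψ : Continuous ψ) {C : ℝ}
    (hC : ∀ x, ‖ψ x‖ ≤ C) {a : ι → ℝ} (hsupp : ∀ x, x ∉ unitCube a → ψ x = 0) :
    HasSum (fun m : ι → ℤ => ‖∫ x, expChar m x * ψ x‖ ^ 2) (∫ x, ‖ψ x‖ ^ 2) := by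
  let _ : MeasureSpace UnitAddCircle := instMeasureSpaceUnitAddCircle
  have : IsProbabilityMeasure (volume : Measure UnitAddCircle) :=
    inferInstanceAs (IsProbabilityMeasure AddCircle.haarAddCircle)
  set Ψ : UnitAddTorus ι → ℂ := fun t => ψ (UnitAddTorus.measurableEquivPiIoc a t).1
  have hΨm : Measurable Ψ := hψ.measurable.comp
    (measurable_subtype_coe.comp (UnitAddTorus.measurableEquivPiIoc a).measurable)
  have hΨ : MemLp Ψ 2 volume :=
    MemLp.of_bound hΨm.aestronglyMeasurable C (ae_of_all _ fun t => hC _)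
  have hΨx : ∀ x ∈ unitCube a, Ψ (fun i => (x i : UnitAddCircle)) = ψ x := by
    intro x hx
    have := (UnitAddTorus.measurableEquivPiIoc a).apply_symm_apply ⟨x, hx⟩
    simp only [UnitAddTorus.coe_symm_measurableEquivPiIoc_apply] at this
    simp only [Ψ, this]
  have h := UnitAddTorus.hasSum_sq_mFourierCoeff (hΨ.toLp Ψ)
  have hl : ∀ n, UnitAddTorus.mFourierCoeff (hΨ.toLp Ψ) (-n) = ∫ x, expChar n x * ψ x := by
    intro n
    have e1 : UnitAddTorus.mFourierCoeff (hΨ.toLp Ψ) (-n) = UnitAddTorus.mFourierCoeff Ψ (-n) :=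
      integral_congr_ae ((ae_eq_refl _).smul hΨ.coeFn_toLp)
    rw [e1, UnitAddTorus.mFourierCoeff_eq_integral Ψ _ a]
    refine Eq.trans ?_ (setIntegral_eq_integral_of_forall_compl_eq_zero (s := unitCube a)
      (fun x hx => by rw [hsupp x hx, mul_zero]))
    refine setIntegral_congr_fun (measurableSet_unitCube a) fun x hx => ?_
    simp only [neg_neg, mFourier_coe, hΨx x hx, smul_eq_mul]
  have hr : ∫ t, ‖(hΨ.toLp Ψ) t‖ ^ 2 = ∫ x, ‖ψ x‖ ^ 2 := by
    have e1 : ∫ t, ‖(hΨ.toLp Ψ) t‖ ^ 2 = ∫ t, ‖Ψ t‖ ^ 2 :=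
      integral_congr_ae (hΨ.coeFn_toLp.mono fun t ht => by simp only [ht])
    rw [e1, UnitAddTorus.integral_preimage (fun t => ‖Ψ t‖ ^ 2) a]
    refine Eq.trans ?_ (setIntegral_eq_integral_of_forall_compl_eq_zero (s := unitCube a)
      (fun x hx => by rw [hsupp x hx, norm_zero, zero_pow two_ne_zero]))
    refine setIntegral_congr_fun (measurableSet_unitCube a) fun x hx => ?_
    simp only [hΨx x hx]
  rw [hr] at h
  have h' := (Equiv.neg (ι → ℤ)).hasSum_iff.mpr h
  simpa only [Function.comp_def, Equiv.neg_apply, hl] using h'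

end

section

open scoped SchwartzMap

variable {d : ℕ}

/-- Assumption (φ), with `supp φ̂` at distance at least `δ` from the boundary of the cube. -/
structure IsProfile (φ : 𝓢(Euc d, ℂ)) (δ : ℝ) : Prop where
  pos : 0 < δ
  le_half : δ ≤ 1 / 2
  tsum_eq : ∀ ξ, ∑' n : Zd d, ‖𝓕 φ (ξ + latVec d n)‖ ^ 2 = 1
  le_of_ne_zero : ∀ ξ, 𝓕 φ ξ ≠ 0 → ∀ j, |ξ j| ≤ 1 - δ

lemma exists_isProfile {φ : 𝓢(Euc d, ℂ)}
    (h1 : ∀ ξ : Euc d, ∑' n : Zd d, ‖𝓕 (φ : Euc d → ℂ) (ξ + latVec d n)‖ ^ 2 = 1)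
    (h2 : tsupport (𝓕 (φ : Euc d → ℂ)) ⊆ {ξ | ∀ j, ξ j ∈ Set.Ioo (-1 : ℝ) 1}) :
    ∃ δ, IsProfile φ δ := by
  set T := tsupport (𝓕 (φ : Euc d → ℂ))
  have hlt : ∀ ξ ∈ T, ‖WithLp.ofLp ξ‖ < 1 := fun ξ hξ =>
    (pi_norm_lt_iff one_pos).mpr fun j => by
      rw [Real.norm_eq_abs, abs_lt]; exact h2 hξ j
  have hcont : Continuous fun ξ : Euc d => ‖WithLp.ofLp ξ‖ := by fun_prop
  have hcomp : IsCompact T := by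
    refine Metric.isCompact_of_isClosed_isBounded (isClosed_tsupport _) ?_
    have hb : Bornology.IsBounded ((PiLp.continuousLinearEquiv 2 ℝ fun _ : Fin d => ℝ).symm ''
        Metric.closedBall 0 1) :=
      ((isCompact_closedBall (0 : Fin d → ℝ) 1).image (ContinuousLinearEquiv.continuous _)).isBounded
    refine hb.subset fun ξ hξ => ⟨WithLp.ofLp ξ, ?_, rfl⟩
    simpa using (hlt ξ hξ).le
  have key : ∃ r < 1, ∀ ξ ∈ T, ‖WithLp.ofLp ξ‖ ≤ r := by
    rcases T.eq_empty_or_nonempty with hT | hT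
    · exact ⟨0, one_pos, fun ξ hξ => by simp [hT] at hξ⟩
    · obtain ⟨ξ₀, h0, hmax⟩ := hcomp.exists_isMaxOn hT hcont.continuousOn
      exact ⟨_, hlt _ h0, fun ξ hξ => hmax hξ⟩
  obtain ⟨r, hr, hT⟩ := key
  refine ⟨min (1 - r) (1 / 2), lt_min (by linarith) (by norm_num), min_le_right _ _, h1, ?_⟩
  intro ξ hξ j
  have e1 := hT ξ (subset_tsupport _ hξ)
  have e2 := norm_le_pi_norm (WithLp.ofLp ξ) j
  rw [Real.norm_eq_abs] at e2
  linarith [min_le_left (1 - r) (1 / 2 : ℝ)]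

lemma latVec_apply (n : Zd d) (j : Fin d) : latVec d n j = n j := rfl

lemma latPt_apply (h : ℝ) (z : Zd d) (j : Fin d) : latPt d h z j = h * z j := rfl

lemma IsProfile.norm_eq_one {φ : 𝓢(Euc d, ℂ)} {δ : ℝ} (hφ : IsProfile φ δ) {ξ : Euc d}
    (hξ : ∀ j, |ξ j| < δ) : ‖𝓕 φ ξ‖ = 1 := by
  have h := hφ.tsum_eq ξ
  rw [tsum_eq_single 0] at h
  · have e0 : ξ + latVec d 0 = ξ := by ext j; simp [latVec_apply]
    rw [e0] at h
    exact (pow_eq_one_iff_of_nonneg (norm_nonneg _) two_ne_zero).mp h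
  · intro n hn
    by_contra hne
    have hne' : 𝓕 φ (ξ + latVec d n) ≠ 0 := fun h0 => hne (by rw [h0]; simp)
    obtain ⟨j, hj⟩ := Function.ne_iff.mp hn
    have h1 := hφ.le_of_ne_zero _ hne' j
    rw [PiLp.add_apply, latVec_apply] at h1
    have h2 : (1 : ℝ) ≤ |(n j : ℝ)| := by exact_mod_cast Int.one_le_abs hj
    have h3 := abs_sub_abs_le_abs_sub (n j : ℝ) (-ξ j)
    rw [abs_neg, sub_neg_eq_add, add_comm] at h3
    linarith [hξ j]

/-- The dilate `x ↦ φ (h⁻¹ x)`. -/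
def dilS {h : ℝ} (hh : 0 < h) (φ : 𝓢(Euc d, ℂ)) : 𝓢(Euc d, ℂ) :=
  SchwartzMap.compCLMOfContinuousLinearEquiv ℂ
    (ContinuousLinearEquiv.smulLeft (Units.mk0 h⁻¹ (inv_ne_zero hh.ne'))) φ

lemma dilS_apply {h : ℝ} (hh : 0 < h) (φ : 𝓢(Euc d, ℂ)) (x : Euc d) :
    dilS hh φ x = φ (h⁻¹ • x) := rfl

lemma fourier_dilS {h : ℝ} (hh : 0 < h) (φ : 𝓢(Euc d, ℂ)) (ξ : Euc d) :
    𝓕 (dilS hh φ) ξ = (h : ℂ) ^ d * 𝓕 φ (h • ξ) := by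
  rw [SchwartzMap.fourier_coe, SchwartzMap.fourier_coe, Real.fourier_eq, Real.fourier_eq]
  have := Measure.integral_comp_inv_smul (volume : Measure (Euc d))
    (fun y => Real.fourierChar (-inner ℝ y (h • ξ)) • φ y) h
  rw [finrank_euclideanSpace_fin, abs_of_pos (pow_pos hh d), Complex.real_smul,
    ofReal_pow] at this
  refine Eq.trans ?_ this
  refine integral_congr_ae (ae_of_all _ fun x => ?_)
  simp only [dilS_apply, real_inner_smul_left, real_inner_smul_right]
  rw [mul_inv_cancel_left₀ hh.ne']

/-- The rescaled translate `φ_{h,z}` as a Schwartz function. -/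
def waveS {h : ℝ} (hh : 0 < h) (φ : 𝓢(Euc d, ℂ)) (z : Zd d) : 𝓢(Euc d, ℂ) :=
  transS (-latPt d h z) (dilS hh φ)

lemma waveS_apply {h : ℝ} (hh : 0 < h) (φ : 𝓢(Euc d, ℂ)) (z : Zd d) (x : Euc d) :
    waveS hh φ z x = φ (h⁻¹ • (x - latPt d h z)) := by
  rw [waveS, transS_apply, dilS_apply, sub_eq_add_neg]

lemma fourier_waveS {h : ℝ} (hh : 0 < h) (φ : 𝓢(Euc d, ℂ)) (z : Zd d) (ξ : Euc d) :
    𝓕 (waveS hh φ z) ξ = (h : ℂ) ^ d * (conj (expChar z (h • ξ).ofLp) * 𝓕 φ (h • ξ)) := by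
  rw [waveS, fourier_transS, fourier_dilS]
  have : Complex.exp (2 * π * (inner ℝ (-latPt d h z) ξ : ℝ) * I) = conj (expChar z (h • ξ).ofLp) := by
    rw [expChar, ← Complex.exp_conj]
    congr 1
    simp only [map_mul, map_sum, conj_I, conj_ofReal, map_ofNat, map_intCast]
    rw [inner_neg_left, PiLp.inner_apply]
    simp only [latPt_apply, PiLp.smul_apply, smul_eq_mul]
    have e : (∑ i : Fin d, inner ℝ (h * (z i : ℝ)) (ξ i) : ℝ) = ∑ j, (z j : ℝ) * (h * ξ j) :=
      Finset.sum_congr rfl fun j _ => by simp; ring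
    rw [e]
    push_cast
    ring
  rw [this]
  ring

lemma expChar_mul_conj (m n : Zd d) (x : Fin d → ℝ) :
    expChar m x * conj (expChar n x) = expChar (m - n) x := by
  rw [expChar, expChar, expChar, ← Complex.exp_conj, ← Complex.exp_add]
  congr 1
  simp only [map_mul, map_sum, conj_I, conj_ofReal, map_ofNat, map_intCast, Pi.sub_apply,
    Int.cast_sub, sub_mul, Finset.sum_sub_distrib]
  ring

lemma inner_waveS {φ : 𝓢(Euc d, ℂ)} {δ : ℝ} (hφ : IsProfile φ δ) {h : ℝ} (hh : 0 < h)
    (z z' : Zd d) : (inner ℂ ((waveS hh φ z).toLp 2 volume) ((waveS hh φ z').toLp 2 volume) : ℂ)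
      = if z = z' then (h : ℂ) ^ d else 0 := by
  classical
  have hh' : (h : ℂ) ≠ 0 := by exact_mod_cast hh.ne'
  rw [inner_toLp_fourier]
  set F : Euc d → ℂ := fun η => expChar (z - z') η.ofLp * ((‖𝓕 φ η‖ ^ 2 : ℝ) : ℂ) with hF
  have e1 : ∀ ξ, conj (𝓕 (waveS hh φ z) ξ) * 𝓕 (waveS hh φ z') ξ
      = (h : ℂ) ^ d * (h : ℂ) ^ d * F (h • ξ) := by
    intro ξ
    rw [fourier_waveS, fourier_waveS, hF]
    simp only
    rw [← expChar_mul_conj]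
    push_cast
    rw [← Complex.conj_mul']
    simp only [map_mul, map_pow, conj_ofReal, conj_conj]
    ring
  simp_rw [e1]
  rw [integral_const_mul, Measure.integral_comp_smul, finrank_euclideanSpace_fin,
    abs_of_pos (inv_pos.mpr (pow_pos hh d)), Complex.real_smul]
  have hIntg : Integrable (fun η : Euc d => ‖𝓕 φ η‖ ^ 2) := by
    refine (integrable_conj_mul (𝓕 φ) (𝓕 φ)).norm.congr (ae_of_all _ fun η => ?_)
    simp [sq]
  have hmp := PiLp.volume_preserving_toLp (Fin d)
  have e2 : ∫ η, F η = if z = z' then 1 else 0 := by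
    rw [← hmp.integral_comp (MeasurableEquiv.toLp 2 (Fin d → ℝ)).measurableEmbedding]
    have := integral_expChar_mul_of_tsum (G := fun x : Fin d → ℝ => ‖𝓕 φ (WithLp.toLp 2 x)‖ ^ 2)
      (hmp.integrable_comp_of_integrable hIntg) (fun x => by positivity)
      (fun x => by
        rw [← hφ.tsum_eq (WithLp.toLp 2 x)]
        rfl) (z - z')
    simpa only [sub_eq_zero] using! this
  rw [e2]
  split_ifs
  · push_cast; field_simp
  · simp

end

section

open scoped SchwartzMap

variable {d : ℕ}

lemma latMeas_singleton_ne_top (h : ℝ) (z : Zd d) : latMeas d h {z} ≠ ∞ := by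
  simp [latMeas]

/-- The indicator of `{z}` in `ℓ²(hℤ^d)`. -/
def latDelta (h : ℝ) (z : Zd d) : l2h d h :=
  indicatorConstLp 2 (measurableSet_singleton z) (latMeas_singleton_ne_top h z) 1

lemma inner_latDelta {h : ℝ} (hh : 0 < h) (z : Zd d) (v : l2h d h) :
    (inner ℂ (latDelta h z) v : ℂ) = (h : ℂ) ^ d * (v : Zd d → ℂ) z := by
  have h0 : 0 ≤ h ^ d := pow_nonneg hh.le d
  rw [latDelta, L2.inner_indicatorConstLp_one (𝕜 := ℂ), integral_singleton, Measure.real]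
  simp [latMeas, h0]

lemma coeFn_latDelta {h : ℝ} (hh : 0 < h) (z z' : Zd d) [Decidable (z' = z)] :
    (latDelta h z : Zd d → ℂ) z' = if z' = z then 1 else 0 := by
  have := (ae_latMeas_iff hh).mp (indicatorConstLp_coeFn (p := 2)
    (hs := measurableSet_singleton z) (hμs := latMeas_singleton_ne_top h z) (c := (1 : ℂ))) z'
  rw [latDelta, this, Set.indicator_apply]
  simp

lemma l2h_ext_inner {h : ℝ} (hh : 0 < h) {v w : l2h d h}
    (H : ∀ z, (inner ℂ (latDelta h z) v : ℂ) = inner ℂ (latDelta h z) w) : v = w := by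
  refine l2h_ext hh fun z => ?_
  have := H z
  rw [inner_latDelta hh, inner_latDelta hh] at this
  exact mul_left_cancel₀ (pow_ne_zero d (by exact_mod_cast hh.ne')) this

lemma norm_sq_l2h {h : ℝ} (hh : 0 < h) (v : l2h d h) :
    ‖v‖ ^ 2 = h ^ d * ∑' z, ‖(v : Zd d → ℂ) z‖ ^ 2 := by
  have hi : Integrable (fun z => ‖(v : Zd d → ℂ) z‖ ^ 2) (latMeas d h) :=
    (memLp_two_iff_integrable_sq_norm (Lp.memLp v).1).mp (Lp.memLp v)
  have h1 : ‖v‖ ^ 2 = ∫ z, ‖(v : Zd d → ℂ) z‖ ^ 2 ∂latMeas d h := by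
    rw [@norm_sq_eq_re_inner ℂ, L2.inner_def, ← integral_re (L2.integrable_inner v v)]
    refine integral_congr_ae (ae_of_all _ fun z => ?_)
    simp [← ofReal_pow]
  have h2 : ∀ z : Zd d, (latMeas d h).real {z} = h ^ d := fun z => by
    simp [latMeas, Measure.real, pow_nonneg hh.le d]
  rw [h1, integral_countable hi, ← tsum_mul_left]
  simp only [h2, smul_eq_mul]

section
variable {φ : 𝓢(Euc d, ℂ)} {δ h : ℝ} {P : L2 d →L[ℂ] l2h d h}

lemma IsProjOp.inner_latDelta_apply (hh : 0 < h) (hP : IsProjOp d h φ P) (z : Zd d) (u : L2 d) :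
    (inner ℂ (latDelta h z) (P u) : ℂ) = inner ℂ ((waveS hh φ z).toLp 2 volume) u := by
  have hh' : (h : ℂ) ^ d ≠ 0 := pow_ne_zero d (by exact_mod_cast hh.ne')
  rw [inner_latDelta hh, hP u z, mul_inv_cancel_left₀ hh', L2.inner_def]
  refine integral_congr_ae ?_
  filter_upwards [(waveS hh φ z).coeFn_toLp 2 volume] with x hx
  rw [hx, waveS_apply, RCLike.inner_apply, mul_comm]

lemma IsProjOp.adjoint_latDelta (hh : 0 < h) (hP : IsProjOp d h φ P) (z : Zd d) :
    ContinuousLinearMap.adjoint P (latDelta h z) = (waveS hh φ z).toLp 2 volume :=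
  ext_inner_right ℂ fun u => by
    rw [ContinuousLinearMap.adjoint_inner_left, hP.inner_latDelta_apply hh]

lemma IsProjOp.apply_waveS (hφ : IsProfile φ δ) (hh : 0 < h) (hP : IsProjOp d h φ P) (z : Zd d) :
    P ((waveS hh φ z).toLp 2 volume) = latDelta h z := by
  classical
  refine l2h_ext_inner hh fun z' => ?_
  rw [hP.inner_latDelta_apply hh, inner_waveS hφ hh, inner_latDelta hh, coeFn_latDelta hh]
  simp

lemma IsProjOp.apply_adjoint (hφ : IsProfile φ δ) (hh : 0 < h) (hP : IsProjOp d h φ P)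
    (w : l2h d h) : P (ContinuousLinearMap.adjoint P w) = w := by
  refine l2h_ext_inner hh fun z => ?_
  rw [hP.inner_latDelta_apply hh, ContinuousLinearMap.adjoint_inner_right, hP.apply_waveS hφ hh]

end

end

section

open scoped SchwartzMap

variable {d : ℕ}

/-- Low-frequency truncation of a Schwartz function. -/
lemma exists_low_frequency_part {δ h : ℝ} (hδ : 0 < δ) (hh : 0 < h) (u : 𝓢(Euc d, ℂ)) :
    ∃ g : 𝓢(Euc d, ℂ), (∀ ξ, δ / 2 ≤ ‖h • ξ‖ → 𝓕 g ξ = 0) ∧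
      ∀ ξ, ‖𝓕 (u - g) ξ‖ ≤ 16 / δ ^ 2 * h ^ 2 * ‖𝓕 (negLapS u) ξ‖ := by
  let κ : ContDiffBump (0 : Euc d) := ⟨δ / 4, δ / 2, by positivity, by linarith⟩
  have hκs : HasCompactSupport fun x : Euc d => ((κ x : ℝ) : ℂ) :=
    κ.hasCompactSupport.comp_left (g := fun t : ℝ => (t : ℂ)) ofReal_zero
  have hκd : ContDiff ℝ (⊤ : ℕ∞) fun x : Euc d => ((κ x : ℝ) : ℂ) :=
    ofRealCLM.contDiff.comp κ.contDiff
  set k : 𝓢(Euc d, ℂ) := dilS (inv_pos.mpr hh) (hκs.toSchwartzMap hκd)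
  have hk : ∀ ξ, k ξ = ((κ (h • ξ) : ℝ) : ℂ) := fun ξ => by
    simp only [k, dilS_apply, inv_inv]
    rfl
  have htg : Function.HasTemperateGrowth k := k.hasTemperateGrowth
  set g : 𝓢(Euc d, ℂ) := 𝓕⁻ (SchwartzMap.smulLeftCLM ℂ k (𝓕 u))
  have hg : ∀ ξ, 𝓕 g ξ = ((κ (h • ξ) : ℝ) : ℂ) * 𝓕 u ξ := fun ξ => by
    simp only [g, FourierTransform.fourier_fourierInv_eq]
    rw [SchwartzMap.smulLeftCLM_apply_apply htg, hk, smul_eq_mul]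
  refine ⟨g, fun ξ hξ => ?_, fun ξ => ?_⟩
  · rw [hg, κ.zero_of_le_dist (by rwa [dist_zero_right]), ofReal_zero, zero_mul]
  · have e1 : 𝓕 (u - g) ξ = ((1 - κ (h • ξ) : ℝ) : ℂ) * 𝓕 u ξ := by
      have : 𝓕 (u - g) = 𝓕 u - 𝓕 g := by
        simp only [← FourierTransform.fourierCLM_apply (R := ℂ), map_sub]
      rw [this, sub_apply, hg]
      push_cast; ring
    rw [e1, fourier_negLapS, norm_mul, norm_mul, norm_real, norm_real, ← mul_assoc]
    refine mul_le_mul_of_nonneg_right ?_ (norm_nonneg _)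
    rw [Real.norm_of_nonneg (sub_nonneg.mpr κ.le_one),
      Real.norm_of_nonneg (by positivity : (0 : ℝ) ≤ (2 * π * ‖ξ‖) ^ 2)]
    rcases le_or_gt ‖h • ξ‖ (δ / 4) with hle | hlt
    · rw [κ.one_of_mem_closedBall (by rwa [mem_closedBall_zero_iff]), sub_self]
      positivity
    · rw [norm_smul, Real.norm_of_nonneg hh.le] at hlt
      have h1 : (δ / 4) ^ 2 ≤ (h * ‖ξ‖) ^ 2 := pow_le_pow_left₀ (by positivity) hlt.le 2
      have h2 : 1 ≤ 16 / δ ^ 2 * (h * ‖ξ‖) ^ 2 := by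
        rw [div_mul_eq_mul_div, le_div_iff₀ (by positivity)]
        nlinarith
      have h3 : (1 : ℝ) ≤ (2 * π) ^ 2 := one_le_pow₀ (by linarith [Real.pi_gt_three])
      calc 1 - κ (h • ξ) ≤ 1 := by linarith [κ.nonneg (x := h • ξ)]
        _ ≤ (16 / δ ^ 2 * (h * ‖ξ‖) ^ 2) * (2 * π) ^ 2 := by nlinarith
        _ = _ := by ring

section
variable {φ : 𝓢(Euc d, ℂ)} {δ h : ℝ} {P : L2 d →L[ℂ] l2h d h}

lemma norm_sq_toLp (g : 𝓢(Euc d, ℂ)) : ‖g.toLp 2 volume‖ ^ 2 = ∫ ξ, ‖𝓕 g ξ‖ ^ 2 := by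
  rw [@norm_sq_eq_re_inner ℂ, inner_toLp_fourier]
  have : ∀ ξ, conj (𝓕 g ξ) * 𝓕 g ξ = ((‖𝓕 g ξ‖ ^ 2 : ℝ) : ℂ) := fun ξ => by
    rw [Complex.conj_mul']; push_cast; rfl
  simp_rw [this]
  rw [integral_complex_ofReal]
  exact ofReal_re _

lemma IsProjOp.norm_apply_of_low_frequency (hφ : IsProfile φ δ) (hh : 0 < h)
    (hP : IsProjOp d h φ P) {g : 𝓢(Euc d, ℂ)} (hg : ∀ ξ, δ / 2 ≤ ‖h • ξ‖ → 𝓕 g ξ = 0) :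
    ‖P (g.toLp 2 volume)‖ = ‖g.toLp 2 volume‖ := by
  have hh' : (h : ℂ) ≠ 0 := by exact_mod_cast hh.ne'
  have hd : 0 < h ^ d := pow_pos hh d
  set ψ : Euc d → ℂ := fun η => conj (𝓕 φ η) * 𝓕 g (h⁻¹ • η) with hψ
  have hψ0 : ∀ η, δ / 2 ≤ ‖η‖ → ψ η = 0 := fun η hη => by
    rw [hψ]; simp only
    rw [hg, mul_zero]
    rwa [smul_inv_smul₀ hh.ne']
  have hcoord : ∀ (η : Euc d), ‖η‖ < δ / 2 → ∀ j, |η j| < δ / 2 := fun η hη j =>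
    lt_of_le_of_lt (by rw [← Real.norm_eq_abs]; exact PiLp.norm_apply_le η j) hη
  have hψn : ∀ η, ‖ψ η‖ = ‖𝓕 g (h⁻¹ • η)‖ := fun η => by
    rcases le_or_gt (δ / 2) ‖η‖ with hle | hlt
    · rw [hψ0 η hle, hg, norm_zero]
      rwa [smul_inv_smul₀ hh.ne']
    · rw [hψ]; simp only
      rw [norm_mul, RCLike.norm_conj, hφ.norm_eq_one fun j =>
        (hcoord η hlt j).trans (by linarith [hφ.pos]), one_mul]
  have hψc : Continuous ψ :=
    (continuous_conj.comp (𝓕 φ).continuous).mul ((𝓕 g).continuous.comp (continuous_const_smul h⁻¹))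
  obtain ⟨C, hC⟩ : ∃ C, ∀ ξ, ‖𝓕 g ξ‖ ≤ C :=
    ⟨_, fun ξ => (SchwartzMap.toBoundedContinuousFunction (𝓕 g)).norm_coe_le_norm ξ⟩
  have hmp := PiLp.volume_preserving_toLp (Fin d)
  have hemb := (MeasurableEquiv.toLp 2 (Fin d → ℝ)).measurableEmbedding
  have hpar := hasSum_sq_integral_expChar (ψ := fun x : Fin d → ℝ => ψ (WithLp.toLp 2 x))
    (hψc.comp (PiLp.continuous_toLp 2 _)) (C := C) (fun x => by rw [hψn]; exact hC _)
    (a := fun _ => -1 / 2) (fun x hx => by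
      by_contra hne
      refine hx fun j => ?_
      have h1 := hcoord (WithLp.toLp 2 x) (not_le.mp fun hle => hne (hψ0 _ hle)) j
      rw [abs_lt] at h1
      have := hφ.le_half
      constructor <;> [linarith [h1.1]; linarith [h1.2]])
  have hcoef : ∀ z, (P (g.toLp 2 volume) : Zd d → ℂ) z
      = (h ^ d : ℂ)⁻¹ * ∫ x : Fin d → ℝ, expChar z x * ψ (WithLp.toLp 2 x) := by
    intro z
    have e0 := inner_latDelta hh z (P (g.toLp 2 volume))
    rw [hP.inner_latDelta_apply hh, inner_toLp_fourier] at e0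
    set F : Euc d → ℂ := fun η => expChar z η.ofLp * ψ η with hF
    have e1 : ∀ ξ, conj (𝓕 (waveS hh φ z) ξ) * 𝓕 g ξ = (h : ℂ) ^ d * F (h • ξ) := by
      intro ξ
      rw [fourier_waveS, hF]
      simp only [hψ, map_mul, map_pow, conj_ofReal, conj_conj, inv_smul_smul₀ hh.ne']
      ring
    simp_rw [e1] at e0
    rw [integral_const_mul, Measure.integral_comp_smul, finrank_euclideanSpace_fin,
      abs_of_pos (inv_pos.mpr hd), Complex.real_smul, ← hmp.integral_comp hemb] at e0
    have e2 := mul_left_cancel₀ (pow_ne_zero d hh') e0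
    rw [← e2]
    push_cast
    rfl
  have hn : ‖P (g.toLp 2 volume)‖ ^ 2 = ‖g.toLp 2 volume‖ ^ 2 := by
    rw [norm_sq_l2h hh]
    simp_rw [hcoef, norm_mul, mul_pow]
    rw [tsum_mul_left, hpar.tsum_eq, hmp.integral_comp hemb (fun η => ‖ψ η‖ ^ 2)]
    simp_rw [hψn]
    rw [Measure.integral_comp_inv_smul volume (fun ξ => ‖𝓕 g ξ‖ ^ 2), finrank_euclideanSpace_fin,
      abs_of_pos hd, ← norm_sq_toLp, smul_eq_mul, norm_inv, norm_pow, norm_real,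
      Real.norm_of_nonneg hh.le]
    field_simp
  exact (pow_left_inj₀ (norm_nonneg _) (norm_nonneg _) two_ne_zero).mp hn

lemma IsProjOp.adjoint_apply_of_low_frequency (hφ : IsProfile φ δ) (hh : 0 < h)
    (hP : IsProjOp d h φ P) {g : 𝓢(Euc d, ℂ)} (hg : ∀ ξ, δ / 2 ≤ ‖h • ξ‖ → 𝓕 g ξ = 0) :
    ContinuousLinearMap.adjoint P (P (g.toLp 2 volume)) = g.toLp 2 volume := by
  set u := g.toLp 2 volume
  set w := ContinuousLinearMap.adjoint P (P u)
  have h1 : (inner ℂ w u : ℂ) = ((‖P u‖ ^ 2 : ℝ) : ℂ) := by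
    rw [ContinuousLinearMap.adjoint_inner_left, inner_self_eq_norm_sq_to_K]
    push_cast; rfl
  have h2 : (inner ℂ w w : ℂ) = ((‖P u‖ ^ 2 : ℝ) : ℂ) := by
    rw [ContinuousLinearMap.adjoint_inner_left, hP.apply_adjoint hφ hh, inner_self_eq_norm_sq_to_K]
    push_cast; rfl
  have h3 : ‖w - u‖ ^ 2 = 0 := by
    rw [@norm_sub_sq ℂ, h1, @norm_sq_eq_re_inner ℂ _ _ _ _ w, h2,
      hP.norm_apply_of_low_frequency hφ hh hg]
    simp only [RCLike.re_to_complex, ofReal_re]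
    ring
  exact sub_eq_zero.mp (norm_eq_zero.mp (pow_eq_zero_iff two_ne_zero |>.mp h3))

lemma norm_sub_adjoint_apply_le {E F : Type*} [NormedAddCommGroup E] [InnerProductSpace ℂ E]
    [CompleteSpace E] [NormedAddCommGroup F] [InnerProductSpace ℂ F] [CompleteSpace F]
    {P : E →L[ℂ] F} (hP : ∀ w, P (ContinuousLinearMap.adjoint P w) = w) {u g : E}
    (hg : ContinuousLinearMap.adjoint P (P g) = g) :
    ‖u - ContinuousLinearMap.adjoint P (P u)‖ ≤ 2 * ‖u - g‖ := by
  have e : u - ContinuousLinearMap.adjoint P (P u)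
      = (u - g) - ContinuousLinearMap.adjoint P (P (u - g)) := by
    rw [map_sub, map_sub, hg]
    abel
  have h1 := ContinuousLinearMap.le_of_opNorm_le _ (norm_adjoint_le_one_of_comp_eq hP) (P (u - g))
  have h2 := ContinuousLinearMap.le_of_opNorm_le _ (norm_le_one_of_comp_adjoint_eq hP) (u - g)
  rw [one_mul] at h1 h2
  rw [e]
  linarith [norm_sub_le (u - g) (ContinuousLinearMap.adjoint P (P (u - g)))]

/-- `P_h* P_h` approximates the identity on `H²`. -/
lemma IsProjOp.norm_sub_adjoint_apply_le (hφ : IsProfile φ δ) (hh : 0 < h)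
    (hP : IsProjOp d h φ P) (u : 𝓢(Euc d, ℂ)) :
    ‖u.toLp 2 volume - ContinuousLinearMap.adjoint P (P (u.toLp 2 volume))‖
      ≤ 32 / δ ^ 2 * h ^ 2 * ‖(negLapS u).toLp 2 volume‖ := by
  obtain ⟨g, hg, hug⟩ := exists_low_frequency_part hφ.pos hh u
  have h1 := norm_toLp_le_of_fourier_le hug
  have h2 : (u - g).toLp 2 volume = u.toLp 2 volume - g.toLp 2 volume := by
    simp only [← SchwartzMap.toLpCLM_apply (𝕜 := ℂ), map_sub]
  rw [h2] at h1
  refine (_root_.norm_sub_adjoint_apply_le (hP.apply_adjoint hφ hh)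
    (hP.adjoint_apply_of_low_frequency hφ hh hg)).trans ?_
  calc _ ≤ 2 * (16 / δ ^ 2 * h ^ 2 * ‖(negLapS u).toLp 2 volume‖) := by gcongr
    _ = _ := by ring

end

end

section

open scoped SchwartzMap

variable {d : ℕ}

lemma latPt_add (h : ℝ) (z n : Zd d) : latPt d h (z + n) = latPt d h z + latPt d h n := by
  ext j
  simp [latPt_apply, mul_add]

lemma latPt_neg (h : ℝ) (n : Zd d) : latPt d h (-n) = -latPt d h n := by
  ext j
  simp [latPt_apply]

lemma latPt_single (h : ℝ) (j : Fin d) :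
    latPt d h (Pi.single j 1) = h • basisVec j := by
  ext i
  rcases eq_or_ne i j with rfl | hij
  · simp [latPt_apply]
  · simp [latPt_apply, hij]

lemma dense_span_latDelta {h : ℝ} (hh : 0 < h) :
    Dense (Submodule.span ℂ (Set.range (latDelta (d := d) h)) : Set (l2h d h)) := by
  rw [Submodule.dense_iff_topologicalClosure_eq_top, Submodule.topologicalClosure_eq_top_iff,
    Submodule.eq_bot_iff]
  intro v hv
  refine l2h_ext_inner hh fun z => ?_
  rw [inner_zero_right]
  exact (Submodule.mem_orthogonal _ _).mp hv _ (Submodule.subset_span ⟨z, rfl⟩)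

section
variable {φ : 𝓢(Euc d, ℂ)} {δ h : ℝ} {P : L2 d →L[ℂ] l2h d h}

lemma transS_waveS (hh : 0 < h) (z n : Zd d) :
    transS (-latPt d h n) (waveS hh φ z) = waveS hh φ (z + n) := by
  ext x
  rw [transS_apply, waveS_apply, waveS_apply, latPt_add]
  congr 2
  abel

lemma IsProjOp.apply_trOp (hh : 0 < h) (hP : IsProjOp d h φ P) (n : Zd d) (u : L2 d) :
    P (trOp volume (latPt d h n) u) = trOp (latMeas d h) n (P u) := by
  refine l2h_ext_inner hh fun z => ?_
  have e := (ae_latMeas_iff hh).mp (coeFn_trOp (μ := latMeas d h) n (P u)) z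
  rw [hP.inner_latDelta_apply hh, inner_latDelta hh, e, ← inner_latDelta hh,
    hP.inner_latDelta_apply hh, ← transS_waveS, toLp_transS, inner_trOp_left, neg_neg]

lemma IsProjOp.adjoint_trOp (hh : 0 < h) (hP : IsProjOp d h φ P) (n : Zd d) (v : l2h d h) :
    ContinuousLinearMap.adjoint P (trOp (latMeas d h) n v)
      = trOp volume (latPt d h n) (ContinuousLinearMap.adjoint P v) := by
  refine ext_inner_right ℂ fun u => ?_
  rw [ContinuousLinearMap.adjoint_inner_left, inner_trOp_left, inner_trOp_left,
    ContinuousLinearMap.adjoint_inner_left, ← latPt_neg, hP.apply_trOp hh]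

lemma IsProjOp.adjoint_latLap (hh : 0 < h) (hP : IsProjOp d h φ P) (v : l2h d h) :
    ContinuousLinearMap.adjoint P (latLap d h v)
      = contLap d h (ContinuousLinearMap.adjoint P v) := by
  have hA := hP.adjoint_trOp hh
  generalize ContinuousLinearMap.adjoint P = A at hA ⊢
  have hdiff : ∀ j, A (diffOp (latMeas d h) (Pi.single j 1) v)
      = diffOp volume (h • basisVec j) (A v) := fun j => by
    rw [diffOp_apply, diffOp_apply, A.map_sub, A.map_sub, A.map_smul, hA, hA, latPt_neg,
      latPt_single]
  rw [latLap_apply, contLap_apply, A.map_smul, map_sum]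
  simp only [hdiff]

/-- Every `v` in the span of the point masses has `P_h* v` Schwartz and band-limited. -/
lemma IsProjOp.exists_schwartz_of_mem_span (hφ : IsProfile φ δ) (hh : 0 < h)
    (hP : IsProjOp d h φ P) {v : l2h d h}
    (hv : v ∈ Submodule.span ℂ (Set.range (latDelta (d := d) h))) :
    ∃ G : 𝓢(Euc d, ℂ), G.toLp 2 volume = ContinuousLinearMap.adjoint P v ∧
      ∀ ξ, 𝓕 G ξ ≠ 0 → ∀ j, |h * ξ j| ≤ 1 - δ := by
  induction hv using Submodule.span_induction with
  | mem x hx =>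
    obtain ⟨z, rfl⟩ := hx
    refine ⟨waveS hh φ z, (hP.adjoint_latDelta hh z).symm, fun ξ hξ j => ?_⟩
    rw [fourier_waveS] at hξ
    exact hφ.le_of_ne_zero (h • ξ) (right_ne_zero_of_mul (right_ne_zero_of_mul hξ)) j
  | zero =>
    refine ⟨0, ?_, fun ξ hξ => absurd ?_ hξ⟩
    · rw [map_zero, ← SchwartzMap.toLpCLM_apply (𝕜 := ℂ), map_zero]
    · rw [← FourierTransform.fourierCLM_apply (R := ℂ), map_zero, zero_apply]
  | add x y _ _ hx hy =>
    obtain ⟨G, hG, hGs⟩ := hx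
    obtain ⟨G', hG', hGs'⟩ := hy
    refine ⟨G + G', ?_, fun ξ hξ => ?_⟩
    · rw [map_add, ← hG, ← hG']
      simp only [← SchwartzMap.toLpCLM_apply (𝕜 := ℂ), map_add]
    · have e : 𝓕 (G + G') ξ = 𝓕 G ξ + 𝓕 G' ξ := by
        simp only [← FourierTransform.fourierCLM_apply (R := ℂ), map_add, add_apply]
      by_cases h0 : 𝓕 G ξ = 0
      · rw [e, h0, zero_add] at hξ
        exact hGs' ξ hξ
      · exact hGs ξ h0
  | smul c x _ hx =>
    obtain ⟨G, hG, hGs⟩ := hx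
    refine ⟨c • G, ?_, fun ξ hξ => hGs ξ ?_⟩
    · rw [map_smul, ← hG]
      simp only [← SchwartzMap.toLpCLM_apply (𝕜 := ℂ), map_smul]
    · have e : 𝓕 (c • G) ξ = c * 𝓕 G ξ := by
        simp only [← FourierTransform.fourierCLM_apply (R := ℂ), map_smul, smul_apply, smul_eq_mul]
      rw [e] at hξ
      exact right_ne_zero_of_mul hξ

/-- The difference Laplacian is consistent with `-Δ`, tested against band-limited functions. -/
lemma norm_inner_diffLapS_sub_le (hδ : 0 < δ) (hδ1 : δ ≤ 1) (hh : 0 < h) {G : 𝓢(Euc d, ℂ)}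
    (hG : ∀ ξ, 𝓕 G ξ ≠ 0 → ∀ j, |h * ξ j| ≤ 1 - δ) (g : 𝓢(Euc d, ℂ)) :
    ‖(inner ℂ ((diffLapS h G).toLp 2 volume) (g.toLp 2 volume) : ℂ)
        - inner ℂ (G.toLp 2 volume) ((negLapS g).toLp 2 volume)‖
      ≤ h ^ 2 / (4 * (2 * δ / π) ^ 2) *
        (‖(diffLapS h G).toLp 2 volume‖ * ‖(negLapS g).toLp 2 volume‖) := by
  have hπ := Real.pi_pos
  have hc : 0 < (2 * δ / π) ^ 2 := by positivity
  refine norm_inner_sub_inner_le (fun ξ => ?_) (by positivity)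
  set t := (2 * π * ‖ξ‖) ^ 2
  have ht : 0 ≤ t := by positivity
  rw [fourier_diffLapS, fourier_negLapS]
  by_cases h0 : 𝓕 G ξ = 0
  · simp [h0]
  have e : conj ((diffSymbol h ξ : ℂ) * 𝓕 G ξ) * 𝓕 g ξ - conj (𝓕 G ξ) * ((t : ℂ) * 𝓕 g ξ)
      = ((diffSymbol h ξ - t : ℝ) : ℂ) * (conj (𝓕 G ξ) * 𝓕 g ξ) := by
    push_cast
    rw [map_mul, conj_ofReal]
    ring
  rw [e]
  have h1 := le_diffSymbol hh hδ.le hδ1 (hG ξ h0)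
  have h2 := abs_diffSymbol_sub_le hh ξ
  have h3 : (2 * π * ‖ξ‖) ^ 4 = t ^ 2 := by ring
  have hs : 0 ≤ diffSymbol h ξ := le_trans (by positivity) h1
  simp only [norm_mul, norm_real, Real.norm_eq_abs, RCLike.norm_conj]
  rw [abs_of_nonneg hs, abs_of_nonneg ht]
  have h4 : h ^ 2 / 4 * t ^ 2 ≤ h ^ 2 / (4 * (2 * δ / π) ^ 2) * (diffSymbol h ξ * t) := by
    rw [← div_div, div_mul_eq_mul_div _ ((2 * δ / π) ^ 2), le_div_iff₀ hc]
    calc h ^ 2 / 4 * t ^ 2 * (2 * δ / π) ^ 2 = h ^ 2 / 4 * (((2 * δ / π) ^ 2 * t) * t) := by ring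
      _ ≤ h ^ 2 / 4 * (diffSymbol h ξ * t) := by gcongr
  calc |diffSymbol h ξ - t| * (‖𝓕 G ξ‖ * ‖𝓕 g ξ‖)
      ≤ (h ^ 2 / (4 * (2 * δ / π) ^ 2) * (diffSymbol h ξ * t)) * (‖𝓕 G ξ‖ * ‖𝓕 g ξ‖) := by
        gcongr
        exact (h2.trans_eq (by rw [h3])).trans h4
    _ = _ := by ring

/-- Consistency of the lattice Laplacian with `-Δ`. -/
lemma IsProjOp.norm_inner_latLap_sub_le (hφ : IsProfile φ δ) (hh : 0 < h)
    (hP : IsProjOp d h φ P) (v : l2h d h) (g : 𝓢(Euc d, ℂ)) :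
    ‖(inner ℂ (latLap d h v) (P (g.toLp 2 volume)) : ℂ)
        - inner ℂ v (P ((negLapS g).toLp 2 volume))‖
      ≤ h ^ 2 / (4 * (2 * δ / π) ^ 2) * (‖latLap d h v‖ * ‖(negLapS g).toLp 2 volume‖) := by
  have hcl : IsClosed {v : l2h d h | ‖(inner ℂ (latLap d h v) (P (g.toLp 2 volume)) : ℂ)
        - inner ℂ v (P ((negLapS g).toLp 2 volume))‖
      ≤ h ^ 2 / (4 * (2 * δ / π) ^ 2) * (‖latLap d h v‖ * ‖(negLapS g).toLp 2 volume‖)} :=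
    isClosed_le (by fun_prop) (by fun_prop)
  refine closure_minimal (s := (Submodule.span ℂ (Set.range (latDelta (d := d) h)) : Set _))
    (fun v hv => ?_) hcl (dense_span_latDelta hh v)
  obtain ⟨G, hG, hGs⟩ := hP.exists_schwartz_of_mem_span hφ hh hv
  have h1 := norm_inner_diffLapS_sub_le hφ.pos (hφ.le_half.trans (by norm_num)) hh hGs g
  rw [toLp_diffLapS, hG, ← hP.adjoint_latLap hh, ContinuousLinearMap.adjoint_inner_left,
    ContinuousLinearMap.adjoint_inner_left] at h1
  refine h1.trans ?_
  have h2 := ContinuousLinearMap.le_of_opNorm_le _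
    (norm_adjoint_le_one_of_comp_eq (hP.apply_adjoint hφ hh)) (latLap d h v)
  rw [one_mul] at h2
  gcongr

end

end

section

open scoped SchwartzMap

variable {d : ℕ}

lemma latPt_eq_smul (h : ℝ) (z : Zd d) : latPt d h z = h • latVec d z := by
  ext j
  simp [latPt_apply, latVec_apply]

lemma latVec_add (m n : Zd d) : latVec d (m + n) = latVec d m + latVec d n := by
  ext j
  simp [latVec_apply]

lemma latVec_injective : Function.Injective (latVec d) := fun m n hmn => by
  ext j
  have := congrArg (fun v : Euc d => v j) hmn
  simpa [latVec_apply] using this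

lemma exists_summable_one_add_norm_latVec (d : ℕ) :
    ∃ k : ℕ, Summable fun n : Zd d => ((1 + ‖latVec d n‖) ^ k)⁻¹ := by
  let b := (EuclideanSpace.basisFun (Fin d) ℝ).toBasis
  let L : Submodule ℤ (Euc d) := Submodule.span ℤ (Set.range b)
  have hmem : ∀ n : Zd d, latVec d n ∈ L := fun n => by
    have : latVec d n = ∑ j, n j • b j := by
      ext i
      simp [latVec_apply, b, Finset.sum_apply, Pi.single_apply]
    rw [this]
    exact Submodule.sum_mem _ fun j _ =>
      Submodule.smul_mem _ _ (Submodule.subset_span ⟨j, rfl⟩)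
  have hinj : Function.Injective fun n : Zd d => (⟨latVec d n, hmem n⟩ : L) :=
    fun m n hmn => latVec_injective (congrArg Subtype.val hmn)
  refine ⟨Module.finrank ℤ L + 1, ?_⟩
  have h1 := (ZLattice.summable_norm_pow_inv L (Module.finrank ℤ L + 1)
    (Nat.lt_succ_self _)).comp_injective hinj
  refine Summable.of_norm_bounded_eventually h1 ?_
  refine (Set.finite_singleton (0 : Zd d)).subset fun n hn => ?_
  by_contra h0
  refine hn ?_
  have hpos : 0 < ‖latVec d n‖ := norm_pos_iff.mpr fun h => h0 <|
    latVec_injective (by rw [h]; ext j; simp [latVec_apply])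
  rw [Set.mem_ofPred_eq, Real.norm_of_nonneg (by positivity)]
  simp only [Function.comp_apply, Submodule.coe_norm, inv_pow]
  gcongr
  linarith

lemma exists_norm_sub_latVec_floor_le (d : ℕ) :
    ∃ R : ℝ, 0 ≤ R ∧ ∀ x : Euc d, ∃ n : Zd d, ‖x - latVec d n‖ ≤ R := by
  refine ⟨√d, Real.sqrt_nonneg _, fun x => ⟨fun j => ⌊x j⌋, ?_⟩⟩
  rw [EuclideanSpace.norm_eq]
  refine Real.sqrt_le_sqrt ?_
  calc ∑ j, ‖(x - latVec d fun j => ⌊x j⌋) j‖ ^ 2 ≤ ∑ j : Fin d, (1 : ℝ) := by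
        refine Finset.sum_le_sum fun j _ => ?_
        rw [PiLp.sub_apply, latVec_apply, Int.self_sub_floor,
          Real.norm_of_nonneg (Int.fract_nonneg (x j))]
        exact pow_le_one₀ (Int.fract_nonneg _) (Int.fract_lt_one _).le
    _ = d := by simp

/-- Lattice sums of translates of a rapidly decreasing function are uniformly bounded. -/
lemma exists_tsum_latVec_le (φ : 𝓢(Euc d, ℂ)) : ∃ S : ℝ≥0∞, S ≠ ∞ ∧ ∀ x : Euc d,
    ∑' z : Zd d, ENNReal.ofReal ((1 + ‖x - latVec d z‖) * ‖φ (x - latVec d z)‖) ≤ S := by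
  obtain ⟨k, hk⟩ := exists_summable_one_add_norm_latVec d
  obtain ⟨R, hR, hfl⟩ := exists_norm_sub_latVec_floor_le d
  obtain ⟨C, hC⟩ : ∃ C : ℝ, ∀ x, (1 + ‖x‖) ^ (k + 1) * ‖φ x‖ ≤ C := ⟨_, fun x => by
    simpa using SchwartzMap.one_add_le_sup_seminorm_apply (𝕜 := ℝ) (m := (k + 1, 0))
      (k := k + 1) (n := 0) le_rfl le_rfl φ x⟩
  have hC0 : 0 ≤ C := (by positivity : (0 : ℝ) ≤ _).trans (hC 0)
  have hk' := hk.mul_left (C * (1 + R) ^ k)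
  refine ⟨ENNReal.ofReal (∑' n : Zd d, C * (1 + R) ^ k * ((1 + ‖latVec d n‖) ^ k)⁻¹),
    ENNReal.ofReal_ne_top, fun x => ?_⟩
  obtain ⟨m, hm⟩ := hfl x
  rw [ENNReal.ofReal_tsum_of_nonneg (fun n => by positivity) hk', ← (Equiv.addLeft m).tsum_eq]
  refine ENNReal.tsum_le_tsum fun n => ENNReal.ofReal_le_ofReal ?_
  rw [Equiv.coe_addLeft, latVec_add]
  set y := x - (latVec d m + latVec d n) with hy
  have h1 : ‖latVec d n‖ ≤ R + ‖y‖ := by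
    have : latVec d n = (x - latVec d m) - y := by rw [hy]; abel
    rw [this]
    exact (norm_sub_le _ _).trans (by gcongr)
  have h2 : 1 + ‖latVec d n‖ ≤ (1 + R) * (1 + ‖y‖) := by
    nlinarith [norm_nonneg y]
  have h3 : (1 + ‖latVec d n‖) ^ k ≤ (1 + R) ^ k * (1 + ‖y‖) ^ k := by
    rw [← mul_pow]; gcongr
  rw [← div_eq_mul_inv, le_div_iff₀ (by positivity)]
  calc (1 + ‖y‖) * ‖φ y‖ * (1 + ‖latVec d n‖) ^ k
      ≤ (1 + ‖y‖) * ‖φ y‖ * ((1 + R) ^ k * (1 + ‖y‖) ^ k) := by gcongr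
    _ = (1 + ‖y‖) ^ (k + 1) * ‖φ y‖ * (1 + R) ^ k := by ring
    _ ≤ C * (1 + R) ^ k := by gcongr; exact hC y

lemma lintegral_mul_sq_le {X : Type*} [MeasurableSpace X] {μ : Measure X} {p g : X → ℝ≥0∞}
    (hp : AEMeasurable p μ) (hg : AEMeasurable g μ) :
    (∫⁻ x, p x * g x ∂μ) ^ 2 ≤ (∫⁻ x, p x ∂μ) * ∫⁻ x, p x * g x ^ 2 ∂μ := by
  have h1 := ENNReal.lintegral_mul_le_Lp_mul_Lq μ Real.HolderConjugate.two_two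
    (hp.pow_const (1 / 2 : ℝ)) ((hp.pow_const (1 / 2 : ℝ)).mul hg)
  have hs : ∀ a : ℝ≥0∞, a ^ (1 / 2 : ℝ) * a ^ (1 / 2 : ℝ) = a := fun a => by
    rw [← ENNReal.rpow_add_of_nonneg _ _ (by norm_num) (by norm_num)]
    norm_num
  have hs' : ∀ a : ℝ≥0∞, (a ^ (1 / 2 : ℝ)) ^ 2 = a := fun a => by rw [sq, hs]
  simp only [Pi.mul_apply, ENNReal.rpow_two, mul_pow, hs', ← mul_assoc, hs] at h1
  calc (∫⁻ x, p x * g x ∂μ) ^ 2 ≤ _ := pow_le_pow_left₀ (zero_le) h1 2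
    _ = _ := by rw [mul_pow, hs', hs']

end

section

open scoped SchwartzMap

variable {d : ℕ}

lemma enorm_sq_eq_lintegral {X : Type*} [MeasurableSpace X] {μ : Measure X} (f : Lp ℂ 2 μ) :
    ‖f‖ₑ ^ 2 = ∫⁻ x, ‖f x‖ₑ ^ 2 ∂μ := by
  rw [Lp.enorm_def]
  have := eLpNorm_nnreal_pow_eq_lintegral (μ := μ) (f := f) (p := 2) two_ne_zero
  simpa using this

/-- Schur test for kernels dominated by the translates of a rapidly decreasing function. -/
lemma exists_norm_le_of_kernel_le (φ : 𝓢(Euc d, ℂ)) : ∃ C : ℝ, 0 ≤ C ∧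
    ∀ h : ℝ, 0 < h → ∀ ε : ℝ, 0 ≤ ε → ∀ (v : l2h d h) (f : L2 d),
      (∀ z, ‖(v : Zd d → ℂ) z‖ₑ ≤ (ENNReal.ofReal (h ^ d))⁻¹ * ENNReal.ofReal ε *
        ∫⁻ x, ENNReal.ofReal ((1 + ‖h⁻¹ • (x - latPt d h z)‖) * ‖φ (h⁻¹ • (x - latPt d h z))‖) *
          ‖(f : Euc d → ℂ) x‖ₑ) → ‖v‖ ≤ ε * C * ‖f‖ := by
  obtain ⟨S, hS, hSle⟩ := exists_tsum_latVec_le φ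
  set ψ : Euc d → ℝ := fun y => (1 + ‖y‖) * ‖φ y‖ with hψ
  have hψ0 : ∀ y, 0 ≤ ψ y := fun y => by positivity
  have hψc : Continuous ψ := by
    have := φ.continuous
    fun_prop
  have hψi : Integrable ψ volume := by
    have h0 := φ.integrable_pow_mul volume 0
    have h1 := φ.integrable_pow_mul volume 1
    refine (h0.add h1).congr (ae_of_all _ fun x => ?_)
    simp [hψ]
    ring
  set A := ∫ y, ψ y with hA
  have hA0 : 0 ≤ A := integral_nonneg hψ0
  refine ⟨√(A * S.toReal), Real.sqrt_nonneg _, fun h hh ε hε v f hv => ?_⟩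
  have hhd : 0 < h ^ d := by positivity
  set N := ENNReal.ofReal (h ^ d) with hN
  have hN0 : N ≠ 0 := by simpa [hN] using hhd
  have hNt : N ≠ ∞ := ENNReal.ofReal_ne_top
  set k : Zd d → Euc d → ℝ≥0∞ := fun z x => ENNReal.ofReal (ψ (h⁻¹ • (x - latPt d h z))) with hk
  have hkm : ∀ z, Measurable (k z) := fun z => by
    refine ENNReal.measurable_ofReal.comp (hψc.measurable.comp ?_)
    fun_prop
  have hkint : ∀ z, ∫⁻ x, k z x = N * ENNReal.ofReal A := fun z => by
    have hi : Integrable (fun x => ψ (h⁻¹ • (x - latPt d h z))) volume :=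
      ((hψi.comp_smul (inv_ne_zero hh.ne')).comp_sub_right (latPt d h z))
    have h1 := ofReal_integral_eq_lintegral_ofReal hi (ae_of_all _ fun x => hψ0 _)
    rw [hk, ← h1, integral_sub_right_eq_self (fun x => ψ (h⁻¹ • x)),
      Measure.integral_comp_inv_smul_of_nonneg _ _ hh.le, smul_eq_mul, hN,
      ← ENNReal.ofReal_mul hhd.le, finrank_euclideanSpace_fin]
  have hksum : ∀ x, ∑' z, k z x ≤ S := fun x => by
    refine le_trans (le_of_eq ?_) (hSle (h⁻¹ • x))
    refine tsum_congr fun z => ?_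
    simp only [hk, hψ, latPt_eq_smul, smul_sub, inv_smul_smul₀ hh.ne']
  have hfm : AEMeasurable (fun x => ‖(f : Euc d → ℂ) x‖ₑ) volume :=
    (Lp.aestronglyMeasurable f).enorm
  have hpt : ∀ z, ‖(v : Zd d → ℂ) z‖ₑ ^ 2 ≤ (N⁻¹ * ENNReal.ofReal ε) ^ 2 *
      ((N * ENNReal.ofReal A) * ∫⁻ x, k z x * ‖(f : Euc d → ℂ) x‖ₑ ^ 2) := fun z => by
    refine (pow_le_pow_left₀ (zero_le) (hv z) 2).trans ?_
    rw [mul_pow, ← hkint z]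
    gcongr
    exact lintegral_mul_sq_le (hkm z).aemeasurable hfm
  have hsum : ∑' z, ∫⁻ x, k z x * ‖(f : Euc d → ℂ) x‖ₑ ^ 2 ≤ S * ‖f‖ₑ ^ 2 := by
    have := lintegral_tsum (μ := volume) (f := fun z x => k z x * ‖(f : Euc d → ℂ) x‖ₑ ^ 2)
      fun z => (hkm z).aemeasurable.mul (hfm.pow_const 2)
    rw [← this, enorm_sq_eq_lintegral, ← lintegral_const_mul' _ _ hS]
    refine lintegral_mono fun x => ?_
    rw [ENNReal.tsum_mul_right]
    gcongr
    exact hksum x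
  have hfin : ‖v‖ₑ ^ 2 ≤ ENNReal.ofReal ε ^ 2 * ENNReal.ofReal A * S * ‖f‖ₑ ^ 2 := by
    rw [enorm_sq_eq_lintegral, lintegral_countable']
    have hm : ∀ z, latMeas d h {z} = N := fun z => by simp [latMeas, hN]
    simp only [hm]
    rw [ENNReal.tsum_mul_right]
    calc (∑' z, ‖(v : Zd d → ℂ) z‖ₑ ^ 2) * N
        ≤ (∑' z, (N⁻¹ * ENNReal.ofReal ε) ^ 2 *
          ((N * ENNReal.ofReal A) * ∫⁻ x, k z x * ‖(f : Euc d → ℂ) x‖ₑ ^ 2)) * N := by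
          gcongr with z
          exact hpt z
      _ = (N⁻¹ * N) ^ 2 * ENNReal.ofReal ε ^ 2 * ENNReal.ofReal A *
          ∑' z, ∫⁻ x, k z x * ‖(f : Euc d → ℂ) x‖ₑ ^ 2 := by
          rw [ENNReal.tsum_mul_left, ENNReal.tsum_mul_left]
          ring
      _ ≤ ENNReal.ofReal ε ^ 2 * ENNReal.ofReal A * (S * ‖f‖ₑ ^ 2) := by
          rw [ENNReal.inv_mul_cancel hN0 hNt, one_pow, one_mul]
          gcongr
      _ = _ := by ring
  have hreal : ‖v‖ ^ 2 ≤ ε ^ 2 * A * S.toReal * ‖f‖ ^ 2 := by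
    have ht : ENNReal.ofReal ε ^ 2 * ENNReal.ofReal A * S * ‖f‖ₑ ^ 2 ≠ ∞ :=
      ENNReal.mul_ne_top (ENNReal.mul_ne_top (ENNReal.mul_ne_top (by simp) (by simp)) hS)
        (by simp)
    have := ENNReal.toReal_mono ht hfin
    simpa [ENNReal.toReal_mul, ENNReal.toReal_ofReal hε, ENNReal.toReal_ofReal hA0] using this
  refine le_of_sq_le_sq ?_ (by positivity)
  rw [mul_pow, mul_pow, Real.sq_sqrt (by positivity)]
  linarith

end

section

open scoped SchwartzMap

variable {d : ℕ}

lemma exists_abs_sub_le_of_uniformContinuous {m : Euc d → ℝ} (hm1 : ∀ x, |m x| ≤ 1)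
    (hmu : UniformContinuous m) {ε : ℝ} (hε : 0 < ε) :
    ∃ h₀ > (0 : ℝ), ∀ h : ℝ, 0 < h → h < h₀ → ∀ x y,
      |m x - m y| ≤ ε * (1 + ‖h⁻¹ • (x - y)‖) := by
  obtain ⟨r, hr, hru⟩ := Metric.uniformContinuous_iff.mp hmu ε hε
  refine ⟨ε * r / 2, by positivity, fun h hh hlt x y => ?_⟩
  rw [norm_smul, Real.norm_of_nonneg (inv_nonneg.mpr hh.le), ← dist_eq_norm x y]
  rcases lt_or_ge (dist x y) r with hxy | hxy
  · have h1 := hru hxy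
    rw [Real.dist_eq] at h1
    have : 0 ≤ ε * (h⁻¹ * dist x y) := by positivity
    linarith
  · have h1 : |m x - m y| ≤ 2 := (abs_sub _ _).trans (by linarith [hm1 x, hm1 y])
    have h2 : 2 ≤ ε * (h⁻¹ * dist x y) := by
      have : ε * (h⁻¹ * dist x y) = ε * dist x y / h := by ring
      rw [this, le_div_iff₀ hh]
      nlinarith
    linarith

lemma exists_norm_proj_mulOp_sub_le (φ : 𝓢(Euc d, ℂ)) {m : Euc d → ℝ} (hm : Measurable m)
    (hm1 : ∀ x, |m x| ≤ 1) (hmu : UniformContinuous m) {η : ℝ} (hη : 0 < η) :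
    ∃ h₀ > (0 : ℝ), ∀ h : ℝ, 0 < h → h < h₀ → ∀ P : L2 d →L[ℂ] l2h d h, IsProjOp d h φ P → ∀ f : L2 d,
      ‖mulOp (latMeas d h) (fun z => m (latPt d h z)) (measurable_of_countable _) 1
        (fun _ => hm1 _) (P f) - P (mulOp volume m hm 1 hm1 f)‖ ≤ η * ‖f‖ := by
  obtain ⟨C, hC, hker⟩ := exists_norm_le_of_kernel_le φ
  obtain ⟨h₀, hh₀, hle⟩ := exists_abs_sub_le_of_uniformContinuous hm1 hmu
    (show 0 < η / (C + 1) by positivity)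
  refine ⟨h₀, hh₀, fun h hh hlt P hP f => ?_⟩
  refine (hker h hh (η / (C + 1)) (by positivity) _ f fun z => ?_).trans ?_
  · set Q := mulOp (latMeas d h) (fun z => m (latPt d h z)) (measurable_of_countable _) 1
        (fun z => hm1 _) with hQ
    set g := mulOp volume m hm 1 hm1 f with hg
    have hval : ((Q (P f) - P g : l2h d h) : Zd d → ℂ) z = ((h : ℂ) ^ d)⁻¹ *
        ∫ x, conj (φ (h⁻¹ • (x - latPt d h z))) *
          (((m (latPt d h z) - m x : ℝ) : ℂ) * (f : Euc d → ℂ) x) := by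
      have h1 := (ae_latMeas_iff hh).mp (Lp.coeFn_sub (Q (P f)) (P g)) z
      have h2 := (ae_latMeas_iff hh).mp (coeFn_mulOp (μ := latMeas d h)
        (m := fun z => m (latPt d h z)) (hm := measurable_of_countable _) (C := 1)
        (hC := fun z => hm1 _) (P f)) z
      have hi : ∀ u : L2 d, Integrable (fun x => conj (φ (h⁻¹ • (x - latPt d h z))) *
          (u : Euc d → ℂ) x) volume := fun u => by
        refine (L2.integrable_inner (𝕜 := ℂ) ((waveS hh φ z).toLp 2 volume) u).congr ?_
        filter_upwards [(waveS hh φ z).coeFn_toLp 2 volume] with x hx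
        rw [hx, waveS_apply, RCLike.inner_apply, mul_comm]
      simp only [] at h2
      rw [h1, Pi.sub_apply, hQ, h2, hP, hP, mul_left_comm, ← mul_sub, ← integral_const_mul,
        ← integral_sub ((hi f).const_mul _) (hi g)]
      congr 1
      refine integral_congr_ae ?_
      filter_upwards [coeFn_mulOp (μ := volume) (m := m) (hm := hm) (C := 1) (hC := hm1) f]
        with x hx
      rw [hg, hx]
      push_cast
      ring
    have hhd : (0 : ℝ) < h ^ d := by positivity
    have hN : ‖((h : ℂ) ^ d)⁻¹‖ₑ = (ENNReal.ofReal (h ^ d))⁻¹ := by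
      rw [← ofReal_norm, norm_inv, norm_pow, Complex.norm_of_nonneg hh.le,
        ENNReal.ofReal_inv_of_pos hhd]
    rw [hval, enorm_mul, hN, mul_assoc]
    gcongr
    refine (enorm_integral_le_lintegral_enorm _).trans ?_
    rw [← lintegral_const_mul' _ _ ENNReal.ofReal_ne_top]
    refine lintegral_mono fun x => ?_
    rw [enorm_mul, enorm_mul, ← mul_assoc, ← mul_assoc]
    refine mul_le_mul_left ?_ _
    rw [← ofReal_norm, ← ofReal_norm, ← ENNReal.ofReal_mul (norm_nonneg _),
      ← ENNReal.ofReal_mul (by positivity)]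
    refine ENNReal.ofReal_le_ofReal ?_
    rw [RCLike.norm_conj, Complex.norm_real, Real.norm_eq_abs, abs_sub_comm]
    calc ‖φ (h⁻¹ • (x - latPt d h z))‖ * |m x - m (latPt d h z)|
        ≤ ‖φ (h⁻¹ • (x - latPt d h z))‖ *
          (η / (C + 1) * (1 + ‖h⁻¹ • (x - latPt d h z)‖)) := by
          gcongr
          exact hle h hh hlt _ _
      _ = _ := by ring
  · gcongr
    rw [div_mul_eq_mul_div, div_le_iff₀ (by positivity)]
    nlinarith

end

section

open scoped SchwartzMap

variable {d : ℕ}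

lemma exists_small_step {k₁ k₂ C D η : ℝ} (hk₁ : 0 ≤ k₁) (hk₂ : 0 ≤ k₂) (hC : 0 ≤ C)
    (hD : 0 ≤ D) (hη : 0 < η) :
    ∃ h₀ > (0 : ℝ), h₀ ≤ 1 ∧ ∃ ε > (0 : ℝ), ∀ h : ℝ, 0 < h → h < h₀ →
      k₁ * h ^ 2 * D + D * ε ≤ η ∧ k₂ * h ^ 2 * C ≤ η := by
  set A := k₁ * D + k₂ * C with hA
  have hA₁ : 0 ≤ k₁ * D := by positivity
  have hA₂ : 0 ≤ k₂ * C := by positivity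
  refine ⟨min 1 (η / (2 * (A + 1))), by positivity, min_le_left _ _, η / (2 * (D + 1)),
    by positivity, fun h hh hlt => ?_⟩
  have h1 : h < 1 := hlt.trans_le (min_le_left _ _)
  have h2 : h * (2 * (A + 1)) < η :=
    (lt_div_iff₀ (by positivity)).mp (hlt.trans_le (min_le_right _ _))
  have h3 : A * h ^ 2 ≤ η / 2 := by
    nlinarith [mul_nonneg (add_nonneg hA₁ hA₂) hh.le]
  have h4 : D * (η / (2 * (D + 1))) ≤ η / 2 := by
    rw [mul_div_assoc', div_le_iff₀ (by positivity)]
    nlinarith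
  have h5 : 0 ≤ k₁ * D * h ^ 2 := by positivity
  have h6 : 0 ≤ k₂ * C * h ^ 2 := by positivity
  have h7 : A * h ^ 2 = k₁ * D * h ^ 2 + k₂ * C * h ^ 2 := by rw [hA]; ring
  constructor <;> linarith

/-- An abstract comparison of the solution operators of `L + W` and `L' + W'`. -/
lemma norm_solution_sub_le {E F : Type*} [NormedAddCommGroup E] [InnerProductSpace ℂ E]
    [NormedAddCommGroup F] [InnerProductSpace ℂ F] [CompleteSpace F]
    {P : E →L[ℂ] F} {B L Q : F →L[ℂ] F} {g n q : E} {κ ε C₁ C₂ : ℝ}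
    (hκ : 0 ≤ κ) (hε : 0 ≤ ε) (hC₁ : 0 ≤ C₁)
    (hB : IsSelfAdjoint B) (hQ : IsSelfAdjoint Q) (hBQ : ∀ w, B w = Q (w - L (B w)))
    (hBn : ∀ w, ‖w - L (B w)‖ ≤ C₁ * ‖w‖ ∧ ‖L (B w)‖ ≤ C₁ * ‖w‖)
    (hL : ∀ v, ‖(inner ℂ (L v) (P g) : ℂ) - inner ℂ v (P n)‖ ≤ κ * (‖L v‖ * ‖n‖))
    (hcomm : ‖Q (P q) - P g‖ ≤ ε * ‖q‖) (hq : ‖q‖ ≤ C₂ * ‖n + q‖) (hn : ‖n‖ ≤ C₂ * ‖n + q‖) :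
    ‖B (P (n + q)) - P g‖ ≤ (κ * (C₁ * C₂) + C₁ * C₂ * ε) * ‖n + q‖ := by
  set f := n + q with hf
  set w := B (P f) - P g with hw
  set v := B w with hv
  set a := w - L v with ha
  have hva : v = Q a := hBQ w
  have hid : (inner ℂ w w : ℂ) = -(inner ℂ (L v) (P g) - inner ℂ v (P n)) +
      inner ℂ a (Q (P q) - P g) := by
    have h1 : (inner ℂ w (B (P f)) : ℂ) = inner ℂ v (P f) := by
      rw [hv, ← ContinuousLinearMap.adjoint_inner_right, hB.adjoint_eq]
    have h2 : (inner ℂ v (P q) : ℂ) = inner ℂ a (Q (P q)) := by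
      rw [hva, ← ContinuousLinearMap.adjoint_inner_right, hQ.adjoint_eq]
    have h3 : (inner ℂ w (P g) : ℂ) = inner ℂ a (P g) + inner ℂ (L v) (P g) := by
      rw [← inner_add_left, ha, sub_add_cancel]
    calc (inner ℂ w w : ℂ) = inner ℂ w (B (P f)) - inner ℂ w (P g) := by
          rw [← inner_sub_right]
      _ = _ := by
        rw [h1, h3, hf, map_add, inner_add_right, h2, inner_sub_right]
        ring
  obtain ⟨han, hLn⟩ := hBn w
  have hww : ‖w‖ * ‖w‖ = ‖(inner ℂ w w : ℂ)‖ := by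
    rw [inner_self_eq_norm_sq_to_K, norm_pow]
    simp [sq]
  have hmain : ‖w‖ * ‖w‖ ≤ ‖w‖ * ((κ * (C₁ * C₂) + C₁ * C₂ * ε) * ‖f‖) := by
    rw [hww, hid]
    refine (norm_add_le _ _).trans ?_
    rw [norm_neg]
    have e2 := norm_inner_le_norm (𝕜 := ℂ) a (Q (P q) - P g)
    have e3 : ε * ‖q‖ ≤ ε * (C₂ * ‖f‖) := by gcongr
    calc _ ≤ κ * ((C₁ * ‖w‖) * (C₂ * ‖f‖)) + (C₁ * ‖w‖) * (ε * (C₂ * ‖f‖)) := by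
          refine add_le_add ((hL v).trans ?_) (e2.trans ?_)
          · gcongr
          · exact mul_le_mul han (hcomm.trans e3) (norm_nonneg _) (by positivity)
      _ = _ := by ring
  rcases eq_or_lt_of_le (norm_nonneg w) with h0 | h0
  · have : 0 ≤ C₂ * ‖f‖ := (norm_nonneg _).trans hq
    rw [← h0]
    have h5 : 0 ≤ κ * C₁ * (C₂ * ‖f‖) + C₁ * (C₂ * ‖f‖) * ε := by positivity
    linarith
  · exact le_of_mul_le_mul_left hmain h0

set_option maxHeartbeats 1000000 in
/-- Norm convergence of resolvents below the bottom of the spectrum. -/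
theorem exists_resolvent_close {V W : Euc d → ℝ} {K c δ : ℝ} {φ : 𝓢(Euc d, ℂ)}
    (hφ : IsProfile φ δ) (hW : IsSlowPotential W c) (hWu : UniformContinuous fun x => (W x)⁻¹)
    (hWV : ∀ x, W x = V x + K) {H : L2 d →ₗ.[ℂ] L2 d} (hH : IsSchrodingerOp d V H) :
    ∃ B : L2 d →L[ℂ] L2 d, IsSelfAdjoint B ∧ IsResolventAt H (-(K : ℂ)) B ∧
      ∀ η > 0, ∃ h₀ > (0 : ℝ), ∀ h : ℝ, 0 < h → h < h₀ → ∀ P : L2 d →L[ℂ] l2h d h,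
        IsProjOp d h φ P → ∀ Hh, IsDiscreteHam d h V Hh → ∃ B' : l2h d h →L[ℂ] l2h d h,
          IsSelfAdjoint B' ∧ IsResolventAt Hh (-(K : ℂ)) B' ∧
          (∀ u, ‖B' (P u) - P (B u)‖ ≤ η * ‖u‖) ∧
          ∀ u, ‖B u - ContinuousLinearMap.adjoint P (P (B u))‖ ≤ η * ‖u‖ := by
  obtain ⟨B, hBs, hBr, hind⟩ := exists_schrodinger_resolvent hW hWV hH
  refine ⟨B, hBs, hBr, fun η hη => ?_⟩
  obtain ⟨C₁, hC₁, hlat⟩ := exists_lattice_resolvent hW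
  obtain ⟨C₂, hC₂, hell⟩ := norm_le_of_schrodinger_equation hW
  have hm : Measurable fun x => (W x)⁻¹ := hW.continuous.measurable.inv
  have hm1 : ∀ x, |(W x)⁻¹| ≤ 1 := fun x => by
    rw [abs_of_nonneg (inv_nonneg.mpr (hW.pos x).le)]
    exact inv_le_one_of_one_le₀ (hW.one_le x)
  have hδ := hφ.pos
  set κ := 1 / (4 * (2 * δ / π) ^ 2) with hκ
  have hκ0 : 0 ≤ κ := by positivity
  obtain ⟨h₁, hh₁, hh₁1, ε, hε, hsmall⟩ := exists_small_step (k₁ := κ) (k₂ := 32 / δ ^ 2)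
    (C := C₂) (D := C₁ * C₂) hκ0 (by positivity) hC₂ (by positivity) hη
  obtain ⟨h₂, hh₂, hcomm⟩ := exists_norm_proj_mulOp_sub_le φ hm hm1 hWu hε
  refine ⟨min h₁ h₂, lt_min hh₁ hh₂, fun h hh hlt P hP Hh hHh => ?_⟩
  have hlt₁ := hlt.trans_le (min_le_left _ _)
  have hlt₂ := hlt.trans_le (min_le_right _ _)
  obtain ⟨hb₁, hb₂⟩ := hsmall h hh hlt₁
  obtain ⟨B', hB's, hB'W, hB'n, hB'r⟩ := hlat h hh (hlt₁.le.trans hh₁1)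
  refine ⟨B', hB's, hB'r V K hWV Hh hHh, hind (fun u => ‖B' (P u) - P (B u)‖ ≤ η * ‖u‖) ?_ ?_,
    hind (fun u => ‖B u - ContinuousLinearMap.adjoint P (P (B u))‖ ≤ η * ‖u‖) ?_ ?_⟩
  · exact isClosed_le (by fun_prop) (by fun_prop)
  · intro g q hq hBg
    rw [hBg]
    obtain ⟨-, hqn, hgn⟩ := hell g q hq
    have hcomm' := hcomm h hh hlt₂ P hP q
    have hgq : mulOp volume _ hm 1 hm1 q = g.toLp 2 volume := by
      apply Lp.ext
      filter_upwards [coeFn_mulOp (μ := volume) (hm := hm) (hC := hm1) q, hq,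
        g.coeFn_toLp 2 volume] with x h1 h2 h3
      have : (W x : ℂ) ≠ 0 := by exact_mod_cast (hW.pos x).ne'
      rw [h1, h2, h3, ofReal_inv, inv_mul_cancel_left₀ this]
    rw [hgq] at hcomm'
    set Q := mulOp (latMeas d h) (fun z => (W (latPt d h z))⁻¹) (measurable_of_countable _) 1
        (fun _ => hm1 _) with hQ
    have hBQ : ∀ w, B' w = Q (w - latLap d h (B' w)) := fun w => by
      refine l2h_ext hh fun z => ?_
      have h1 := (ae_latMeas_iff hh).mp (coeFn_mulOp (μ := latMeas d h)
        (m := fun z => (W (latPt d h z))⁻¹) (hm := measurable_of_countable _) (C := 1)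
        (hC := fun _ => hm1 _) (w - latLap d h (B' w))) z
      simp only [] at h1
      have : (W (latPt d h z) : ℂ) ≠ 0 := by exact_mod_cast (hW.pos _).ne'
      rw [hQ, h1, hB'W w z, ofReal_inv, inv_mul_cancel_left₀ this]
    have hκh : h ^ 2 / (4 * (2 * δ / π) ^ 2) = κ * h ^ 2 := by rw [hκ]; ring
    refine (norm_solution_sub_le (κ := κ * h ^ 2) (by positivity) hε.le hC₁ hB's
      isSelfAdjoint_mulOp hBQ hB'n (fun v => ?_) hcomm' hqn hgn).trans (by gcongr)
    rw [← hκh]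
    exact hP.norm_inner_latLap_sub_le hφ hh v g
  · exact isClosed_le (by fun_prop) (by fun_prop)
  · intro g q hq hBg
    rw [hBg]
    obtain ⟨-, -, hgn⟩ := hell g q hq
    refine (hP.norm_sub_adjoint_apply_le hφ hh g).trans ?_
    calc _ ≤ 32 / δ ^ 2 * h ^ 2 * (C₂ * ‖(negLapS g).toLp 2 volume + q‖) := by gcongr
      _ = 32 / δ ^ 2 * h ^ 2 * C₂ * ‖(negLapS g).toLp 2 volume + q‖ := by ring
      _ ≤ _ := by gcongr

end

lemma uniformContinuous_inv_add_one {X : Type*} [PseudoMetricSpace X] {f : X → ℝ}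
    (hf : ∀ x, 0 < f x) (hu : UniformContinuous fun x => (f x)⁻¹) :
    UniformContinuous fun x => (f x + 1)⁻¹ := by
  rw [Metric.uniformContinuous_iff] at hu ⊢
  intro ε hε
  obtain ⟨r, hr, hru⟩ := hu ε hε
  refine ⟨r, hr, fun x y hxy => lt_of_le_of_lt ?_ (hru hxy)⟩
  have hx := hf x
  have hy := hf y
  rw [Real.dist_eq, Real.dist_eq, inv_sub_inv (by positivity) (by positivity),
    inv_sub_inv hx.ne' hy.ne', abs_div, abs_div, add_sub_add_right_eq_sub,
    abs_of_pos (mul_pos hx hy), abs_of_pos (by positivity : 0 < (f x + 1) * (f y + 1))]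
  gcongr <;> linarith

lemma isSlowPotential_add_one {d : ℕ} {V : Euc d → ℝ} {M c : ℝ} (hV : Continuous V)
    (hVM : ∀ x, 0 < V x + M) (hc : ∀ x y, dist x y ≤ 1 → V y + M ≤ c * (V x + M)) :
    IsSlowPotential (fun x => V x + M + 1) (max c 1) where
  continuous := by fun_prop
  one_le x := by linarith [hVM x]
  one_le_const := le_max_right _ _
  le_mul x y hxy := by
    have h1 : c * (V x + M) ≤ max c 1 * (V x + M) :=
      mul_le_mul_of_nonneg_right (le_max_left _ _) (hVM x).le
    linarith [hc x y hxy, le_max_right c 1]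

/-- Corollary 1 of the paper.  Suppose Assumptions (V) and (φ) hold, and
let `a < b` with `a, b ∉ σ(H)`.  Then `a, b ∉ σ(H_h)` for all sufficiently small `h > 0`,
and `‖P_h* E_{H_h}((a,b)) P_h − E_H((a,b))‖_{B(L²(ℝ^d))} → 0` as `h → 0`, where `E_A(Ω)`
denotes the spectral projection of the self-adjoint operator `A` associated to `Ω`. -/
theorem spectral_projection_convergence
    (d : ℕ) (φ : SchwartzMap (Euc d) ℂ)
    -- Assumption (φ)
    (hφ1 : ∀ ξ : Euc d, ∑' n : Zd d, ‖𝓕 ⇑φ (ξ + latVec d n)‖ ^ 2 = 1)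
    (hφ2 : tsupport (𝓕 ⇑φ) ⊆ {ξ : Euc d | ∀ j, ξ j ∈ Set.Ioo (-1 : ℝ) 1})
    -- Assumption (V)
    (V : Euc d → ℝ) (hVcont : Continuous V) (hVbdd : BddBelow (Set.range V))
    (M : ℝ) (hM : 0 < M) (hVM : ∀ x, 0 < V x + M)
    (hVu : UniformContinuous fun x => (V x + M)⁻¹)
    (c₁ : ℝ) (hc₁ : 0 < c₁)
    (hVcomp : ∀ x y : Euc d, dist x y ≤ 1 →
      c₁⁻¹ * (V x + M) ≤ V y + M ∧ V y + M ≤ c₁ * (V x + M))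
    -- the self-adjoint operator `H = −Δ + V`
    (H : L2 d →ₗ.[ℂ] L2 d) (hH : IsSchrodingerOp d V H)
    -- `a < b` with `a, b ∉ σ(H)`, i.e. `H − a` and `H − b` have bounded inverses
    (a b : ℝ) (hab : a < b)
    (Ra : L2 d →L[ℂ] L2 d) (hRa : IsResolventAt H (a : ℂ) Ra)
    (Rb : L2 d →L[ℂ] L2 d) (hRb : IsResolventAt H (b : ℂ) Rb)
    -- the spectral projection `E_H((a,b))`
    (ν : L2 d → Measure ℝ) (hν : IsSpectralMeasureFamily H ν)
    (EH : L2 d →L[ℂ] L2 d)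
    (hEH : ∀ u : L2 d, (inner ℂ u (EH u) : ℂ) = ((ν u (Set.Ioo a b)).toReal : ℝ)) :
    ∀ ε > (0 : ℝ), ∃ h₀ > (0 : ℝ), ∀ h : ℝ, 0 < h → h < h₀ →
      ∀ Ph : L2 d →L[ℂ] l2h d h, IsProjOp d h φ Ph →
      ∀ Hh : l2h d h →ₗ.[ℂ] l2h d h, IsDiscreteHam d h V Hh →
        -- `a, b ∉ σ(H_h)`
        ((∃ Sa : l2h d h →L[ℂ] l2h d h, IsResolventAt Hh (a : ℂ) Sa) ∧
         (∃ Sb : l2h d h →L[ℂ] l2h d h, IsResolventAt Hh (b : ℂ) Sb)) ∧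
        -- convergence of the spectral projections
        (∀ νh : l2h d h → Measure ℝ, IsSpectralMeasureFamily Hh νh →
          ∀ Eh : l2h d h →L[ℂ] l2h d h,
            (∀ v : l2h d h, (inner ℂ v (Eh v) : ℂ) = ((νh v (Set.Ioo a b)).toReal : ℝ)) →
            ‖(ContinuousLinearMap.adjoint Ph).comp (Eh.comp Ph) - EH‖ ≤ ε) := by
  intro ε hε
  obtain ⟨δ, hφ⟩ := exists_isProfile hφ1 hφ2
  obtain ⟨B, hBs, hB, hclose⟩ := exists_resolvent_close (K := M + 1) hφ
    (isSlowPotential_add_one hVcont hVM fun x y hxy => (hVcomp x y hxy).2)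
    (uniformContinuous_inv_add_one hVM hVu) (fun x => add_assoc _ _ _) hH
  obtain ⟨η, hη, hspec⟩ := exists_spectral_close hab hBs hB hRa hRb hν hEH hε
  obtain ⟨h₀, hh₀, hh⟩ := hclose η hη
  refine ⟨h₀, hh₀, fun h hpos hlt Ph hPh Hh hHh => ?_⟩
  obtain ⟨B', hB's, hB', hclose₁, hclose₂⟩ := hh h hpos hlt Ph hPh Hh hHh
  exact hspec _ Ph Hh B' hB's hB' (hPh.apply_adjoint hφ hpos) hclose₁ hclose₂
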